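/- arXiv:2108.05764 — 9 statements merged into one kernel-verified Lean document; each statement's English description precedes it below -/
import Mathlib

section
/- Let n ≥ 2 be an integer and let g : (0,1/2] → ℝ be a differentiable function satisfying: 1 + g(r) ≥ ε for some ε > 0 and all r, ∫_0^{1/2} |g′(r)| dr < ∞ (finite total variation), and ∫_0^{1/2} g(r)²/r dr < ∞ (square-Dini condition). Then there exists a solution v of the ordinary differential equation (r^{n−1}(1+g(r)) v′(r))′ = (n−1) r^{n−3} v(r) on (0,1/2) such that v(r) = r·exp[ ((n−1)/n) ∫_r^{1/2} g(ρ)/ρ dρ ]·(1 + o(1)) as r → 0⁺, i.e. the quotient v(r) / ( r·exp[ ((n−1)/n) ∫_r^{1/2} g(ρ)/ρ dρ ] ) tends to 1 as r → 0⁺. -/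
open Set Filter MeasureTheory

theorem continuousOn_integral_Ioo {R : ℝ} {f : ℝ → ℝ}
    (hf : ∀ r ∈ Ioo 0 R, IntervalIntegrable f volume 0 r) :
    ContinuousOn (fun r => ∫ ρ in (0:ℝ)..r, f ρ) (Ioo 0 R) := by
  intro r hr
  obtain ⟨s, hrs, hsR⟩ := exists_between hr.2
  have h := intervalIntegral.continuousOn_primitive_interval' (hf s ⟨hr.1.trans hrs, hsR⟩)
    (left_mem_uIcc)
  rw [uIcc_of_le (hr.1.trans hrs).le] at h
  exact (h.continuousAt (Icc_mem_nhds hr.1 hrs)).continuousWithinAt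

theorem hasDerivAt_integral_Ioo {R : ℝ} {f : ℝ → ℝ} (hc : ContinuousOn f (Ioo 0 R))
    (hf : ∀ r ∈ Ioo 0 R, IntervalIntegrable f volume 0 r) {r : ℝ} (hr : r ∈ Ioo 0 R) :
    HasDerivAt (fun r => ∫ ρ in (0:ℝ)..r, f ρ) (f r) r :=
  intervalIntegral.integral_hasDerivAt_right (hf r hr)
    (hc.stronglyMeasurableAtFilter isOpen_Ioo r hr) (hc.continuousAt (isOpen_Ioo.mem_nhds hr))

/-- Between an ordered pair of nonnegative sub- and supersolutions vanishing at `0`, the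
cooperative linear system `uᵢ' = cᵢ u_{σ i}` has a solution. -/
theorem exists_solution_between {ι : Type*} (σ : ι → ι) {R : ℝ} (c l l' w w' : ι → ℝ → ℝ)
    (hc : ∀ i, ContinuousOn (c i) (Ioo 0 R)) (hc0 : ∀ i, ∀ r ∈ Ioo 0 R, 0 ≤ c i r)
    (hl : ∀ i, ContinuousOn (l i) (Ico 0 R)) (hw : ∀ i, ContinuousOn (w i) (Ico 0 R))
    (hl0 : ∀ i, l i 0 = 0) (hw0 : ∀ i, w i 0 = 0)
    (hl' : ∀ i, ∀ r ∈ Ioo 0 R, HasDerivAt (l i) (l' i r) r)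
    (hw' : ∀ i, ∀ r ∈ Ioo 0 R, HasDerivAt (w i) (w' i r) r)
    (hsub : ∀ i, ∀ r ∈ Ioo 0 R, l' i r ≤ c i r * l (σ i) r)
    (hsup : ∀ i, ∀ r ∈ Ioo 0 R, c i r * w (σ i) r ≤ w' i r)
    (hlnn : ∀ i, ∀ r ∈ Ioo 0 R, 0 ≤ l i r) (hlw : ∀ i, ∀ r ∈ Ioo 0 R, l i r ≤ w i r) :
    ∃ u : ι → ℝ → ℝ, (∀ i, ∀ r ∈ Ioo 0 R, l i r ≤ u i r ∧ u i r ≤ w i r) ∧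
      ∀ i, ∀ r ∈ Ioo 0 R, HasDerivAt (u i) (c i r * u (σ i) r) r := by
  have hIoc : ∀ r ∈ Ioo 0 R, Ioc 0 r ⊆ Ioo 0 R := fun r hr x hx => ⟨hx.1, hx.2.trans_lt hr.2⟩
  have hIcc : ∀ r ∈ Ioo 0 R, Icc 0 r ⊆ Ico 0 R := fun r hr x hx => ⟨hx.1, hx.2.trans_lt hr.2⟩
  have meas : ∀ f : ℝ → ℝ, ContinuousOn f (Ioo 0 R) → ∀ r ∈ Ioo 0 R,
      AEStronglyMeasurable f (volume.restrict (Ioc 0 r)) := fun f hf r hr =>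
    (hf.mono (hIoc r hr)).aestronglyMeasurable measurableSet_Ioc
  have hwint : ∀ i, ∀ r ∈ Ioo 0 R,
      IntervalIntegrable (fun ρ => c i ρ * w (σ i) ρ) volume 0 r := by
    intro i r hr
    rw [intervalIntegrable_iff_integrableOn_Ioc_of_le hr.1.le]
    have hr' : ∀ x ∈ Ioo 0 r, x ∈ Ioo 0 R := fun x hx => ⟨hx.1, hx.2.trans hr.2⟩
    have h1 : IntegrableOn (w' i) (Ioc 0 r) := by
      refine intervalIntegral.integrableOn_deriv_of_nonneg ((hw i).mono (hIcc r hr))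
        (fun x hx => hw' i x (hr' x hx)) fun x hx => ?_
      exact (mul_nonneg (hc0 i x (hr' x hx))
        ((hlnn _ x (hr' x hx)).trans (hlw _ x (hr' x hx)))).trans (hsup i x (hr' x hx))
    refine Integrable.mono' h1 (meas _ ((hc i).mul ((hw _).mono Ioo_subset_Ico_self)) r hr) ?_
    refine (ae_restrict_iff' measurableSet_Ioc).2 (ae_of_all _ fun x hx => ?_)
    have hx := hIoc r hr hx
    rw [Real.norm_of_nonneg (mul_nonneg (hc0 i x hx) ((hlnn _ x hx).trans (hlw _ x hx)))]
    exact hsup i x hx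
  have hint : ∀ u : ι → ℝ → ℝ, (∀ i, ∀ r ∈ Ioo 0 R, l i r ≤ u i r ∧ u i r ≤ w i r) →
      (∀ i, ∀ r ∈ Ioo 0 R, AEStronglyMeasurable (u i) (volume.restrict (Ioc 0 r))) →
      ∀ i, ∀ r ∈ Ioo 0 R, IntervalIntegrable (fun ρ => c i ρ * u (σ i) ρ) volume 0 r := by
    intro u hu hm i r hr
    have h1 := hwint i r hr
    rw [intervalIntegrable_iff_integrableOn_Ioc_of_le hr.1.le] at h1 ⊢
    refine Integrable.mono' h1 ((meas _ (hc i) r hr).mul (hm _ r hr)) ?_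
    refine (ae_restrict_iff' measurableSet_Ioc).2 (ae_of_all _ fun x hx => ?_)
    have hx := hIoc r hr hx
    rw [Real.norm_of_nonneg (mul_nonneg (hc0 i x hx) ((hlnn _ x hx).trans (hu _ x hx).1))]
    exact mul_le_mul_of_nonneg_left (hu _ x hx).2 (hc0 i x hx)
  have hmono : ∀ (i) (f h : ℝ → ℝ) (r), r ∈ Ioo 0 R →
      IntervalIntegrable (fun ρ => c i ρ * f ρ) volume 0 r →
      IntervalIntegrable (fun ρ => c i ρ * h ρ) volume 0 r → (∀ x ∈ Ioo 0 R, f x ≤ h x) →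
      ∫ ρ in (0:ℝ)..r, c i ρ * f ρ ≤ ∫ ρ in (0:ℝ)..r, c i ρ * h ρ := by
    intro i f h r hr hf hh hfh
    refine intervalIntegral.integral_mono_on_of_le_Ioo hr.1.le hf hh fun x hx => ?_
    have hx : x ∈ Ioo 0 R := ⟨hx.1, hx.2.trans hr.2⟩
    exact mul_le_mul_of_nonneg_left (hfh x hx) (hc0 i x hx)
  have hlself : ∀ i, ∀ r ∈ Ioo 0 R, l i r ≤ l i r ∧ l i r ≤ w i r :=
    fun i r hr => ⟨le_rfl, hlw i r hr⟩
  have hlint := hint l hlself fun i => meas _ ((hl i).mono Ioo_subset_Ico_self)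
  have hlT : ∀ i, ∀ r ∈ Ioo 0 R, l i r ≤ ∫ ρ in (0:ℝ)..r, c i ρ * l (σ i) ρ := by
    intro i r hr
    have h := intervalIntegral.sub_le_integral_of_hasDeriv_right_of_le hr.1.le
      ((hl i).mono (hIcc r hr))
      (fun x hx => (hl' i x ⟨hx.1, hx.2.trans hr.2⟩).hasDerivWithinAt)
      ((intervalIntegrable_iff_integrableOn_Icc_of_le hr.1.le).1 (hlint i r hr))
      (fun x hx => hsub i x ⟨hx.1, hx.2.trans hr.2⟩)
    rwa [hl0, sub_zero] at h
  have hwT : ∀ i, ∀ r ∈ Ioo 0 R, ∫ ρ in (0:ℝ)..r, c i ρ * w (σ i) ρ ≤ w i r := by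
    intro i r hr
    have h := intervalIntegral.integral_le_sub_of_hasDeriv_right_of_le hr.1.le
      ((hw i).mono (hIcc r hr))
      (fun x hx => (hw' i x ⟨hx.1, hx.2.trans hr.2⟩).hasDerivWithinAt)
      ((intervalIntegrable_iff_integrableOn_Icc_of_le hr.1.le).1 (hwint i r hr))
      (fun x hx => hsup i x ⟨hx.1, hx.2.trans hr.2⟩)
    rwa [hw0, sub_zero] at h
  let T : (ι → ℝ → ℝ) → ι → ℝ → ℝ := fun u i r => ∫ ρ in (0:ℝ)..r, c i ρ * u (σ i) ρ
  let U : ℕ → ι → ℝ → ℝ := fun k => T^[k] l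
  have hUs : ∀ k, U (k + 1) = T (U k) := fun k => Function.iterate_succ_apply' T k l
  have hU : ∀ k, (∀ i, ContinuousOn (U k i) (Ioo 0 R)) ∧
      ∀ i, ∀ r ∈ Ioo 0 R, l i r ≤ U k i r ∧ U k i r ≤ w i r := by
    intro k
    induction k with
    | zero => exact ⟨fun i => (hl i).mono Ioo_subset_Ico_self, hlself⟩
    | succ k ih =>
      have hi := hint (U k) ih.2 fun i => meas _ (ih.1 i)
      rw [hUs]
      refine ⟨fun i => continuousOn_integral_Ioo (hi i), fun i r hr => ⟨?_, ?_⟩⟩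
      · exact (hlT i r hr).trans
          (hmono i _ _ r hr (hlint i r hr) (hi i r hr) fun x hx => (ih.2 _ x hx).1)
      · exact (hmono i _ _ r hr (hi i r hr) (hwint i r hr) fun x hx => (ih.2 _ x hx).2).trans
          (hwT i r hr)
  have hUint : ∀ k, ∀ i, ∀ r ∈ Ioo 0 R,
      IntervalIntegrable (fun ρ => c i ρ * U k (σ i) ρ) volume 0 r :=
    fun k => hint (U k) (hU k).2 fun i => meas _ ((hU k).1 i)
  have hUmono : ∀ i, ∀ r ∈ Ioo 0 R, Monotone fun k => U k i r := by
    intro i r hr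
    refine monotone_nat_of_le_succ fun k => ?_
    induction k generalizing i r with
    | zero => rw [hUs]; exact hlT i r hr
    | succ k ih =>
      rw [hUs (k + 1), hUs k]
      have := hmono i _ _ r hr (hUint k i r hr) (hUint (k + 1) i r hr) fun x hx => ih _ x hx
      rwa [hUs k] at this
  have hlim : ∀ i, ∀ r ∈ Ioo 0 R, Tendsto (fun k => U k i r) atTop (nhds (⨆ k, U k i r)) :=
    fun i r hr => tendsto_atTop_ciSup (hUmono i r hr)
      ⟨w i r, by rintro _ ⟨k, rfl⟩; exact ((hU k).2 i r hr).2⟩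
  let u : ι → ℝ → ℝ := fun i r => ⨆ k, U k i r
  have hu : ∀ i, ∀ r ∈ Ioo 0 R, l i r ≤ u i r ∧ u i r ≤ w i r := fun i r hr =>
    ⟨ge_of_tendsto' (hlim i r hr) fun k => ((hU k).2 i r hr).1,
      le_of_tendsto' (hlim i r hr) fun k => ((hU k).2 i r hr).2⟩
  have huint := hint u hu fun i r hr =>
    aestronglyMeasurable_of_tendsto_ae atTop (fun k => meas _ ((hU k).1 i) r hr)
      ((ae_restrict_iff' measurableSet_Ioc).2 (ae_of_all _ fun x hx => hlim i x (hIoc r hr hx)))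
  have hfix : ∀ i, ∀ r ∈ Ioo 0 R, u i r = ∫ ρ in (0:ℝ)..r, c i ρ * u (σ i) ρ := by
    intro i r hr
    refine tendsto_nhds_unique ((hlim i r hr).comp (tendsto_add_atTop_nat 1)) ?_
    have : (fun k => U k i r) ∘ (fun k => k + 1) =
        fun k => ∫ ρ in (0:ℝ)..r, c i ρ * U k (σ i) ρ := by
      funext k; simp only [Function.comp, hUs, T]
    rw [this]
    refine intervalIntegral.tendsto_integral_filter_of_dominated_convergence
      (fun ρ => c i ρ * w (σ i) ρ) (Eventually.of_forall fun k => ?_)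
      (Eventually.of_forall fun k => ae_of_all _ fun x hx => ?_) (hwint i r hr)
      (ae_of_all _ fun x hx => ?_)
    · exact (hUint k i r hr).aestronglyMeasurable_restrict_uIoc
    · rw [uIoc_of_le hr.1.le] at hx
      have hx := hIoc r hr hx
      rw [Real.norm_of_nonneg (mul_nonneg (hc0 i x hx) ((hlnn _ x hx).trans ((hU k).2 _ x hx).1))]
      exact mul_le_mul_of_nonneg_left ((hU k).2 _ x hx).2 (hc0 i x hx)
    · rw [uIoc_of_le hr.1.le] at hx
      exact (hlim _ x (hIoc r hr hx)).const_mul _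
  have hucont : ∀ i, ContinuousOn (u i) (Ioo 0 R) := fun i =>
    (continuousOn_integral_Ioo (huint i)).congr (hfix i)
  refine ⟨u, hu, fun i r hr => ?_⟩
  refine (hasDerivAt_integral_Ioo ((hc i).mul (hucont (σ i))) (huint i) hr).congr_of_eventuallyEq ?_
  filter_upwards [isOpen_Ioo.mem_nhds hr] with s hs using hfix i s hs

theorem continuousOn_Ico_of_hasDerivAt {R : ℝ} {f f' : ℝ → ℝ} (h0 : f 0 = 0)
    (hlim : Tendsto f (nhdsWithin 0 (Ioi 0)) (nhds 0))
    (hf : ∀ r ∈ Ioo 0 R, HasDerivAt f (f' r) r) : ContinuousOn f (Ico 0 R) := by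
  intro r hr
  rcases hr.1.eq_or_lt with rfl | h
  · refine ContinuousWithinAt.mono (t := Ici 0) ?_ fun x hx => hx.1
    rw [← continuousWithinAt_Ioi_iff_Ici]
    simpa only [ContinuousWithinAt, h0] using hlim
  · exact (hf r ⟨h, hr.2⟩).continuousAt.continuousWithinAt

theorem tendsto_mul_exp_integral_div {R μ : ℝ} {g : ℝ → ℝ} (hμ0 : 0 ≤ μ) (hμ1 : μ ≤ 1)
    (hR : 0 < R) (hg : ContinuousOn g (Ioc 0 R))
    (hsq : IntegrableOn (fun r => g r ^ 2 / r) (Ioc 0 R)) :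
    Tendsto (fun r => r * Real.exp (μ * ∫ ρ in r..R, g ρ / ρ)) (nhdsWithin 0 (Ioi 0))
      (nhds 0) := by
  set K := ∫ ρ in (0:ℝ)..R, g ρ ^ 2 / ρ with hK
  have hsq' : IntervalIntegrable (fun r => g r ^ 2 / r) volume 0 R :=
    (intervalIntegrable_iff_integrableOn_Ioc_of_le hR.le).2 hsq
  have hsqnn : ∀ x, 0 ≤ x → 0 ≤ g x ^ 2 / x := fun x hx => by positivity
  have hbound : ∀ r ∈ Ioo 0 R, r * Real.exp (μ * ∫ ρ in r..R, g ρ / ρ) ≤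
      Real.exp (Real.log r * (1 / 2) + (Real.log R / 2 + K / 2)) := by
    intro r hr
    have hsub : uIcc r R ⊆ Ioc 0 R := by
      rw [uIcc_of_le hr.2.le]; exact fun x hx => ⟨hr.1.trans_le hx.1, hx.2⟩
    have hne : ∀ x ∈ uIcc r R, x ≠ 0 := fun x hx => (hsub hx).1.ne'
    have i1 : IntervalIntegrable (fun ρ => g ρ / ρ) volume r R :=
      ((hg.mono hsub).div continuousOn_id hne).intervalIntegrable
    have i2 : IntervalIntegrable (fun ρ => g ρ ^ 2 / ρ) volume r R :=
      (((hg.mono hsub).pow 2).div continuousOn_id hne).intervalIntegrable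
    have i3 : IntervalIntegrable (fun ρ : ℝ => ρ⁻¹) volume r R :=
      (continuousOn_id.inv₀ hne).intervalIntegrable
    have h1 : ∫ ρ in r..R, g ρ / ρ ≤ ∫ ρ in r..R, ((1 / 2) * ρ⁻¹ + (1 / 2) * (g ρ ^ 2 / ρ)) := by
      refine intervalIntegral.integral_mono_on hr.2.le i1
        ((i3.const_mul _).add (i2.const_mul _)) fun x hx => ?_
      have hx0 : 0 < x := hr.1.trans_le hx.1
      have : (1 / 2) * x⁻¹ + (1 / 2) * (g x ^ 2 / x) - g x / x = (1 / 2) * ((g x - 1) ^ 2 / x) := by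
        field_simp; ring
      have h2 : 0 ≤ (g x - 1) ^ 2 / x := by positivity
      linarith
    rw [intervalIntegral.integral_add (i3.const_mul _) (i2.const_mul _),
      intervalIntegral.integral_const_mul, intervalIntegral.integral_const_mul,
      integral_inv_of_pos hr.1 hR, Real.log_div hR.ne' hr.1.ne'] at h1
    have h2 : ∫ ρ in r..R, g ρ ^ 2 / ρ ≤ K := by
      refine intervalIntegral.integral_mono_interval hr.1.le hr.2.le le_rfl ?_ hsq'
      exact (ae_restrict_iff' measurableSet_Ioc).2 (ae_of_all _ fun x hx => hsqnn x hx.1.le)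
    have hK0 : 0 ≤ K := intervalIntegral.integral_nonneg hR.le fun x hx => hsqnn x hx.1
    have hlog : Real.log r ≤ Real.log R := Real.log_le_log hr.1 hr.2.le
    have h3 : μ * ∫ ρ in r..R, g ρ / ρ ≤ (Real.log R - Real.log r) / 2 + K / 2 :=
      calc μ * ∫ ρ in r..R, g ρ / ρ ≤ μ * ((Real.log R - Real.log r) / 2 + K / 2) :=
            mul_le_mul_of_nonneg_left (by linarith) hμ0
        _ ≤ _ := mul_le_of_le_one_left (by linarith) hμ1
    calc r * Real.exp (μ * ∫ ρ in r..R, g ρ / ρ)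
        = Real.exp (Real.log r + μ * ∫ ρ in r..R, g ρ / ρ) := by
          rw [Real.exp_add, Real.exp_log hr.1]
      _ ≤ _ := Real.exp_le_exp.2 (by linarith)
  have hlim : Tendsto (fun r => Real.exp (Real.log r * (1 / 2) + (Real.log R / 2 + K / 2)))
      (nhdsWithin 0 (Ioi 0)) (nhds 0) :=
    Real.tendsto_exp_atBot.comp (tendsto_atBot_add_const_right _ _
      (Real.tendsto_log_nhdsGT_zero.atBot_mul_const (by norm_num)))
  refine tendsto_of_tendsto_of_tendsto_of_le_of_le' tendsto_const_nhds hlim ?_ ?_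
  · filter_upwards [self_mem_nhdsWithin] with r hr
    exact mul_nonneg (le_of_lt hr) (Real.exp_pos _).le
  · filter_upwards [Ioo_mem_nhdsGT hR] with r hr using hbound r hr

/-- The weighted average `ζ` of `g` and a nonnegative function `A` vanishing at `0`
with `r A' = 2 g² - 2 g ζ + 2 (k + 1) ζ²`. -/
theorem exists_average {R : ℝ} (k : ℕ) {g : ℝ → ℝ} (hR : 0 < R) (hg : ContinuousOn g (Ioc 0 R))
    (hsq : IntegrableOn (fun r => g r ^ 2 / r) (Ioc 0 R)) :
    ∃ ζ A : ℝ → ℝ,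
      (∀ r ∈ Ioo 0 R, HasDerivAt ζ ((g r - (k + 1) * ζ r) / r) r) ∧
      (∀ r ∈ Ioo 0 R,
        HasDerivAt A ((2 * g r ^ 2 - 2 * g r * ζ r + 2 * (k + 1) * ζ r ^ 2) / r) r) ∧
      Tendsto ζ (nhdsWithin 0 (Ioi 0)) (nhds 0) ∧ Tendsto A (nhdsWithin 0 (Ioi 0)) (nhds 0) ∧
      (∀ r ∈ Ioo 0 R, 0 ≤ A r) ∧
      ∀ ε ≤ 1, (∀ r ∈ Ioo 0 R, ε ≤ 1 + g r) → ∀ r ∈ Ioo 0 R, ε ≤ 1 + ζ r := by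
  have hg' : ContinuousOn g (Ioo 0 R) := hg.mono Ioo_subset_Ioc_self
  have hIoc : ∀ r ∈ Ioo 0 R, Ioc 0 r ⊆ Ioc 0 R := fun r hr => Ioc_subset_Ioc_right hr.2.le
  have hsqR : IntervalIntegrable (fun r => g r ^ 2 / r) volume 0 R :=
    (intervalIntegrable_iff_integrableOn_Ioc_of_le hR.le).2 hsq
  have hsqi : ∀ r ∈ Ioo 0 R, IntervalIntegrable (fun ρ => g ρ ^ 2 / ρ) volume 0 r := fun r hr =>
    (intervalIntegrable_iff_integrableOn_Ioc_of_le hr.1.le).2 (hsq.mono_set (hIoc r hr))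
  have hpow : ∀ r, IntervalIntegrable (fun ρ : ℝ => ρ ^ k) volume 0 r := fun r =>
    (continuous_pow k).intervalIntegrable _ _
  have hyoung : ∀ τ > 0, ∀ r, ∀ x ∈ Ioc 0 r,
      |x ^ k * g x| ≤ τ * x ^ k + r ^ (k + 1) / τ * (g x ^ 2 / x) := by
    intro τ hτ r x hx
    have hx0 := hx.1
    have h1 : |g x| ≤ τ + g x ^ 2 / τ := by
      have h := sq_nonneg (|g x| - τ)
      rw [← sq_abs (g x), ← sub_nonneg]
      have : τ + |g x| ^ 2 / τ - |g x| = ((|g x| - τ) ^ 2 + τ * |g x|) / τ := by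
        field_simp; ring
      rw [this]; positivity
    have h2 : x ^ (k + 1) ≤ r ^ (k + 1) := pow_le_pow_left₀ hx0.le hx.2 _
    calc |x ^ k * g x| = x ^ k * |g x| := by rw [abs_mul, abs_of_pos (pow_pos hx0 k)]
      _ ≤ x ^ k * (τ + g x ^ 2 / τ) := mul_le_mul_of_nonneg_left h1 (by positivity)
      _ = τ * x ^ k + x ^ (k + 1) / τ * (g x ^ 2 / x) := by field_simp; ring
      _ ≤ _ := by gcongr
  have hint : ∀ r ∈ Ioo 0 R, IntervalIntegrable (fun ρ => ρ ^ k * g ρ) volume 0 r := by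
    intro r hr
    have h := ((hpow r).const_mul 1).add ((hsqi r hr).const_mul (r ^ (k + 1) / 1))
    rw [intervalIntegrable_iff_integrableOn_Ioc_of_le hr.1.le] at h ⊢
    refine Integrable.mono' h
      (((continuous_pow k).continuousOn.mul (hg.mono (hIoc r hr))).aestronglyMeasurable
        measurableSet_Ioc) ?_
    exact (ae_restrict_iff' measurableSet_Ioc).2
      (ae_of_all _ fun x hx => hyoung 1 one_pos r x hx)
  set I : ℝ → ℝ := fun r => ∫ ρ in (0:ℝ)..r, ρ ^ k * g ρ with hI
  set B : ℝ → ℝ := fun r => ∫ ρ in (0:ℝ)..r, g ρ ^ 2 / ρ with hB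
  have hIder : ∀ r ∈ Ioo 0 R, HasDerivAt I (r ^ k * g r) r := fun r hr =>
    hasDerivAt_integral_Ioo ((continuous_pow k).continuousOn.mul hg') hint hr
  have hBder : ∀ r ∈ Ioo 0 R, HasDerivAt B (g r ^ 2 / r) r := fun r hr =>
    hasDerivAt_integral_Ioo ((hg'.pow 2).div continuousOn_id fun x hx => hx.1.ne') hsqi hr
  have hBlim : Tendsto B (nhdsWithin 0 (Ioi 0)) (nhds 0) := by
    have h := intervalIntegral.continuousOn_primitive_interval' hsqR left_mem_uIcc
      0 left_mem_uIcc
    rw [uIcc_of_le hR.le] at h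
    have h' : Tendsto B (nhdsWithin 0 (Icc 0 R)) (nhds (B 0)) := h
    rw [show B 0 = 0 from intervalIntegral.integral_same] at h'
    refine h'.mono_left ?_
    rw [← nhdsWithin_Ioo_eq_nhdsGT hR]
    exact nhdsWithin_mono _ Ioo_subset_Icc_self
  set ζ : ℝ → ℝ := fun r => I r / r ^ (k + 1) with hζ
  have hζbound : ∀ τ > 0, ∀ r ∈ Ioo 0 R, |ζ r| ≤ τ + B r / τ := by
    intro τ hτ r hr
    have hr0 := hr.1
    have h1 : |I r| ≤ ∫ ρ in (0:ℝ)..r, (τ * ρ ^ k + r ^ (k + 1) / τ * (g ρ ^ 2 / ρ)) :=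
      intervalIntegral.norm_integral_le_of_norm_le (f := fun ρ => ρ ^ k * g ρ) hr.1.le
        (ae_of_all _ fun x hx => hyoung τ hτ r x hx)
        (((hpow r).const_mul _).add ((hsqi r hr).const_mul _))
    rw [intervalIntegral.integral_add ((hpow r).const_mul _) ((hsqi r hr).const_mul _),
      intervalIntegral.integral_const_mul, intervalIntegral.integral_const_mul, integral_pow] at h1
    rw [hζ, abs_div, abs_of_pos (pow_pos hr.1 (k + 1)), div_le_iff₀ (pow_pos hr.1 _)]
    refine h1.trans ?_
    have h2 : (r ^ (k + 1) - 0 ^ (k + 1)) / ((k:ℝ) + 1) ≤ r ^ (k + 1) := by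
      rw [zero_pow (Nat.succ_ne_zero k), sub_zero]
      exact div_le_self (by positivity) (by linarith [(Nat.cast_nonneg k : (0:ℝ) ≤ k)])
    have h3 : r ^ (k + 1) / τ * (∫ ρ in (0:ℝ)..r, g ρ ^ 2 / ρ) = B r / τ * r ^ (k + 1) := by
      rw [hB]; ring
    rw [h3, add_mul]
    gcongr
  have hζlim : Tendsto ζ (nhdsWithin 0 (Ioi 0)) (nhds 0) := by
    rw [Metric.tendsto_nhds]
    intro e he
    filter_upwards [Ioo_mem_nhdsGT hR, hBlim.eventually_lt_const (show (0:ℝ) < e ^ 2 / 4 by positivity)]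
      with r hr hBr
    rw [Real.dist_eq, sub_zero]
    have h1 := hζbound (e / 2) (by positivity) r hr
    have h2 : B r / (e / 2) < e / 2 := by
      rw [div_lt_iff₀ (by positivity)]; linarith
    linarith
  have hζder : ∀ r ∈ Ioo 0 R, HasDerivAt ζ ((g r - (k + 1) * ζ r) / r) r := by
    intro r hr
    have hr0 := hr.1.ne'
    refine ((hIder r hr).div (hasDerivAt_pow (k + 1) r) (pow_ne_zero _ hr0)).congr_deriv ?_
    simp only [hζ, Nat.add_sub_cancel]
    push_cast
    field_simp
    ring
  have hAder : ∀ r ∈ Ioo 0 R, HasDerivAt (fun r => 2 * B r - ζ r ^ 2)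
      ((2 * g r ^ 2 - 2 * g r * ζ r + 2 * (k + 1) * ζ r ^ 2) / r) r := by
    intro r hr
    have hr0 := hr.1.ne'
    refine (((hBder r hr).const_mul 2).sub ((hζder r hr).pow 2)).congr_deriv ?_
    field_simp
    ring
  have hAlim : Tendsto (fun r => 2 * B r - ζ r ^ 2) (nhdsWithin 0 (Ioi 0)) (nhds 0) := by
    simpa using (hBlim.const_mul 2).sub (hζlim.pow 2)
  refine ⟨ζ, fun r => 2 * B r - ζ r ^ 2, hζder, hAder, hζlim, hAlim, fun r hr => ?_,
    fun ε hε1 hε r hr => ?_⟩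
  · have hcont := continuousOn_Ico_of_hasDerivAt (by simp [hζ, hB]) hAlim hAder
    have hmono : MonotoneOn (fun r => 2 * B r - ζ r ^ 2) (Ico 0 R) := by
      refine monotoneOn_of_deriv_nonneg (convex_Ico 0 R) hcont ?_ ?_ <;> rw [interior_Ico]
      · exact fun x hx => (hAder x hx).differentiableAt.differentiableWithinAt
      · intro x hx
        rw [(hAder x hx).deriv]
        refine div_nonneg ?_ hx.1.le
        have hk : (0:ℝ) ≤ k := Nat.cast_nonneg k
        nlinarith [sq_nonneg (g x - ζ x), sq_nonneg (g x), mul_nonneg hk (sq_nonneg (ζ x)),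
          sq_nonneg (ζ x)]
    have := hmono (left_mem_Ico.2 hR) (Ioo_subset_Ico_self hr) hr.1.le
    simpa [hζ, hB] using this
  · have h1 : ∫ ρ in (0:ℝ)..r, (ε - 1) * ρ ^ k ≤ I r := by
      refine intervalIntegral.integral_mono_on_of_le_Ioo hr.1.le ((hpow r).const_mul _)
        (hint r hr) fun x hx => ?_
      have := hε x ⟨hx.1, hx.2.trans hr.2⟩
      rw [mul_comm]
      exact mul_le_mul_of_nonneg_left (by linarith) (pow_pos hx.1 k).le
    rw [intervalIntegral.integral_const_mul, integral_pow, zero_pow (Nat.succ_ne_zero k),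
      sub_zero] at h1
    have h2 : ε - 1 ≤ ζ r := by
      rw [hζ, le_div_iff₀ (pow_pos hr.1 _)]
      refine le_trans ?_ h1
      refine mul_le_mul_of_nonpos_left ?_ (by linarith)
      exact div_le_self (pow_pos hr.1 _).le (by linarith [(Nat.cast_nonneg k : (0:ℝ) ≤ k)])
    linarith

/-- Logarithmic differentiation of the barrier `x = exp (μ L - ζ / (k + 1) + s A)`. -/
theorem hasDerivAt_barrier {L ζ A : ℝ → ℝ} {k : ℕ} {s r a D : ℝ} (hr : r ≠ 0)
    (hL : HasDerivAt L (-(a / r)) r) (hζ : HasDerivAt ζ ((a - (k + 1) * ζ r) / r) r)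
    (hA : HasDerivAt A (D / r) r) :
    HasDerivAt (fun r => r * Real.exp (k / (k + 1) * L r) * Real.exp (s * A r - ζ r / (k + 1)))
      (Real.exp (k / (k + 1) * L r) * Real.exp (s * A r - ζ r / (k + 1)) *
        (1 + ζ r - a + s * D)) r ∧
    HasDerivAt (fun r => r ^ k * (1 + ζ r) * Real.exp (k / (k + 1) * L r) *
        Real.exp (s * A r - ζ r / (k + 1)))
      (r ^ k / r * (Real.exp (k / (k + 1) * L r) * Real.exp (s * A r - ζ r / (k + 1))) *
        (k + ζ r * (ζ r - a) + (1 + ζ r) * (s * D))) r := by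
  have hE := (hL.const_mul ((k:ℝ) / (k + 1))).exp
  have hX := ((hA.const_mul s).sub (hζ.div_const ((k:ℝ) + 1))).exp
  have hk : (k:ℝ) + 1 ≠ 0 := by positivity
  constructor
  · refine (((hasDerivAt_id r).mul hE).mul hX).congr_deriv ?_
    simp only [id, Pi.sub_apply, Pi.mul_apply]
    field_simp
    ring
  · refine ((((hasDerivAt_pow k r).mul (hζ.const_add 1)).mul hE).mul hX).congr_deriv ?_
    have hp : (k:ℝ) * r ^ (k - 1) = k * r ^ k / r := by
      rcases k with _ | k
      · simp
      · rw [Nat.add_sub_cancel, pow_succ]; field_simp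
    simp only [Pi.sub_apply, Pi.mul_apply]
    rw [hp]
    field_simp
    ring

/-- The equation `(r ^ k (1 + g) v')' = k r ^ (k - 2) v`, written as a first-order system with
flux `p`, has a solution asymptotic to `r exp (k / (k + 1) ∫_r^R g(ρ) / ρ dρ)` at `0`. -/
theorem exists_flux_solution {R ε : ℝ} {k : ℕ} {g : ℝ → ℝ} (hk : k ≠ 0) (hR : 0 < R)
    (hg : ContinuousOn g (Ioc 0 R)) (hε0 : 0 < ε) (hε1 : ε ≤ 1)
    (hell : ∀ r ∈ Ioc 0 R, ε ≤ 1 + g r)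
    (hsq : IntegrableOn (fun r => g r ^ 2 / r) (Ioc 0 R)) :
    ∃ v p : ℝ → ℝ,
      (∀ r ∈ Ioo 0 R, HasDerivAt v (1 / (r ^ k * (1 + g r)) * p r) r) ∧
      (∀ r ∈ Ioo 0 R, HasDerivAt p (k * r ^ k / r ^ 2 * v r) r) ∧
      Tendsto (fun r => v r / (r * Real.exp ((k / (k + 1)) * ∫ ρ in r..R, g ρ / ρ)))
        (nhdsWithin 0 (Ioi 0)) (nhds 1) := by
  have hg' : ContinuousOn g (Ioo 0 R) := hg.mono Ioo_subset_Ioc_self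
  have hk0 : (0:ℝ) ≤ k := Nat.cast_nonneg k
  obtain ⟨ζ, A, hζ, hA, hζlim, hAlim, hAnn, hζε⟩ := exists_average k hR hg hsq
  have hG : ∀ r ∈ Ioo 0 R, ε ≤ 1 + g r := fun r hr => hell r (Ioo_subset_Ioc_self hr)
  replace hζε := hζε ε hε1 hG
  set L : ℝ → ℝ := fun r => ∫ ρ in r..R, g ρ / ρ with hLdef
  have hL : ∀ r ∈ Ioo 0 R, HasDerivAt L (-(g r / r)) r := by
    intro r hr
    have hsub : uIcc r R ⊆ Ioc 0 R := by
      rw [uIcc_of_le hr.2.le]; exact fun x hx => ⟨hr.1.trans_le hx.1, hx.2⟩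
    have hc : ContinuousOn (fun ρ => g ρ / ρ) (Ioo 0 R) :=
      hg'.div continuousOn_id fun x hx => hx.1.ne'
    exact intervalIntegral.integral_hasDerivAt_left
      ((hg.mono hsub).div continuousOn_id fun x hx => (hsub hx).1.ne').intervalIntegrable
      (hc.stronglyMeasurableAtFilter isOpen_Ioo r hr) (hc.continuousAt (isOpen_Ioo.mem_nhds hr))
  have hrE : Tendsto (fun r => r * Real.exp (k / (k + 1) * L r)) (nhdsWithin 0 (Ioi 0))
      (nhds 0) :=
    tendsto_mul_exp_integral_div (by positivity)
      ((div_le_one (by positivity)).2 (by linarith)) hR hg hsq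
  have hX : ∀ s : ℝ, Tendsto (fun r => Real.exp (s * A r - ζ r / (k + 1))) (nhdsWithin 0 (Ioi 0))
      (nhds 1) := fun s => by
    simpa using ((hAlim.const_mul s).sub (hζlim.div_const ((k:ℝ) + 1))).rexp
  set D : ℝ → ℝ := fun r => 2 * g r ^ 2 - 2 * g r * ζ r + 2 * (k + 1) * ζ r ^ 2 with hD
  have hDle : ∀ r, g r ^ 2 + ζ r ^ 2 ≤ D r := fun r => by
    simp only [hD]
    nlinarith [sq_nonneg (g r - ζ r), mul_nonneg hk0 (sq_nonneg (ζ r))]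
  have hkey : ∀ t r : ℝ, r ∈ Ioo 0 R → ε ≤ t → 2 * (g r ^ 2 + ζ r ^ 2) ≤ t * (2 / ε * D r) := by
    intro t r hr ht
    calc 2 * (g r ^ 2 + ζ r ^ 2) ≤ 2 * D r := by linarith [hDle r]
      _ = ε * (2 / ε * D r) := by field_simp
      _ ≤ _ := by
        have : 0 ≤ D r := (by positivity : 0 ≤ g r ^ 2 + ζ r ^ 2).trans (hDle r)
        gcongr
  let V : ℝ → ℝ → ℝ := fun s r =>
    r * Real.exp (k / (k + 1) * L r) * Real.exp (s * A r - ζ r / (k + 1))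
  let P : ℝ → ℝ → ℝ := fun s r =>
    r ^ k * (1 + ζ r) * Real.exp (k / (k + 1) * L r) * Real.exp (s * A r - ζ r / (k + 1))
  let V' : ℝ → ℝ → ℝ := fun s r =>
    Real.exp (k / (k + 1) * L r) * Real.exp (s * A r - ζ r / (k + 1)) * (1 + ζ r - g r + s * D r)
  let P' : ℝ → ℝ → ℝ := fun s r =>
    r ^ k / r * (Real.exp (k / (k + 1) * L r) * Real.exp (s * A r - ζ r / (k + 1))) *
        (k + ζ r * (ζ r - g r) + (1 + ζ r) * (s * D r))
  have hV : ∀ s, ∀ r ∈ Ioo 0 R, HasDerivAt (V s) (V' s r) r := fun s r hr =>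
    (hasDerivAt_barrier hr.1.ne' (hL r hr) (hζ r hr) (hA r hr)).1
  have hP : ∀ s, ∀ r ∈ Ioo 0 R, HasDerivAt (P s) (P' s r) r := fun s r hr =>
    (hasDerivAt_barrier hr.1.ne' (hL r hr) (hζ r hr) (hA r hr)).2
  have hV0 : ∀ s, V s 0 = 0 := fun s => by simp [V]
  have hP0 : ∀ s, P s 0 = 0 := fun s => by simp [P, hk]
  have hVc : ∀ s, ContinuousOn (V s) (Ico 0 R) := fun s =>
    continuousOn_Ico_of_hasDerivAt (hV0 s) (by simpa [V] using hrE.mul (hX s)) (hV s)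
  have hPc : ∀ s, ContinuousOn (P s) (Ico 0 R) := by
    intro s
    refine continuousOn_Ico_of_hasDerivAt (hP0 s) ?_ (hP s)
    obtain ⟨j, rfl⟩ := Nat.exists_eq_succ_of_ne_zero hk
    have hpow : Tendsto (fun r : ℝ => r ^ j) (nhdsWithin 0 (Ioi 0)) (nhds (0 ^ j)) :=
      ((continuous_pow j).tendsto 0).mono_left nhdsWithin_le_nhds
    have h := (hpow.mul (hζlim.const_add 1)).mul (hrE.mul (hX s))
    rw [zero_mul, mul_zero] at h
    refine h.congr fun r => ?_
    simp only [P, Nat.succ_eq_add_one]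
    ring
  let c : Bool → ℝ → ℝ := fun b r => cond b (k * r ^ k / r ^ 2) (1 / (r ^ k * (1 + g r)))
  suffices h : ∃ u : Bool → ℝ → ℝ, (∀ b, ∀ r ∈ Ioo 0 R,
      cond b (P (-(2 / ε))) (V (-(2 / ε))) r ≤ u b r ∧
        u b r ≤ cond b (P (2 / ε)) (V (2 / ε)) r) ∧
      ∀ b, ∀ r ∈ Ioo 0 R, HasDerivAt (u b) (c b r * u (!b) r) r by
    obtain ⟨u, hu, hu'⟩ := h
    refine ⟨u false, u true, hu' false, hu' true, ?_⟩
    refine tendsto_of_tendsto_of_tendsto_of_le_of_le' (hX (-(2 / ε))) (hX (2 / ε)) ?_ ?_ <;>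
      filter_upwards [Ioo_mem_nhdsGT hR] with r hr
    · rw [le_div_iff₀ (mul_pos hr.1 (Real.exp_pos _)), mul_comm]
      exact (hu false r hr).1
    · rw [div_le_iff₀ (mul_pos hr.1 (Real.exp_pos _)), mul_comm (Real.exp _)]
      exact (hu false r hr).2
  refine exists_solution_between (R := R) Bool.not c
    (fun b => cond b (P (-(2 / ε))) (V (-(2 / ε)))) (fun b => cond b (P' (-(2 / ε))) (V' (-(2 / ε))))
    (fun b => cond b (P (2 / ε)) (V (2 / ε))) (fun b => cond b (P' (2 / ε)) (V' (2 / ε)))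
    (Bool.forall_bool.2 ⟨?_, ?_⟩) (Bool.forall_bool.2 ⟨?_, ?_⟩)
    (Bool.forall_bool.2 ⟨hVc _, hPc _⟩) (Bool.forall_bool.2 ⟨hVc _, hPc _⟩)
    (Bool.forall_bool.2 ⟨hV0 _, hP0 _⟩) (Bool.forall_bool.2 ⟨hV0 _, hP0 _⟩)
    (Bool.forall_bool.2 ⟨hV _, hP _⟩) (Bool.forall_bool.2 ⟨hV _, hP _⟩)
    (Bool.forall_bool.2 ⟨?_, ?_⟩) (Bool.forall_bool.2 ⟨?_, ?_⟩)
    (Bool.forall_bool.2 ⟨?_, ?_⟩) (Bool.forall_bool.2 ⟨?_, ?_⟩)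
  · exact continuousOn_const.div ((continuous_pow k).continuousOn.mul (hg'.const_add 1))
      fun r hr => (mul_pos (pow_pos hr.1 k) (hε0.trans_le (hG r hr))).ne'
  · exact (continuous_const.mul (continuous_pow k)).continuousOn.div
      (continuous_pow 2).continuousOn fun r hr => (pow_pos hr.1 2).ne'
  · intro r hr
    exact (one_div_pos.2 (mul_pos (pow_pos hr.1 k) (hε0.trans_le (hG r hr)))).le
  · intro r hr
    have := hr.1
    simp only [c, cond_true]
    positivity
  · intro r hr
    have hr0 := hr.1
    have hGr := hε0.trans_le (hG r hr)
    have h := hkey _ r hr (hG r hr)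
    have hcalc : 1 / (r ^ k * (1 + g r)) * P (-(2 / ε)) r =
        Real.exp (k / (k + 1) * L r) * Real.exp (-(2 / ε) * A r - ζ r / (k + 1)) *
          ((1 + ζ r) / (1 + g r)) := by
      simp only [P]; field_simp
    simp only [c, cond_true, cond_false, Bool.not_false]
    rw [hcalc]
    refine mul_le_mul_of_nonneg_left ?_ (by positivity)
    rw [le_div_iff₀ hGr]
    nlinarith [sq_nonneg (g r - ζ r), sq_nonneg (g r + ζ r), sq_nonneg (g r), sq_nonneg (ζ r)]
  · intro r hr
    have hr0 := hr.1
    have h := hkey _ r hr (hζε r hr)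
    have hcalc : k * r ^ k / r ^ 2 * V (-(2 / ε)) r = r ^ k / r *
        (Real.exp (k / (k + 1) * L r) * Real.exp (-(2 / ε) * A r - ζ r / (k + 1))) * k := by
      simp only [V]; field_simp
    simp only [c, cond_true, cond_false, Bool.not_true]
    rw [hcalc]
    refine mul_le_mul_of_nonneg_left ?_ (by positivity)
    nlinarith [sq_nonneg (g r - ζ r), sq_nonneg (g r + ζ r), sq_nonneg (g r), sq_nonneg (ζ r)]
  · intro r hr
    have hr0 := hr.1
    have hGr := hε0.trans_le (hG r hr)
    have h := hkey _ r hr (hG r hr)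
    have hcalc : 1 / (r ^ k * (1 + g r)) * P (2 / ε) r =
        Real.exp (k / (k + 1) * L r) * Real.exp (2 / ε * A r - ζ r / (k + 1)) *
          ((1 + ζ r) / (1 + g r)) := by
      simp only [P]; field_simp
    simp only [c, cond_true, cond_false, Bool.not_false]
    rw [hcalc]
    refine mul_le_mul_of_nonneg_left ?_ (by positivity)
    rw [div_le_iff₀ hGr]
    nlinarith [sq_nonneg (g r - ζ r), sq_nonneg (g r + ζ r), sq_nonneg (g r), sq_nonneg (ζ r)]
  · intro r hr
    have hr0 := hr.1
    have h := hkey _ r hr (hζε r hr)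
    have hcalc : k * r ^ k / r ^ 2 * V (2 / ε) r = r ^ k / r *
        (Real.exp (k / (k + 1) * L r) * Real.exp (2 / ε * A r - ζ r / (k + 1))) * k := by
      simp only [V]; field_simp
    simp only [c, cond_true, cond_false, Bool.not_true]
    rw [hcalc]
    refine mul_le_mul_of_nonneg_left ?_ (by positivity)
    nlinarith [sq_nonneg (g r - ζ r), sq_nonneg (g r + ζ r), sq_nonneg (g r), sq_nonneg (ζ r)]
  · intro r hr
    have := hr.1
    simp only [V, cond_false]
    positivity
  · intro r hr
    have := hr.1
    have h1 := hε0.trans_le (hζε r hr)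
    simp only [P, cond_true]
    positivity
  · intro r hr
    have := hr.1
    have h1 := hAnn r hr
    have h2 : -(2 / ε) ≤ 2 / ε := by linarith [div_pos two_pos hε0]
    simp only [V, cond_false]
    gcongr
  · intro r hr
    have := hr.1
    have h1 := hAnn r hr
    have h2 : -(2 / ε) ≤ 2 / ε := by linarith [div_pos two_pos hε0]
    have h3 := hε0.trans_le (hζε r hr)
    simp only [P, cond_true]
    gcongr

/-- Let `g : (0,1/2] → ℝ` be differentiable with `1 + g ≥ ε > 0`, finite total
variation `∫₀^{1/2} |g′| < ∞`, and square-Dini `∫₀^{1/2} g²/r dr < ∞`. Then the ODE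
`(r^{n−1}(1+g)v′)′ = (n−1)r^{n−3} v` on `(0,1/2)` has a solution `v` with
`v(r) = r·exp[((n−1)/n)∫_r^{1/2} g(ρ)/ρ dρ]·(1+o(1))` as `r → 0⁺`. -/
theorem stmt_4 (n : ℕ) (hn : 2 ≤ n) (g g' : ℝ → ℝ)
    (hg_deriv : ∀ r ∈ Ioc (0:ℝ) (1/2), HasDerivWithinAt g (g' r) (Ioc (0:ℝ) (1/2)) r)
    (hell : ∃ ε : ℝ, 0 < ε ∧ ∀ r ∈ Ioc (0:ℝ) (1/2), ε ≤ 1 + g r)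
    (hTV : IntegrableOn (fun r => |g' r|) (Ioc (0:ℝ) (1/2)))
    (hsq : IntegrableOn (fun r => g r ^ 2 / r) (Ioc (0:ℝ) (1/2))) :
    ∃ v v' : ℝ → ℝ,
      (∀ r ∈ Ioo (0:ℝ) (1/2), HasDerivAt v (v' r) r) ∧
      (∀ r ∈ Ioo (0:ℝ) (1/2),
        HasDerivAt (fun s => s ^ ((n:ℝ) - 1) * (1 + g s) * v' s)
          (((n:ℝ) - 1) * r ^ ((n:ℝ) - 3) * v r) r) ∧
      Tendsto
        (fun r => v r /
          (r * Real.exp ((((n:ℝ) - 1) / n) * ∫ ρ in r..(1/2:ℝ), g ρ / ρ)))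
        (nhdsWithin 0 (Ioi 0)) (nhds 1) := by
  obtain ⟨ε, hε0, hε⟩ := hell
  obtain ⟨k, rfl⟩ : ∃ k, n = k + 1 := ⟨n - 1, by omega⟩
  obtain ⟨v, p, hv, hp, hlim⟩ := exists_flux_solution (R := 1 / 2) (ε := min ε 1) (k := k)
    (g := g) (by omega) (by norm_num) (fun r hr => (hg_deriv r hr).continuousWithinAt)
    (lt_min hε0 one_pos) (min_le_right _ _) (fun r hr => (min_le_left _ _).trans (hε r hr)) hsq
  have hn1 : ((k + 1 : ℕ) : ℝ) - 1 = k := by push_cast; ring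
  refine ⟨v, fun r => 1 / (r ^ k * (1 + g r)) * p r, hv, fun r hr => ?_, ?_⟩
  · have hpow : r ^ (((k + 1 : ℕ) : ℝ) - 3) = r ^ k / r ^ 2 := by
      rw [show ((k + 1 : ℕ) : ℝ) - 3 = (k : ℝ) - (2 : ℕ) by push_cast; ring,
        Real.rpow_sub hr.1, Real.rpow_natCast, Real.rpow_natCast]
    rw [hn1, hpow, ← mul_div_assoc]
    refine (hp r hr).congr_of_eventuallyEq ?_
    filter_upwards [isOpen_Ioo.mem_nhds hr] with s hs
    have h1 := hs.1
    have h2 : 0 < 1 + g s := hε0.trans_le (hε s (Ioo_subset_Ioc_self hs))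
    rw [Real.rpow_natCast]
    field_simp
  · rw [hn1]
    push_cast
    exact hlim
end

section
/- Let n ≥ 2 be an integer and let g : (0,1/2] → ℝ be a differentiable function satisfying: 1 + g(r) ≥ ε for some ε > 0 and all r; ∫_0^{1/2} |g′(r)| dr < ∞; |g(r)| ≤ ω(r) for a nondecreasing function ω with ω(r) → 0 as r → 0⁺ and ∫_0^{1/2} ω(r)²/r dr < ∞; and limsup_{r→0⁺} ∫_r^{1/2} g(ρ)/ρ dρ = +∞. Then there exists a solution v of the ODE (r^{n−1}(1+g(r)) v′(r))′ = (n−1) r^{n−3} v(r) on (0,1/2) such that v(r) → 0 as r → 0⁺ but limsup_{r→0⁺} v(r)/r = +∞; in particular v is not Lipschitz continuous at r = 0. -/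
open Set Filter MeasureTheory

/-- The exponentially weighted average `e^{-Nt} ∫_{-∞}^t e^{Ns} f(s) ds`. -/
noncomputable def expAvg (N : ℝ) (f : ℝ → ℝ) (t : ℝ) : ℝ :=
  Real.exp (-(N * t)) * ∫ s in Iic t, Real.exp (N * s) * f s

lemma integrableOn_exp_mul_of_bounded {N C : ℝ} (hN : 0 < N) {f : ℝ → ℝ} (hf : Continuous f)
    (hC : ∀ s, |f s| ≤ C) (t : ℝ) :
    IntegrableOn (fun s => Real.exp (N * s) * f s) (Iic t) := by
  refine Integrable.mono' ((integrableOn_exp_mul_Iic hN t).mul_const C)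
    (by fun_prop) (Eventually.of_forall fun s => ?_)
  rw [Real.norm_eq_abs, abs_mul, abs_of_pos (Real.exp_pos _)]
  exact mul_le_mul_of_nonneg_left (hC s) (Real.exp_pos _).le

lemma hasDerivAt_expAvg {N C : ℝ} (hN : 0 < N) {f : ℝ → ℝ} (hf : Continuous f)
    (hC : ∀ s, |f s| ≤ C) (t : ℝ) :
    HasDerivAt (expAvg N f) (f t - N * expAvg N f t) t := by
  have hint := integrableOn_exp_mul_of_bounded hN hf hC
  have hcont : Continuous fun s => Real.exp (N * s) * f s := by fun_prop
  have h1 : HasDerivAt (fun t => ∫ s in Iic t, Real.exp (N * s) * f s)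
      (Real.exp (N * t) * f t) t := by
    have h := (hcont.integral_hasStrictDerivAt 0 t).hasDerivAt.const_add
      (∫ s in Iic (0 : ℝ), Real.exp (N * s) * f s)
    refine h.congr_of_eventuallyEq (Eventually.of_forall fun u => ?_)
    have := intervalIntegral.integral_Iic_sub_Iic (hint 0) (hint u)
    simp only
    linarith
  have h2 : HasDerivAt (fun t : ℝ => Real.exp (-(N * t))) (Real.exp (-(N * t)) * -(N * 1)) t :=
    ((hasDerivAt_id t).const_mul N).neg.exp
  refine (h2.mul h1).congr_deriv ?_
  have h3 : Real.exp (-(N * t)) * Real.exp (N * t) = 1 := by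
    rw [← Real.exp_add]; simp
  unfold expAvg
  linear_combination f t * h3

lemma expAvg_le {N C D t : ℝ} (hN : 0 < N) {f : ℝ → ℝ} (hf : Continuous f)
    (hC : ∀ s, |f s| ≤ C) (hD : ∀ s ≤ t, f s ≤ D) : expAvg N f t ≤ D / N := by
  have h1 : ∫ s in Iic t, Real.exp (N * s) * f s ≤ ∫ s in Iic t, Real.exp (N * s) * D :=
    setIntegral_mono_on (integrableOn_exp_mul_of_bounded hN hf hC t)
      ((integrableOn_exp_mul_Iic hN t).mul_const D) measurableSet_Iic
      fun s hs => mul_le_mul_of_nonneg_left (hD s hs) (Real.exp_pos _).le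
  rw [integral_mul_const, integral_exp_mul_Iic hN] at h1
  refine (mul_le_mul_of_nonneg_left h1 (Real.exp_pos _).le).trans_eq ?_
  have h3 : Real.exp (-(N * t)) * Real.exp (N * t) = 1 := by
    rw [← Real.exp_add]; simp
  field_simp
  linear_combination D * h3

lemma expAvg_neg (N : ℝ) (f : ℝ → ℝ) (t : ℝ) :
    expAvg N (fun s => -f s) t = -expAvg N f t := by
  simp [expAvg, integral_neg]

lemma le_expAvg {N C D t : ℝ} (hN : 0 < N) {f : ℝ → ℝ} (hf : Continuous f)
    (hC : ∀ s, |f s| ≤ C) (hD : ∀ s ≤ t, D ≤ f s) : D / N ≤ expAvg N f t := by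
  have h := expAvg_le (f := fun s => -f s) (D := -D) (t := t) hN hf.neg (by simpa using hC)
    (fun s hs => neg_le_neg (hD s hs))
  rw [expAvg_neg, neg_div] at h
  linarith

lemma expAvg_sub {N C D : ℝ} (hN : 0 < N) {f g : ℝ → ℝ} (hf : Continuous f)
    (hg : Continuous g) (hC : ∀ s, |f s| ≤ C) (hD : ∀ s, |g s| ≤ D) (t : ℝ) :
    expAvg N (fun s => f s - g s) t = expAvg N f t - expAvg N g t := by
  simp only [expAvg, mul_sub]
  rw [integral_sub (integrableOn_exp_mul_of_bounded hN hf hC t)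
    (integrableOn_exp_mul_of_bounded hN hg hD t), mul_sub]

lemma exists_riccati_solution {p ε A : ℝ} (hp : 0 ≤ p) (hε : 0 < ε) (hε1 : ε ≤ 1) (hA : 1 ≤ A)
    {b Ω : ℝ → ℝ} (hb : Continuous b) (hbε : ∀ t, ε ≤ b t) (hbA : ∀ t, b t ≤ A)
    (hΩ : Monotone Ω) (hbΩ : ∀ t, |b t - 1| ≤ Ω t) :
    ∃ (y : ℝ → ℝ) (K : ℝ), (∀ t, HasDerivAt y (p + 1 - p * y t - y t ^ 2 / b t) t) ∧
      (∀ t, ε ≤ y t) ∧ (∀ t, y t ≤ A) ∧ ∀ t, |y t - 1| ≤ K * Ω t := by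
  have hA0 : 0 < A := by linarith
  have hb0 : ∀ t, 0 < b t := fun t => hε.trans_le (hbε t)
  have hΩ0 : ∀ t, 0 ≤ Ω t := fun t => (abs_nonneg _).trans (hbΩ t)
  obtain ⟨N, hN⟩ : ∃ N, N = p + 2 * A / ε := ⟨_, rfl⟩
  obtain ⟨c, hc⟩ : ∃ c, c = 2 * ε / A := ⟨_, rfl⟩
  have hc0 : 0 < c := by rw [hc]; positivity
  have hcN : c ≤ N := by
    have h1 : c ≤ 2 := by rw [hc, div_le_iff₀ hA0]; linarith
    have h2 : 2 ≤ 2 * A / ε := by rw [le_div_iff₀ hε]; linarith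
    linarith
  have hN0 : 0 < N := hc0.trans_le hcN
  obtain ⟨K, hK⟩ : ∃ K, K = 1 / (c * ε) := ⟨_, rfl⟩
  have hK0 : 0 ≤ K := by rw [hK]; positivity
  obtain ⟨F, hF⟩ : ∃ F : ℝ → ℝ → ℝ, ∀ s w, F s w = N * w + (p + 1 - p * w - w ^ 2 / b s) :=
    ⟨_, fun _ _ => rfl⟩
  have hFsub : ∀ s w z, F s w - F s z = (w - z) * (N - p - (w + z) / b s) := by
    intro s w z
    rw [hF, hF]
    have := (hb0 s).ne'
    field_simp
    ring
  have hfac0 : ∀ s w z, w ≤ A → z ≤ A → 0 ≤ N - p - (w + z) / b s := by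
    intro s w z hw hz
    have h1 : (w + z) / b s ≤ 2 * A / ε :=
      div_le_div₀ (by linarith) (by linarith) hε (hbε s)
    rw [hN]; linarith
  have hfac1 : ∀ s w z, ε ≤ w → ε ≤ z → N - p - (w + z) / b s ≤ N - c := by
    intro s w z hw hz
    have h1 : 2 * ε / A ≤ (w + z) / b s :=
      div_le_div₀ (by linarith) (by linarith) (hb0 s) (hbA s)
    rw [hc]; linarith
  have hFlip : ∀ s w z, ε ≤ w → w ≤ A → ε ≤ z → z ≤ A →
      |F s w - F s z| ≤ (N - c) * |w - z| := by
    intro s w z h1 h2 h3 h4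
    rw [hFsub, abs_mul, abs_of_nonneg (hfac0 s w z h2 h4), mul_comm]
    exact mul_le_mul_of_nonneg_right (hfac1 s w z h1 h3) (abs_nonneg _)
  have hFε : ∀ s w, ε ≤ w → w ≤ A → N * ε ≤ F s w := by
    intro s w h1 h2
    have h3 := mul_nonneg (sub_nonneg.2 h1) (hfac0 s w ε h2 (by linarith))
    rw [← hFsub] at h3
    have h4 : ε ^ 2 / b s ≤ ε := by
      rw [div_le_iff₀ (hb0 s)]; nlinarith [hbε s]
    have h5 := hF s ε
    nlinarith
  have hFA : ∀ s w, ε ≤ w → w ≤ A → F s w ≤ N * A := by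
    intro s w h1 h2
    have h3 := mul_nonneg (sub_nonneg.2 h2) (hfac0 s A w le_rfl h2)
    rw [← hFsub] at h3
    have h4 : A ≤ A ^ 2 / b s := by
      rw [le_div_iff₀ (hb0 s)]; nlinarith [hbA s]
    have h5 := hF s A
    nlinarith
  have hF1 : ∀ s w, ε ≤ w → w ≤ A → |w - 1| ≤ K * Ω s → |F s w - N| ≤ N * (K * Ω s) := by
    intro s w h1 h2 h3
    have h4 : |F s 1 - N| ≤ c * (K * Ω s) := by
      have h5 : F s 1 - N = (b s - 1) / b s := by
        rw [hF]
        have := (hb0 s).ne'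
        field_simp
        ring
      have h6 : c * (K * Ω s) = Ω s / ε := by rw [hK]; field_simp
      rw [h5, h6, abs_div, abs_of_pos (hb0 s)]
      exact div_le_div₀ (hΩ0 s) (hbΩ s) hε (hbε s)
    have h5 := hFlip s w 1 h1 h2 hε1 hA
    have h6 := mul_le_mul_of_nonneg_left h3 (sub_nonneg.2 hcN)
    have h7 := abs_sub_le (F s w) (F s 1) N
    linarith
  have hFcont : ∀ y : BoundedContinuousFunction ℝ ℝ, Continuous fun s => F s (y s) := by
    intro y
    simp only [hF]
    have := y.continuous
    exact (continuous_const.mul this).add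
      ((continuous_const.sub (continuous_const.mul this)).sub
        ((this.pow 2).div hb fun s => (hb0 s).ne'))
  have hFbdd : ∀ y : BoundedContinuousFunction ℝ ℝ, ∃ C, ∀ s, |F s (y s)| ≤ C := by
    intro y
    refine ⟨N * ‖y‖ + (p + 1 + p * ‖y‖ + ‖y‖ ^ 2 / ε), fun s => ?_⟩
    have hy : |y s| ≤ ‖y‖ := y.norm_coe_le_norm s
    have h1 : y s ^ 2 / b s ≤ ‖y‖ ^ 2 / ε := by
      refine div_le_div₀ (by positivity) ?_ hε (hbε s)
      rw [← sq_abs]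
      gcongr
    have h2 : 0 ≤ y s ^ 2 / b s := div_nonneg (sq_nonneg _) (hb0 s).le
    obtain ⟨h3, h4⟩ := abs_le.1 hy
    have h5 : p * y s ≤ p * ‖y‖ := by gcongr
    have h6 : p * -‖y‖ ≤ p * y s := by gcongr
    have h7 : N * y s ≤ N * ‖y‖ := by gcongr
    have h8 : N * -‖y‖ ≤ N * y s := by gcongr
    rw [hF, abs_le]
    constructor <;> linarith
  choose C hC using hFbdd
  have hex : ∀ y : BoundedContinuousFunction ℝ ℝ, ∃ z : BoundedContinuousFunction ℝ ℝ,
      ∀ t, z t = expAvg N (fun s => F s (y s)) t := by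
    intro y
    refine ⟨BoundedContinuousFunction.ofNormedAddCommGroup
      (expAvg N (fun s => F s (y s)))
      (continuous_iff_continuousAt.2 fun t =>
        (hasDerivAt_expAvg hN0 (hFcont y) (hC y) t).continuousAt) (C y / N) fun t => ?_,
      fun t => rfl⟩
    rw [Real.norm_eq_abs, abs_le]
    refine ⟨?_, expAvg_le hN0 (hFcont y) (hC y) fun s _ => (abs_le.1 (hC y s)).2⟩
    rw [← neg_div]
    exact le_expAvg hN0 (hFcont y) (hC y) fun s _ => (abs_le.1 (hC y s)).1
  choose Φ hΦ using hex
  let S : Set (BoundedContinuousFunction ℝ ℝ) :=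
    {y | ∀ t, ε ≤ y t ∧ y t ≤ A ∧ |y t - 1| ≤ K * Ω t}
  have hScl : IsClosed S := by
    have : S = ⋂ t, {y | ε ≤ y t ∧ y t ≤ A ∧ |y t - 1| ≤ K * Ω t} := by
      ext y; simp [S]
    rw [this]
    refine isClosed_iInter fun t => ?_
    have hev : Continuous fun y : BoundedContinuousFunction ℝ ℝ => y t :=
      (BoundedContinuousFunction.lipschitz_eval_const t).continuous
    exact (isClosed_le continuous_const hev).inter
      ((isClosed_le hev continuous_const).inter
        (isClosed_le (hev.sub continuous_const).abs continuous_const))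
  have hmaps : MapsTo Φ S S := by
    intro y hy t
    rw [hΦ]
    refine ⟨?_, ?_, ?_⟩
    · have := le_expAvg (t := t) hN0 (hFcont y) (hC y) fun s _ => hFε s _ (hy s).1 (hy s).2.1
      rwa [mul_div_cancel_left₀ _ hN0.ne'] at this
    · have := expAvg_le (t := t) hN0 (hFcont y) (hC y) fun s _ => hFA s _ (hy s).1 (hy s).2.1
      rwa [mul_div_cancel_left₀ _ hN0.ne'] at this
    · have hb : ∀ s ≤ t, |F s (y s) - N| ≤ N * (K * Ω t) := fun s hs =>
        (hF1 s _ (hy s).1 (hy s).2.1 (hy s).2.2).trans (by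
          have := hΩ hs
          gcongr)
      have h1 := expAvg_le (t := t) (D := N * (1 + K * Ω t)) hN0 (hFcont y) (hC y)
        fun s hs => by linarith [(abs_le.1 (hb s hs)).2]
      have h2 := le_expAvg (t := t) (D := N * (1 - K * Ω t)) hN0 (hFcont y) (hC y)
        fun s hs => by linarith [(abs_le.1 (hb s hs)).1]
      rw [mul_div_cancel_left₀ _ hN0.ne'] at h1 h2
      rw [abs_le]
      constructor <;> linarith
  have hq0 : 0 ≤ (N - c) / N := div_nonneg (by linarith) hN0.le
  have hcontr : ContractingWith (NNReal.mk ((N - c) / N) hq0) (hmaps.restrict Φ S S) := by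
    refine ⟨?_, LipschitzWith.of_dist_le_mul ?_⟩
    · rw [← NNReal.coe_lt_coe]
      change (N - c) / N < 1
      rw [div_lt_one hN0]
      linarith
    rintro ⟨y, hy⟩ ⟨z, hz⟩
    change dist (Φ y) (Φ z) ≤ (N - c) / N * dist y z
    rw [BoundedContinuousFunction.dist_le (by positivity)]
    intro t
    rw [hΦ, hΦ, Real.dist_eq, ← expAvg_sub hN0 (hFcont y) (hFcont z) (hC y) (hC z)]
    have hb : ∀ s, |F s (y s) - F s (z s)| ≤ (N - c) * dist y z := fun s =>
      (hFlip s _ _ (hy s).1 (hy s).2.1 (hz s).1 (hz s).2.1).trans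
        (mul_le_mul_of_nonneg_left (BoundedContinuousFunction.dist_coe_le_dist (f := y) (g := z) s)
          (sub_nonneg.2 hcN))
    have hcont := (hFcont y).sub (hFcont z)
    rw [div_mul_eq_mul_div, abs_le, ← neg_div]
    exact ⟨le_expAvg hN0 hcont hb fun s _ => (abs_le.1 (hb s)).1,
      expAvg_le hN0 hcont hb fun s _ => (abs_le.1 (hb s)).2⟩
  have h1S : BoundedContinuousFunction.const ℝ (1 : ℝ) ∈ S := fun t =>
    ⟨hε1, hA, by simpa using mul_nonneg hK0 (hΩ0 t)⟩
  obtain ⟨y, hyS, hy, -⟩ := hcontr.exists_fixedPoint' hScl.isComplete hmaps h1S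
    (edist_ne_top _ _)
  refine ⟨y, K, fun t => ?_, fun t => (hyS t).1, fun t => (hyS t).2.1, fun t => (hyS t).2.2⟩
  have hfun : (y : ℝ → ℝ) = expAvg N (fun s => F s (y s)) := by
    funext t
    rw [← hΦ, hy]
  have h := hasDerivAt_expAvg hN0 (hFcont y) (hC y) t
  rw [← hfun] at h
  refine h.congr_deriv ?_
  rw [hF]
  ring

lemma exists_integral_riccati_le {p ε A K t₀ : ℝ} (hp : 0 ≤ p) (hε : 0 < ε) {b Ω y : ℝ → ℝ}
    (hb : Continuous b) (hbε : ∀ t, ε ≤ b t) (hbΩ : ∀ t, |b t - 1| ≤ Ω t)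
    (hΩint : IntegrableOn (fun t => Ω t ^ 2) (Iic t₀))
    (hy : ∀ t, HasDerivAt y (p + 1 - p * y t - y t ^ 2 / b t) t) (hyA : ∀ t, y t ≤ A)
    (hyΩ : ∀ t, |y t - 1| ≤ K * Ω t) :
    ∃ C, ∀ t ≤ t₀, ∫ s in t..t₀, (y s / b s - 1) ≤
      C - (p + 1) / (p + 2) * ∫ s in t..t₀, (b s - 1) := by
  have hb0 : ∀ t, b t ≠ 0 := fun t => (hε.trans_le (hbε t)).ne'
  have hyc : Continuous y := continuous_iff_continuousAt.2 fun t => (hy t).continuousAt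
  obtain ⟨D, hD⟩ : ∃ D, D = (p + 1 + p * |K| + K ^ 2) / ((p + 2) * ε) := ⟨_, rfl⟩
  have hD0 : 0 ≤ D := by rw [hD]; positivity
  have hrem : ∀ s, y s / b s - 1 + (p + 1) / (p + 2) * (b s - 1)
      + (p + 1 - p * y s - y s ^ 2 / b s) / (p + 2) ≤ D * Ω s ^ 2 := by
    intro s
    have hid : y s / b s - 1 + (p + 1) / (p + 2) * (b s - 1)
        + (p + 1 - p * y s - y s ^ 2 / b s) / (p + 2) =
        ((p + 1) * (b s - 1) ^ 2 - p * ((y s - 1) * (b s - 1)) - (y s - 1) ^ 2)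
          / ((p + 2) * b s) := by
      have h1 := hb0 s
      have h2 : p + 2 ≠ 0 := by positivity
      field_simp
      ring
    have hΩ0 : 0 ≤ Ω s := (abs_nonneg _).trans (hbΩ s)
    have h1 : (b s - 1) ^ 2 ≤ Ω s ^ 2 := by
      rw [← sq_abs]; exact pow_le_pow_left₀ (abs_nonneg _) (hbΩ s) 2
    have h2 : -((y s - 1) * (b s - 1)) ≤ |K| * Ω s ^ 2 := by
      refine (neg_le_abs _).trans ?_
      rw [abs_mul, sq, ← mul_assoc]
      refine mul_le_mul ((hyΩ s).trans ?_) (hbΩ s) (abs_nonneg _) (by positivity)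
      exact mul_le_mul_of_nonneg_right (le_abs_self K) hΩ0
    have h3 := mul_le_mul_of_nonneg_left h2 hp
    have h4 := mul_le_mul_of_nonneg_left h1 (by linarith : 0 ≤ p + 1)
    rw [hid, hD, div_mul_eq_mul_div]
    refine div_le_div₀ (by positivity) ?_ (by positivity)
      (mul_le_mul_of_nonneg_left (hbε s) (by linarith))
    nlinarith [sq_nonneg (y s - 1), mul_nonneg (sq_nonneg K) (sq_nonneg (Ω s))]
  refine ⟨D * (∫ s in Iic t₀, Ω s ^ 2) + (A - y t₀) / (p + 2), fun t ht => ?_⟩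
  have hc1 : Continuous fun s => y s / b s - 1 := (hyc.div hb hb0).sub continuous_const
  have hc2 : Continuous fun s => (p + 1) / (p + 2) * (b s - 1) := by fun_prop
  have hc12 : Continuous fun s => y s / b s - 1 + (p + 1) / (p + 2) * (b s - 1) := hc1.add hc2
  have hc3 : Continuous fun s => p + 1 - p * y s - y s ^ 2 / b s :=
    (continuous_const.sub (continuous_const.mul hyc)).sub ((hyc.pow 2).div hb hb0)
  have hI3 : ∫ s in t..t₀, (p + 1 - p * y s - y s ^ 2 / b s) = y t₀ - y t :=
    intervalIntegral.integral_eq_sub_of_hasDerivAt (fun s _ => hy s)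
      (hc3.intervalIntegrable _ _)
  have hΩt : IntegrableOn (fun s => D * Ω s ^ 2) (Iic t₀) := hΩint.const_mul D
  have h1 : ∫ s in t..t₀, (y s / b s - 1 + (p + 1) / (p + 2) * (b s - 1)
      + (p + 1 - p * y s - y s ^ 2 / b s) / (p + 2)) ≤ ∫ s in t..t₀, D * Ω s ^ 2 :=
    intervalIntegral.integral_mono_on ht
      ((hc12.add (hc3.div_const _)).intervalIntegrable _ _)
      ((intervalIntegrable_iff_integrableOn_Ioc_of_le ht).2 (hΩt.mono_set Ioc_subset_Iic_self))
      fun s _ => hrem s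
  have h2 : ∫ s in t..t₀, D * Ω s ^ 2 ≤ D * ∫ s in Iic t₀, Ω s ^ 2 := by
    rw [intervalIntegral.integral_of_le ht, ← integral_const_mul]
    exact setIntegral_mono_set hΩt (Eventually.of_forall fun s => by positivity)
      Ioc_subset_Iic_self.eventuallyLE
  rw [intervalIntegral.integral_add (hc12.intervalIntegrable _ _)
      ((hc3.div_const _).intervalIntegrable _ _),
    intervalIntegral.integral_add (hc1.intervalIntegrable _ _) (hc2.intervalIntegrable _ _),
    intervalIntegral.integral_const_mul, intervalIntegral.integral_div, hI3] at h1
  have h3 : (y t - y t₀) / (p + 2) ≤ (A - y t₀) / (p + 2) := by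
    have := hyA t
    gcongr
  have h4 : (y t₀ - y t) / (p + 2) = -((y t - y t₀) / (p + 2)) := by ring
  linarith

/-- Let `g : (0,1/2] → ℝ` be differentiable with `1 + g ≥ ε > 0`, finite total
variation, `|g(r)| ≤ ω(r)` for a nondecreasing `ω` with `ω(r) → 0` as `r → 0⁺` and
`∫₀^{1/2} ω²/r dr < ∞` (square-Dini), and `limsup_{r→0⁺} ∫_r^{1/2} g(ρ)/ρ dρ = +∞`. Then
the ODE `(r^{n−1}(1+g)v′)′ = (n−1)r^{n−3} v` on `(0,1/2)` has a solution `v` with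
`v(r) → 0` as `r → 0⁺` but `limsup_{r→0⁺} v(r)/r = +∞`; in particular `v` is not Lipschitz
continuous at `0`. -/
theorem stmt_5 (n : ℕ) (hn : 2 ≤ n) (g g' ω : ℝ → ℝ)
    (hg_deriv : ∀ r ∈ Ioc (0:ℝ) (1/2), HasDerivWithinAt g (g' r) (Ioc (0:ℝ) (1/2)) r)
    (hell : ∃ ε : ℝ, 0 < ε ∧ ∀ r ∈ Ioc (0:ℝ) (1/2), ε ≤ 1 + g r)
    (hTV : IntegrableOn (fun r => |g' r|) (Ioc (0:ℝ) (1/2)))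
    (hω_mono : MonotoneOn ω (Ioc (0:ℝ) (1/2)))
    (hω_zero : Tendsto ω (nhdsWithin 0 (Ioi 0)) (nhds 0))
    (hgω : ∀ r ∈ Ioc (0:ℝ) (1/2), |g r| ≤ ω r)
    (hsq : IntegrableOn (fun r => ω r ^ 2 / r) (Ioc (0:ℝ) (1/2)))
    (hdiv : ∀ M : ℝ, ∃ᶠ r in nhdsWithin (0:ℝ) (Ioi 0),
      M < ∫ ρ in r..(1/2:ℝ), g ρ / ρ) :
    ∃ v v' : ℝ → ℝ,
      (∀ r ∈ Ioo (0:ℝ) (1/2), HasDerivAt v (v' r) r) ∧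
      (∀ r ∈ Ioo (0:ℝ) (1/2),
        HasDerivAt (fun s => s ^ ((n:ℝ) - 1) * (1 + g s) * v' s)
          (((n:ℝ) - 1) * r ^ ((n:ℝ) - 3) * v r) r) ∧
      Tendsto v (nhdsWithin 0 (Ioi 0)) (nhds 0) ∧
      (∀ M : ℝ, ∃ᶠ r in nhdsWithin (0:ℝ) (Ioi 0), M < v r / r) ∧
      ¬ ∃ c : ℝ, ∃ r₀ : ℝ, 0 < r₀ ∧ ∀ r ∈ Ioo (0:ℝ) r₀, |v r| ≤ c * r := by
  obtain ⟨ε₀, hε₀, hell⟩ := hell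
  obtain ⟨ε, hε, hε1, hεε₀⟩ : ∃ ε : ℝ, 0 < ε ∧ ε ≤ 1 ∧ ε ≤ ε₀ :=
    ⟨min ε₀ 1, lt_min hε₀ one_pos, min_le_right _ _, min_le_left _ _⟩
  obtain ⟨p, hp, hpn⟩ : ∃ p : ℝ, 0 ≤ p ∧ (n : ℝ) = p + 2 :=
    ⟨n - 2, sub_nonneg.2 (by exact_mod_cast hn), by ring⟩
  let t₀ : ℝ := Real.log (1 / 2)
  have hexp₀ : Real.exp t₀ = 1 / 2 := Real.exp_log (by norm_num)
  have hmem : ∀ t, min (Real.exp t) (1 / 2) ∈ Ioc (0 : ℝ) (1 / 2) := fun t =>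
    ⟨lt_min (Real.exp_pos t) (by norm_num), min_le_right _ _⟩
  have hmin : ∀ t ≤ t₀, min (Real.exp t) (1 / 2) = Real.exp t := fun t ht =>
    min_eq_left (hexp₀ ▸ Real.exp_le_exp.2 ht)
  let b : ℝ → ℝ := fun t => 1 + g (min (Real.exp t) (1 / 2))
  let Ω : ℝ → ℝ := fun t => ω (min (Real.exp t) (1 / 2))
  have hgc : ContinuousOn g (Ioc (0 : ℝ) (1 / 2)) := fun r hr =>
    (hg_deriv r hr).continuousWithinAt
  have hb : Continuous b := continuous_const.add
    (hgc.comp_continuous (Real.continuous_exp.min continuous_const) hmem)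
  have hbε : ∀ t, ε ≤ b t := fun t => hεε₀.trans (hell _ (hmem t))
  have hb0 : ∀ t, b t ≠ 0 := fun t => (hε.trans_le (hbε t)).ne'
  have hbΩ : ∀ t, |b t - 1| ≤ Ω t := fun t => by
    simpa [b, Ω] using hgω _ (hmem t)
  have hΩ : Monotone Ω := fun s t hst =>
    hω_mono (hmem s) (hmem t) (min_le_min_right _ (Real.exp_le_exp.2 hst))
  have hhalf : (1 / 2 : ℝ) ∈ Ioc (0 : ℝ) (1 / 2) := by constructor <;> norm_num
  obtain ⟨A, hA, hbA⟩ : ∃ A : ℝ, 1 ≤ A ∧ ∀ t, b t ≤ A := by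
    refine ⟨1 + ω (1 / 2), ?_, fun t => ?_⟩
    · linarith [(abs_nonneg _).trans (hgω _ hhalf)]
    · have h1 := (le_abs_self _).trans (hgω _ (hmem t))
      have h2 := hω_mono (hmem t) hhalf (hmem t).2
      simp only [b]
      linarith
  have hΩint : IntegrableOn (fun t => Ω t ^ 2) (Iic t₀) := by
    have himg : Real.exp '' Iic t₀ = Ioc 0 (1 / 2) := by
      ext r
      constructor
      · rintro ⟨t, ht, rfl⟩
        exact ⟨Real.exp_pos t, hexp₀ ▸ Real.exp_le_exp.2 ht⟩
      · rintro ⟨h0, h1⟩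
        exact ⟨Real.log r, Real.log_le_log h0 h1, Real.exp_log h0⟩
    rw [← himg, integrableOn_image_iff_integrableOn_abs_deriv_smul measurableSet_Iic
      (fun t _ => (Real.hasDerivAt_exp t).hasDerivWithinAt) Real.exp_injective.injOn] at hsq
    refine hsq.congr_fun (fun t ht => ?_) measurableSet_Iic
    have := Real.exp_pos t
    simp only [Ω, hmin t ht, smul_eq_mul, abs_of_pos this]
    field_simp
  obtain ⟨y, K, hy, hyε, hyA, hyΩ⟩ := exists_riccati_solution hp hε hε1 hA hb hbε hbA hΩ hbΩ
  obtain ⟨C, hC⟩ := exists_integral_riccati_le hp hε hb hbε hbΩ hΩint hy hyA hyΩ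
  have hyc : Continuous y := continuous_iff_continuousAt.2 fun t => (hy t).continuousAt
  have hq : Continuous fun t => y t / b t := hyc.div hb hb0
  let E : ℝ → ℝ := fun t => ∫ s in t₀..t, y s / b s
  have hE : ∀ t, HasDerivAt E (y t / b t) t := fun t =>
    (hq.integral_hasStrictDerivAt t₀ t).hasDerivAt
  have hEneg : ∀ t, E t = -∫ s in t..t₀, y s / b s := fun t =>
    intervalIntegral.integral_symm _ _
  let v : ℝ → ℝ := fun r => Real.exp (E (Real.log r))
  let v' : ℝ → ℝ := fun r => v r * (y (Real.log r) / b (Real.log r) * r⁻¹)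
  have hv : ∀ r, 0 < r → HasDerivAt v (v' r) r := fun r hr =>
    ((hE (Real.log r)).comp r (Real.hasDerivAt_log hr.ne')).exp
  have hlog : ∀ r ∈ Ioc (0 : ℝ) (1 / 2), Real.log r ≤ t₀ := fun r hr =>
    Real.log_le_log hr.1 hr.2
  have hblog : ∀ r ∈ Ioc (0 : ℝ) (1 / 2), b (Real.log r) = 1 + g r := fun r hr => by
    simp only [b, Real.exp_log hr.1, min_eq_left hr.2]
  have hnhds : ∀ r₀ : ℝ, 0 < r₀ → ∀ᶠ r in nhdsWithin (0 : ℝ) (Ioi 0), r ∈ Ioo 0 r₀ := fun r₀ h =>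
    Ioo_mem_nhdsGT h
  have hlim : Tendsto v (nhdsWithin 0 (Ioi 0)) (nhds 0) := by
    refine Real.tendsto_exp_atBot.comp ?_
    have hδ : 0 < ε / A := by positivity
    have hlin : Tendsto (fun r => ε / A * (Real.log r - t₀)) (nhdsWithin 0 (Ioi 0)) atBot :=
      (tendsto_atBot_add_const_right _ _ Real.tendsto_log_nhdsGT_zero).const_mul_atBot hδ
    refine tendsto_atBot_mono' _ ?_ hlin
    filter_upwards [hnhds (1 / 2) (by norm_num)] with r hr
    have hrt := hlog r ⟨hr.1, hr.2.le⟩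
    have h1 : ∫ s in Real.log r..t₀, ε / A ≤ ∫ s in Real.log r..t₀, y s / b s :=
      intervalIntegral.integral_mono_on hrt (continuous_const.intervalIntegrable _ _)
        (hq.intervalIntegrable _ _) fun s _ =>
          div_le_div₀ (hε.le.trans (hyε s)) (hyε s) (hε.trans_le (hbε s)) (hbA s)
    rw [intervalIntegral.integral_const, smul_eq_mul] at h1
    rw [hEneg]
    linarith
  have hκ : 0 < (p + 1) / (p + 2) := by positivity
  have hint : ∀ t ≤ t₀, ∫ s in t..t₀, (b s - 1) = ∫ ρ in Real.exp t..(1 / 2), g ρ / ρ := by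
    intro t ht
    rw [← hexp₀, ← intervalIntegral.integral_comp_mul_deriv'
      (fun s _ => Real.hasDerivAt_exp s) Real.continuous_exp.continuousOn]
    · refine intervalIntegral.integral_congr fun s hs => ?_
      rw [uIcc_of_le ht] at hs
      have := (Real.exp_pos s).ne'
      simp only [b, hmin s hs.2, Function.comp]
      field_simp
      ring
    · refine ContinuousOn.div (hgc.mono ?_) continuousOn_id ?_ <;>
        rw [uIcc_of_le ht]
      · rintro _ ⟨s, hs, rfl⟩
        exact ⟨Real.exp_pos s, hexp₀ ▸ Real.exp_le_exp.2 hs.2⟩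
      · rintro _ ⟨s, -, rfl⟩
        exact (Real.exp_pos s).ne'
  have hquot : ∀ M : ℝ, ∃ᶠ r in nhdsWithin (0 : ℝ) (Ioi 0), M < v r / r := by
    intro M
    have hev := hnhds (1 / 2) (by norm_num)
    refine ((hdiv ((M + C + t₀) / ((p + 1) / (p + 2)))).and_eventually hev).mono ?_
    rintro r ⟨hr, hr0⟩
    have hrt := hlog r ⟨hr0.1, hr0.2.le⟩
    have h1 := hC _ hrt
    rw [hint _ hrt, Real.exp_log hr0.1, intervalIntegral.integral_sub
      (hq.intervalIntegrable _ _) (continuous_const.intervalIntegrable _ _),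
      intervalIntegral.integral_const, smul_eq_mul, mul_one] at h1
    rw [div_lt_iff₀ hκ, mul_comm] at hr
    have h2 : v r / r = Real.exp (E (Real.log r) - Real.log r) := by
      rw [Real.exp_sub, Real.exp_log hr0.1]
    rw [h2, hEneg]
    linarith [Real.add_one_le_exp (-(∫ s in Real.log r..t₀, y s / b s) - Real.log r)]
  refine ⟨v, v', fun r hr => hv r hr.1, fun r hr => ?_, hlim, hquot, ?_⟩
  · have hflux : HasDerivAt (fun s => s ^ p * y (Real.log s) * v s)
        ((n - 1) * r ^ ((n : ℝ) - 3) * v r) r := by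
      have h1 := ((Real.hasDerivAt_rpow_const (p := p) (Or.inl hr.1.ne')).mul
        ((hy (Real.log r)).comp r (Real.hasDerivAt_log hr.1.ne'))).mul (hv r hr.1)
      refine h1.congr_deriv ?_
      have h2 : r ^ p = r ^ (p - 1) * r := by
        rw [← Real.rpow_add_one hr.1.ne']; ring_nf
      have h3 := hb0 (Real.log r)
      have h4 := hr.1.ne'
      rw [hpn, show p + 2 - 3 = p - 1 by ring]
      simp only [v', h2, Pi.mul_apply, Function.comp]
      field_simp
      ring
    refine hflux.congr_of_eventuallyEq ?_
    filter_upwards [Ioo_mem_nhds hr.1 hr.2] with s hs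
    have h2 : s ^ ((n : ℝ) - 1) = s ^ p * s := by
      rw [← Real.rpow_add_one hs.1.ne', hpn]; ring_nf
    have h3 := hb0 (Real.log s)
    have h4 := hs.1.ne'
    rw [← hblog s ⟨hs.1, hs.2.le⟩, h2]
    simp only [v']
    field_simp
  · rintro ⟨c, r₀, hr₀, hc⟩
    refine hquot c ?_
    filter_upwards [hnhds r₀ hr₀] with r hr
    rw [not_lt, div_le_iff₀ hr.1]
    exact (le_abs_self _).trans (hc r hr)
end

section
/- Let n ≥ 2 be an integer, ρ ∈ (0,1], and let g : (0,ρ] → ℝ be bounded and measurable with 1 + g(r) ≥ ε for some ε > 0. For functions v on (0,ρ] define the energy functional J(v) = ∫_0^ρ ( (1+g(r)) |v′(r)|² + (n−1) r^{−2} |v(r)|² ) r^{n−1} dr. Let Z : (0,ρ] → ℝ be a solution of (r^{n−1}(1+g(r)) Z′(r))′ = (n−1) r^{n−3} Z(r) on (0,ρ) with Z(r) > 0 for all r and J(Z) < ∞. Then for every b ∈ ℝ and every locally absolutely continuous function v : (0,ρ] → ℝ with v(ρ) = b and J(v) < ∞, one has J(v) ≥ (1+g(ρ)) ρ^{n−1}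 (Z′(ρ)/Z(ρ)) b², and equality holds for v(r) = b·Z(r)/Z(ρ). -/
open Set Filter MeasureTheory

/-- `u'` is locally integrable on `(0, ρ]` and `u` is a primitive of it there; equivalently, `u` is
locally absolutely continuous on `(0, ρ]` with a.e. derivative `u'`. -/
def IsPrimitiveOnIoc (ρ : ℝ) (u u' : ℝ → ℝ) : Prop :=
  ∀ a c : ℝ, 0 < a → a ≤ c → c ≤ ρ →
    IntegrableOn u' (Ioc a c) ∧ u c - u a = ∫ t in a..c, u' t

theorem intervalIntegral_deriv_mul_add_of_primitive {a b : ℝ} (hab : a ≤ b) {u u' v v' : ℝ → ℝ}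
    (hu' : IntervalIntegrable u' volume a b) (hv' : IntervalIntegrable v' volume a b)
    (hu : ∀ x ∈ Icc a b, u x - u a = ∫ t in a..x, u' t)
    (hv : ∀ x ∈ Icc a b, v x - v a = ∫ t in a..x, v' t) :
    ∫ x in a..b, (u' x * v x + u x * v' x) = u b * v b - u a * v a := by
  have key : ∀ {w w' : ℝ → ℝ}, IntervalIntegrable w' volume a b →
      AbsolutelyContinuousOnInterval (fun x => w a + ∫ t in a..x, w' t) a b ∧
      ∀ᵐ x, x ∈ uIcc a b → deriv (fun x => w a + ∫ t in a..x, w' t) x = w' x := by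
    intro w w' hw'
    refine ⟨?_, ?_⟩
    · have hconst : AbsolutelyContinuousOnInterval (fun _ : ℝ => w a) a b :=
        (LipschitzWith.const (w a)).lipschitzOnWith.absolutelyContinuousOnInterval
      exact hconst.add
        (hw'.absolutelyContinuousOnInterval_intervalIntegral left_mem_uIcc)
    · filter_upwards [hw'.ae_hasDerivAt_integral] with x hx hxab
      exact ((hx hxab a left_mem_uIcc).const_add (w a)).deriv
  obtain ⟨hU, hU'⟩ := key (w := u) hu'
  obtain ⟨hV, hV'⟩ := key (w := v) hv'
  have hparts := hU.integral_deriv_mul_eq_sub hV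
  have heu : ∀ x ∈ Icc a b, u a + ∫ t in a..x, u' t = u x := fun x hx => by
    rw [← hu x hx]; ring
  have hev : ∀ x ∈ Icc a b, v a + ∫ t in a..x, v' t = v x := fun x hx => by
    rw [← hv x hx]; ring
  simp only [heu b (right_mem_Icc.2 hab), hev b (right_mem_Icc.2 hab),
    heu a (left_mem_Icc.2 hab), hev a (left_mem_Icc.2 hab)] at hparts
  rw [← hparts]
  apply intervalIntegral.integral_congr_ae
  filter_upwards [hU', hV'] with x hxu hxv hx
  have hx' : x ∈ uIcc a b := uIoc_subset_uIcc hx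
  rw [uIcc_of_le hab] at hxu hxv hx'
  simp only [hxu hx', hxv hx', heu x hx', hev x hx']

namespace IsPrimitiveOnIoc

variable {ρ : ℝ} {u u' v v' : ℝ → ℝ}

theorem intervalIntegrable (hu : IsPrimitiveOnIoc ρ u u') {a c : ℝ} (ha : 0 < a) (hac : a ≤ c)
    (hc : c ≤ ρ) : IntervalIntegrable u' volume a c :=
  (intervalIntegrable_iff_integrableOn_Ioc_of_le hac).2 (hu a c ha hac hc).1

theorem continuousOn (hu : IsPrimitiveOnIoc ρ u u') : ContinuousOn u (Ioc 0 ρ) := by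
  intro x hx
  have hx2 : 0 < x / 2 := half_pos hx.1
  have hx2x : x / 2 < x := half_lt_self hx.1
  have hle : x / 2 ≤ ρ := hx2x.le.trans hx.2
  have hc : ContinuousOn (fun y => u (x / 2) + ∫ t in (x / 2)..y, u' t) (uIcc (x / 2) ρ) :=
    continuousOn_const.add (intervalIntegral.continuousOn_primitive_interval'
      (hu.intervalIntegrable hx2 hle le_rfl) left_mem_uIcc)
  have hcu : ContinuousOn u (Icc (x / 2) ρ) := by
    rw [uIcc_of_le hle] at hc
    refine hc.congr fun y hy => ?_
    dsimp only
    rw [← (hu (x / 2) y hx2 hy.1 hy.2).2]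
    ring
  refine (hcu x ⟨hx2x.le, hx.2⟩).mono_of_mem_nhdsWithin ?_
  filter_upwards [self_mem_nhdsWithin, mem_nhdsWithin_of_mem_nhds (Ioi_mem_nhds hx2x)]
    with y hy hy'
  exact ⟨le_of_lt hy', hy.2⟩

theorem aestronglyMeasurable (hu : IsPrimitiveOnIoc ρ u u') :
    AEStronglyMeasurable u (volume.restrict (Ioo 0 ρ)) :=
  (hu.continuousOn.mono Ioo_subset_Ioc_self).aestronglyMeasurable measurableSet_Ioo

theorem aestronglyMeasurable_deriv (hu : IsPrimitiveOnIoc ρ u u') :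
    AEStronglyMeasurable u' (volume.restrict (Ioo 0 ρ)) := by
  rcases le_or_gt ρ 0 with hρ | hρ
  · simp [Ioo_eq_empty_of_le hρ]
  have hsub : Ioo 0 ρ ⊆ ⋃ k : ℕ, Ioc (ρ / (k + 1)) ρ := by
    intro x hx
    obtain ⟨k, hk⟩ := exists_nat_gt (ρ / x)
    refine mem_iUnion.2 ⟨k, ?_, hx.2.le⟩
    have hk0 : (0 : ℝ) < k + 1 := by positivity
    rw [div_lt_iff₀ hk0]
    rw [div_lt_iff₀ hx.1] at hk
    nlinarith [hx.1]
  refine AEStronglyMeasurable.mono_measure ?_ (Measure.restrict_mono hsub le_rfl)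
  refine (aestronglyMeasurable_iUnion_iff).2 fun k => ?_
  have hk1 : (1 : ℝ) ≤ k + 1 := by
    have : (0 : ℝ) ≤ k := k.cast_nonneg
    linarith
  exact (hu _ ρ (by positivity) (div_le_self hρ.le hk1) le_rfl).1.aestronglyMeasurable

theorem mul (hu : IsPrimitiveOnIoc ρ u u') (hv : IsPrimitiveOnIoc ρ v v') :
    IsPrimitiveOnIoc ρ (fun r => u r * v r) (fun r => u' r * v r + u r * v' r) := by
  intro a c ha hac hc
  have hsub : uIcc a c ⊆ Ioc 0 ρ := by
    rw [uIcc_of_le hac]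
    exact fun x hx => ⟨ha.trans_le hx.1, hx.2.trans hc⟩
  refine ⟨?_, ?_⟩
  · rw [← intervalIntegrable_iff_integrableOn_Ioc_of_le hac]
    exact ((hu.intervalIntegrable ha hac hc).mul_continuousOn (hv.continuousOn.mono hsub)).add
      ((hv.intervalIntegrable ha hac hc).continuousOn_mul (hu.continuousOn.mono hsub))
  · rw [intervalIntegral_deriv_mul_add_of_primitive hac (hu.intervalIntegrable ha hac hc)
      (hv.intervalIntegrable ha hac hc)
      (fun x hx => (hu a x ha hx.1 (hx.2.trans hc)).2)
      (fun x hx => (hv a x ha hx.1 (hx.2.trans hc)).2)]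

theorem of_hasDerivWithinAt
    (hu : ∀ r ∈ Ioc 0 ρ, HasDerivWithinAt u (u' r) (Ioc 0 ρ) r)
    (hint : ∀ a c : ℝ, 0 < a → a ≤ c → c ≤ ρ → IntegrableOn u' (Ioc a c)) :
    IsPrimitiveOnIoc ρ u u' := by
  intro a c ha hac hc
  refine ⟨hint a c ha hac hc, ?_⟩
  refine (intervalIntegral.integral_eq_sub_of_hasDerivAt_of_le hac (fun x hx => ?_)
    (fun x hx => ?_)
    ((intervalIntegrable_iff_integrableOn_Ioc_of_le hac).2 (hint a c ha hac hc))).symm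
  · exact (hu x ⟨ha.trans_le hx.1, hx.2.trans hc⟩).continuousWithinAt.mono
      fun y hy => ⟨ha.trans_le hy.1, hy.2.trans hc⟩
  · exact (hu x ⟨ha.trans hx.1, hx.2.le.trans hc⟩).hasDerivAt
      (Ioc_mem_nhds (ha.trans hx.1) (hx.2.trans_le hc))

/-- If `u'` and `u r / r` are integrable on `(0, ρ)`, then `u` vanishes at the origin. -/
theorem integral_eq_of_integrableOn_div (hρ : 0 < ρ) (hu : IsPrimitiveOnIoc ρ u u')
    (hu' : IntegrableOn u' (Ioo 0 ρ)) (hdiv : IntegrableOn (fun r => u r / r) (Ioo 0 ρ)) :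
    ∫ r in Ioo 0 ρ, u' r = u ρ := by
  have hII : IntervalIntegrable u' volume 0 ρ :=
    (intervalIntegrable_iff_integrableOn_Ioo_of_le hρ.le).2 hu'
  set L := u ρ - ∫ r in (0 : ℝ)..ρ, u' r with hL
  have hlim : Tendsto u (nhdsWithin 0 (Ioo 0 ρ)) (nhds L) := by
    have hc := (intervalIntegral.continuousOn_primitive_interval' hII right_mem_uIcc) 0
      left_mem_uIcc
    have hc' := (hc.mono (s := Ioo 0 ρ) (by
      rw [uIcc_of_le hρ.le]; exact Ioo_subset_Icc_self)).tendsto.const_add (u ρ)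
    rw [intervalIntegral.integral_symm, ← sub_eq_add_neg] at hc'
    refine hc'.congr' ?_
    filter_upwards [self_mem_nhdsWithin] with a ha
    rw [intervalIntegral.integral_symm, ← (hu a ρ ha.1 ha.2.le le_rfl).2]
    ring
  have hL0 : L = 0 := by
    by_contra hne
    have hpos : 0 < |L| := abs_pos.2 hne
    have hev := hlim.abs.eventually_const_lt (half_lt_self hpos)
    rw [eventually_nhdsWithin_iff, Metric.eventually_nhds_iff] at hev
    obtain ⟨δ, hδ, hball⟩ := hev
    have hη : 0 < min δ ρ := lt_min hδ hρ
    have hinv : IntegrableOn (fun r : ℝ => r⁻¹) (Ioo 0 (min δ ρ)) := by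
      have hdom := ((hdiv.mono_set (Ioo_subset_Ioo_right (min_le_right δ ρ))).norm.const_mul
        (2 / |L|))
      refine hdom.mono' measurable_inv.aestronglyMeasurable ?_
      filter_upwards [ae_restrict_mem measurableSet_Ioo] with r hr
      have hlt := hball (y := r)
        (by rw [Real.dist_eq, sub_zero, abs_of_pos hr.1]; exact hr.2.trans_le (min_le_left _ _))
        ⟨hr.1, hr.2.trans_le (min_le_right _ _)⟩
      have hr0 := hr.1
      rw [Real.norm_eq_abs, Real.norm_eq_abs, abs_div, abs_of_pos (inv_pos.2 hr0), abs_of_pos hr0,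
        div_mul_div_comm, inv_eq_one_div, div_le_div_iff₀ hr0 (mul_pos hpos hr0)]
      nlinarith
    have := (intervalIntegrable_iff_integrableOn_Ioo_of_le hη.le).2 hinv
    rw [intervalIntegrable_inv_iff] at this
    rcases this with h | h
    · exact hη.ne h
    · exact h left_mem_uIcc
  rw [← integral_Ioc_eq_integral_Ioo, ← intervalIntegral.integral_of_le hρ.le]
  linarith

end IsPrimitiveOnIoc

/-- The weak form of the equation `(p Z')' = q Z` on `(0, ρ]`, tested against functions of finite
energy: no boundary term appears at the origin. -/
theorem integral_bilinear_energy_eq {ρ C : ℝ} (hρ : 0 < ρ) (hC : 0 ≤ C) {p q Z Z' v v' : ℝ → ℝ}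
    (hp_meas : Measurable p) (hq_meas : Measurable q)
    (hp : ∀ r ∈ Ioo 0 ρ, 0 ≤ p r) (hq : ∀ r ∈ Ioo 0 ρ, 0 ≤ q r)
    (hpq : ∀ r ∈ Ioo 0 ρ, p r / r ^ 2 ≤ C * q r)
    (hZ : IsPrimitiveOnIoc ρ Z Z')
    (hflux : IsPrimitiveOnIoc ρ (fun r => p r * Z' r) (fun r => q r * Z r))
    (hv : IsPrimitiveOnIoc ρ v v')
    (hZ_energy : IntegrableOn (fun r => p r * Z' r ^ 2 + q r * Z r ^ 2) (Ioo 0 ρ))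
    (hv_energy : IntegrableOn (fun r => p r * v' r ^ 2 + q r * v r ^ 2) (Ioo 0 ρ)) :
    IntegrableOn (fun r => q r * Z r * v r + p r * Z' r * v' r) (Ioo 0 ρ) ∧
      ∫ r in Ioo 0 ρ, (q r * Z r * v r + p r * Z' r * v' r) = p ρ * Z' ρ * v ρ := by
  have hsum := hZ_energy.add hv_energy
  have hint : IntegrableOn (fun r => q r * Z r * v r + p r * Z' r * v' r) (Ioo 0 ρ) := by
    refine hsum.mono' ?_ ?_
    · exact ((hq_meas.aestronglyMeasurable.mul hZ.aestronglyMeasurable).mul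
        hv.aestronglyMeasurable).add ((hp_meas.aestronglyMeasurable.mul
        hZ.aestronglyMeasurable_deriv).mul hv.aestronglyMeasurable_deriv)
    · filter_upwards [ae_restrict_mem measurableSet_Ioo] with r hr
      have h1 := mul_nonneg (hp r hr) (sq_nonneg (Z' r - v' r))
      have h2 := mul_nonneg (hq r hr) (sq_nonneg (Z r - v r))
      have h3 := mul_nonneg (hp r hr) (sq_nonneg (Z' r + v' r))
      have h4 := mul_nonneg (hq r hr) (sq_nonneg (Z r + v r))
      have h5 := mul_nonneg (hp r hr) (add_nonneg (sq_nonneg (Z' r)) (sq_nonneg (v' r)))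
      have h6 := mul_nonneg (hq r hr) (add_nonneg (sq_nonneg (Z r)) (sq_nonneg (v r)))
      simp only [Pi.add_apply, Real.norm_eq_abs, abs_le]
      constructor <;> nlinarith
  refine ⟨hint, (hflux.mul hv).integral_eq_of_integrableOn_div hρ hint ?_⟩
  refine (hZ_energy.add (hv_energy.const_mul C)).mono' ?_ ?_
  · exact ((hp_meas.aestronglyMeasurable.mul hZ.aestronglyMeasurable_deriv).mul
      hv.aestronglyMeasurable).div₀ measurable_id.aestronglyMeasurable
  · filter_upwards [ae_restrict_mem measurableSet_Ioo] with r hr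
    have hw : p r * (v r / r) ^ 2 ≤ C * q r * v r ^ 2 := by
      have h := mul_le_mul_of_nonneg_right (hpq r hr) (sq_nonneg (v r))
      have heq : p r * (v r / r) ^ 2 = p r / r ^ 2 * v r ^ 2 := by ring
      rwa [heq]
    have h1 := mul_nonneg (hp r hr) (sq_nonneg (Z' r - v r / r))
    have h2 := mul_nonneg (hp r hr) (sq_nonneg (Z' r + v r / r))
    have h3 := mul_nonneg (hp r hr) (sq_nonneg (Z' r))
    have h4 := mul_nonneg (hq r hr) (sq_nonneg (Z r))
    have h5 := mul_nonneg hC (mul_nonneg (hp r hr) (sq_nonneg (v' r)))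
    have h6 := mul_nonneg (hp r hr) (sq_nonneg (v r / r))
    simp only [Pi.add_apply, Real.norm_eq_abs, abs_le, mul_div_assoc]
    constructor <;> nlinarith

/-- A coefficient bounded below on compact subintervals can be divided out of a continuous flux. -/
theorem integrableOn_of_continuousOn_mul {p f : ℝ → ℝ} {a c δ : ℝ} (hδ : 0 < δ)
    (hp_meas : Measurable p) (hp : ∀ r ∈ Icc a c, δ ≤ p r)
    (hf : ContinuousOn (fun r => p r * f r) (Icc a c)) : IntegrableOn f (Ioc a c) := by
  have hpf : IntegrableOn (fun r => p r * f r) (Ioc a c) :=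
    (hf.integrableOn_compact isCompact_Icc).mono_set Ioc_subset_Icc_self
  have hdiv : IntegrableOn (fun r => (p r)⁻¹ * (p r * f r)) (Ioc a c) := by
    refine Integrable.bdd_mul (c := δ⁻¹) hpf hp_meas.inv.aestronglyMeasurable ?_
    filter_upwards [ae_restrict_mem measurableSet_Ioc] with r hr
    have hpr := hp r (Ioc_subset_Icc_self hr)
    rw [Real.norm_eq_abs, abs_of_pos (inv_pos.2 (hδ.trans_le hpr))]
    exact inv_anti₀ hδ hpr
  refine hdiv.congr_fun (fun r hr => ?_) measurableSet_Ioc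
  exact inv_mul_cancel_left₀ (hδ.trans_le (hp r (Ioc_subset_Icc_self hr))).ne' (f r)

/-- Let `g` be bounded measurable on `(0,ρ]` with `1 + g ≥ ε > 0`, and let
`Z > 0` solve `(r^{n−1}(1+g)Z′)′ = (n−1)r^{n−3}Z` on `(0,ρ]` with finite energy
`J(Z) < ∞`, where `J(v) = ∫₀^ρ ((1+g)|v′|² + (n−1)r^{−2}|v|²) r^{n−1} dr`. Then for every
`b ∈ ℝ` and every locally absolutely continuous `v : (0,ρ] → ℝ` (with a.e. derivative `v′`)
satisfying `v(ρ) = b` and `J(v) < ∞`, one has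
`J(v) ≥ (1+g(ρ)) ρ^{n−1} (Z′(ρ)/Z(ρ)) b²`, with equality for `v = b·Z/Z(ρ)`. -/
theorem stmt_7 (n : ℕ) (hn : 2 ≤ n) (ρ : ℝ) (hρ : ρ ∈ Ioc (0:ℝ) 1)
    (g : ℝ → ℝ) (hg_meas : Measurable g)
    (hg_bdd : ∃ M : ℝ, ∀ r ∈ Ioc (0:ℝ) ρ, |g r| ≤ M)
    (ε : ℝ) (hε : 0 < ε) (hell : ∀ r ∈ Ioc (0:ℝ) ρ, ε ≤ 1 + g r)
    (Z Z' : ℝ → ℝ)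
    (hZ_deriv : ∀ r ∈ Ioc (0:ℝ) ρ, HasDerivWithinAt Z (Z' r) (Ioc (0:ℝ) ρ) r)
    (hZ_ode : ∀ r ∈ Ioc (0:ℝ) ρ,
      HasDerivWithinAt (fun s => s ^ ((n:ℝ) - 1) * (1 + g s) * Z' s)
        (((n:ℝ) - 1) * r ^ ((n:ℝ) - 3) * Z r) (Ioc (0:ℝ) ρ) r)
    (hZ_pos : ∀ r ∈ Ioc (0:ℝ) ρ, 0 < Z r)
    (hZ_energy : IntegrableOn
      (fun r => ((1 + g r) * Z' r ^ 2 + ((n:ℝ) - 1) * Z r ^ 2 / r ^ 2) * r ^ ((n:ℝ) - 1))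
      (Ioo (0:ℝ) ρ)) :
    ∀ b : ℝ, ∀ v v' : ℝ → ℝ,
      (∀ a c : ℝ, 0 < a → a ≤ c → c ≤ ρ →
        IntegrableOn v' (Ioc a c) ∧ v c - v a = ∫ t in a..c, v' t) →
      v ρ = b →
      IntegrableOn
        (fun r => ((1 + g r) * v' r ^ 2 + ((n:ℝ) - 1) * v r ^ 2 / r ^ 2) * r ^ ((n:ℝ) - 1))
        (Ioo (0:ℝ) ρ) →
      ((∫ r in Ioo (0:ℝ) ρ,
          ((1 + g r) * v' r ^ 2 + ((n:ℝ) - 1) * v r ^ 2 / r ^ 2) * r ^ ((n:ℝ) - 1))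
        ≥ (1 + g ρ) * ρ ^ ((n:ℝ) - 1) * (Z' ρ / Z ρ) * b ^ 2) ∧
      (∫ r in Ioo (0:ℝ) ρ,
          ((1 + g r) * (b * Z' r / Z ρ) ^ 2 + ((n:ℝ) - 1) * (b * Z r / Z ρ) ^ 2 / r ^ 2)
            * r ^ ((n:ℝ) - 1))
        = (1 + g ρ) * ρ ^ ((n:ℝ) - 1) * (Z' ρ / Z ρ) * b ^ 2 := by
  intro b v v' hv hvb hv_energy
  have hρ0 : 0 < ρ := hρ.1
  have hρmem : ρ ∈ Ioc 0 ρ := right_mem_Ioc.2 hρ0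
  have hn1 : (1 : ℝ) ≤ (n : ℝ) - 1 := by
    have : (2 : ℝ) ≤ n := by exact_mod_cast hn
    linarith
  obtain ⟨M, hM⟩ := hg_bdd
  have hM0 : 0 ≤ M := (abs_nonneg _).trans (hM ρ hρmem)
  set p : ℝ → ℝ := fun r => r ^ ((n : ℝ) - 1) * (1 + g r) with hp_def
  set q : ℝ → ℝ := fun r => ((n : ℝ) - 1) * r ^ ((n : ℝ) - 3) with hq_def
  have hq_eq : ∀ r : ℝ, 0 < r → q r = ((n : ℝ) - 1) / r ^ 2 * r ^ ((n : ℝ) - 1) := by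
    intro r hr
    have hexp : (n : ℝ) - 3 = (n : ℝ) - 1 - (2 : ℕ) := by push_cast; ring
    simp only [hq_def]
    rw [hexp, Real.rpow_sub_natCast hr.ne']
    ring
  have henergy : ∀ w w' : ℝ → ℝ, ∀ r ∈ Ioo 0 ρ,
      ((1 + g r) * w' r ^ 2 + ((n : ℝ) - 1) * w r ^ 2 / r ^ 2) * r ^ ((n : ℝ) - 1) =
        p r * w' r ^ 2 + q r * w r ^ 2 := by
    intro w w' r hr
    rw [hq_eq r hr.1]
    simp only [hp_def]
    ring
  have hp_meas : Measurable p := by fun_prop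
  have hq_meas : Measurable q := by fun_prop
  have hp : ∀ r ∈ Ioo 0 ρ, 0 ≤ p r := fun r hr =>
    mul_nonneg (Real.rpow_nonneg hr.1.le _) (hε.le.trans (hell r (Ioo_subset_Ioc_self hr)))
  have hq : ∀ r ∈ Ioo 0 ρ, 0 ≤ q r := fun r hr =>
    mul_nonneg (by linarith) (Real.rpow_nonneg hr.1.le _)
  have hpq : ∀ r ∈ Ioo 0 ρ, p r / r ^ 2 ≤ (1 + M) * q r := by
    intro r hr
    have hg : 1 + g r ≤ (1 + M) * ((n : ℝ) - 1) := by
      have := (abs_le.1 (hM r (Ioo_subset_Ioc_self hr))).2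
      nlinarith
    have hw : 0 ≤ r ^ ((n : ℝ) - 1) / r ^ 2 :=
      div_nonneg (Real.rpow_nonneg hr.1.le _) (sq_nonneg r)
    have h := mul_le_mul_of_nonneg_right hg hw
    rw [hq_eq r hr.1]
    simp only [hp_def]
    calc _ = (1 + g r) * (r ^ ((n : ℝ) - 1) / r ^ 2) := by ring
      _ ≤ _ := h
      _ = _ := by ring
  have hZ_cont : ContinuousOn Z (Ioc 0 ρ) := fun r hr => (hZ_deriv r hr).continuousWithinAt
  have hsub : ∀ {a c : ℝ}, 0 < a → c ≤ ρ → Icc a c ⊆ Ioc 0 ρ := fun ha hc x hx =>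
    ⟨ha.trans_le hx.1, hx.2.trans hc⟩
  have hZ : IsPrimitiveOnIoc ρ Z Z' := by
    refine .of_hasDerivWithinAt hZ_deriv fun a c ha hac hc => ?_
    refine integrableOn_of_continuousOn_mul (p := p) (δ := a ^ ((n : ℝ) - 1) * ε)
      (by positivity) hp_meas (fun r hr => ?_)
      (fun r hr => (hZ_ode r (hsub ha hc hr)).continuousWithinAt.mono (hsub ha hc))
    exact mul_le_mul (Real.rpow_le_rpow ha.le hr.1 (by linarith)) (hell r (hsub ha hc hr)) hε.le
      (Real.rpow_nonneg (ha.le.trans hr.1) _)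
  have hflux : IsPrimitiveOnIoc ρ (fun r => p r * Z' r) (fun r => q r * Z r) := by
    refine .of_hasDerivWithinAt hZ_ode fun a c ha hac hc => ?_
    refine (ContinuousOn.integrableOn_compact isCompact_Icc ?_).mono_set Ioc_subset_Icc_self
    refine ContinuousOn.mul (continuousOn_const.mul fun r hr => ?_) (hZ_cont.mono (hsub ha hc))
    exact (Real.continuousAt_rpow_const r _ (Or.inl (hsub ha hc hr).1.ne')).continuousWithinAt
  have hZe : IntegrableOn (fun r => p r * Z' r ^ 2 + q r * Z r ^ 2) (Ioo 0 ρ) :=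
    hZ_energy.congr_fun (henergy Z Z') measurableSet_Ioo
  have hve : IntegrableOn (fun r => p r * v' r ^ 2 + q r * v r ^ 2) (Ioo 0 ρ) :=
    hv_energy.congr_fun (henergy v v') measurableSet_Ioo
  have hC : 0 ≤ 1 + M := by linarith
  obtain ⟨-, hZZ⟩ := integral_bilinear_energy_eq hρ0 hC hp_meas hq_meas hp hq hpq hZ hflux hZ
    hZe hZe
  obtain ⟨hZv_int, hZv⟩ := integral_bilinear_energy_eq hρ0 hC hp_meas hq_meas hp hq hpq hZ hflux
    hv hZe hve
  have hZJ : ∫ r in Ioo 0 ρ, (p r * Z' r ^ 2 + q r * Z r ^ 2) = p ρ * Z' ρ * Z ρ := by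
    rw [← hZZ]
    exact integral_congr_ae (ae_of_all _ fun r => by ring)
  have hZρ : Z ρ ≠ 0 := (hZ_pos ρ hρmem).ne'
  have hvalue : (1 + g ρ) * ρ ^ ((n : ℝ) - 1) * (Z' ρ / Z ρ) * b ^ 2 =
      (b / Z ρ) ^ 2 * (p ρ * Z' ρ * Z ρ) := by
    simp only [hp_def]
    field_simp
  rw [hvalue]
  refine ⟨?_, ?_⟩
  · rw [setIntegral_congr_fun measurableSet_Ioo (henergy v v'), ge_iff_le]
    set t := b / Z ρ with ht
    have hbt : v ρ = t * Z ρ := by rw [hvb, ht, div_mul_cancel₀ _ hZρ]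
    have hnonneg : 0 ≤ ∫ r in Ioo 0 ρ, ((p r * v' r ^ 2 + q r * v r ^ 2) -
        2 * t * (q r * Z r * v r + p r * Z' r * v' r) +
        t ^ 2 * (p r * Z' r ^ 2 + q r * Z r ^ 2)) := by
      refine setIntegral_nonneg measurableSet_Ioo fun r hr => ?_
      have h1 := mul_nonneg (hp r hr) (sq_nonneg (v' r - t * Z' r))
      have h2 := mul_nonneg (hq r hr) (sq_nonneg (v r - t * Z r))
      linarith
    have hsub_int : IntegrableOn (fun r => (p r * v' r ^ 2 + q r * v r ^ 2) -
        2 * t * (q r * Z r * v r + p r * Z' r * v' r)) (Ioo 0 ρ) :=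
      hve.sub (hZv_int.const_mul (2 * t))
    rw [integral_add hsub_int (hZe.const_mul (t ^ 2)),
      integral_sub hve (hZv_int.const_mul (2 * t)), integral_const_mul, integral_const_mul,
      hZv, hZJ, hbt] at hnonneg
    linarith
  · rw [setIntegral_congr_fun measurableSet_Ioo
      (henergy (fun r => b * Z r / Z ρ) (fun r => b * Z' r / Z ρ)), ← hZJ, ← integral_const_mul]
    exact integral_congr_ae (ae_of_all _ fun r => by ring)
end

section
/- Let n ≥ 2 be an integer and let g : (0,1] → ℝ be bounded and measurable with 1 + g(r) ≥ ε for some ε > 0. Let Z : (0,1] → ℝ be a solution of the ODE (r^{n−1}(1+g(r)) Z′(r))′ = (n−1) r^{n−3} Z(r) on (0,1) satisfying the finite energy condition ∫_0^1 ( |Z′(r)|² + r^{−2} |Z(r)|² ) r^{n−1} dr < ∞ and Z(1) > 0. Then Z(r) > 0 for all r ∈ (0,1]. -/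
open Set Filter MeasureTheory

/-- If `|F r| / r` is dominated by an integrable function near `0`, a monotone `F` is
nonnegative. -/
lemma nonneg_of_monotoneOn_of_integrableOn {F D : ℝ → ℝ} {C : ℝ}
    (hF : MonotoneOn F (Ioo (0:ℝ) 1)) (hD : IntegrableOn D (Ioo (0:ℝ) 1))
    (hle : ∀ r ∈ Ioo (0:ℝ) 1, |F r| * r⁻¹ ≤ C * D r) :
    ∀ r ∈ Ioo (0:ℝ) 1, 0 ≤ F r := by
  intro r hr
  by_contra! hneg
  have hsub : Ioo 0 r ⊆ Ioo (0:ℝ) 1 := Ioo_subset_Ioo_right hr.2.le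
  have hint : IntegrableOn (fun x => |F r|⁻¹ * (C * D x)) (Ioo 0 r) :=
    ((hD.mono_set hsub).const_mul C).const_mul _
  have hinv : IntegrableOn (fun x : ℝ => x⁻¹) (Ioo 0 r) := by
    refine Integrable.mono' hint measurable_inv.aestronglyMeasurable ?_
    filter_upwards [ae_restrict_mem measurableSet_Ioo] with x hx
    have hx0 : 0 < x⁻¹ := inv_pos.2 hx.1
    rw [Real.norm_of_nonneg hx0.le, ← div_eq_inv_mul, le_div_iff₀ (abs_pos.2 hneg.ne)]
    have hFx : F x ≤ F r := hF (hsub hx) hr hx.2.le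
    have habs : |F r| ≤ |F x| := by
      rw [abs_of_neg hneg, abs_of_neg (hFx.trans_lt hneg)]
      linarith
    nlinarith [hle x (hsub hx)]
  have hii : IntervalIntegrable (fun x : ℝ => x⁻¹) volume 0 r := by
    rw [intervalIntegrable_iff_integrableOn_Ioo_of_le hr.1.le]
    exact hinv
  rw [intervalIntegrable_inv_iff] at hii
  rcases hii with h | h
  · exact hr.1.ne h
  · exact h left_mem_uIcc

/-- A function that is positive at the right end of `(0,1]` but not everywhere has a last zero. -/
lemma exists_last_zero {Z : ℝ → ℝ} (hZ : ContinuousOn Z (Ioc (0:ℝ) 1)) (hZ1 : 0 < Z 1)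
    {r : ℝ} (hr : r ∈ Ioc (0:ℝ) 1) (hZr : Z r ≤ 0) :
    ∃ a ∈ Ioo (0:ℝ) 1, Z a = 0 ∧ ∀ x ∈ Ioc a 1, 0 < Z x := by
  have hivt : ∀ x ∈ Ioc (0:ℝ) 1, Z x ≤ 0 → ∃ y ∈ Icc x 1, Z y = 0 := fun x hx hZx =>
    intermediate_value_Icc hx.2
      (hZ.mono fun y hy => ⟨hx.1.trans_le hy.1, hy.2⟩) ⟨hZx, hZ1.le⟩
  have hcont : ContinuousOn Z (Icc r 1) := hZ.mono fun y hy => ⟨hr.1.trans_le hy.1, hy.2⟩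
  have hcomp : IsCompact (Icc r 1 ∩ Z ⁻¹' {0}) :=
    isCompact_Icc.of_isClosed_subset
      (hcont.preimage_isClosed_of_isClosed isClosed_Icc isClosed_singleton) inter_subset_left
  obtain ⟨y, hy, hZy⟩ := hivt r hr hZr
  obtain ⟨a, ⟨ha, hZa⟩, hmax⟩ := hcomp.exists_isGreatest ⟨y, hy, hZy⟩
  have hZa : Z a = 0 := hZa
  refine ⟨a, ⟨hr.1.trans_le ha.1, lt_of_le_of_ne ha.2 ?_⟩, hZa, fun x hx => ?_⟩
  · rintro rfl
    exact hZ1.ne' hZa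
  · by_contra! hneg
    obtain ⟨z, hz, hZz⟩ := hivt x ⟨hr.1.trans_le (ha.1.trans hx.1.le), hx.2⟩ hneg
    have : z ≤ a := hmax ⟨⟨ha.1.trans (hx.1.le.trans hz.1), hz.2⟩, hZz⟩
    linarith [hx.1, hz.1]

/-- Let `g` be bounded measurable on `(0,1]` with `1 + g ≥ ε > 0`, and let
`Z : (0,1] → ℝ` solve `(r^{n−1}(1+g)Z′)′ = (n−1)r^{n−3}Z` on `(0,1)` (being continuous up
to `r = 1`), satisfying the finite energy condition
`∫₀¹ (|Z′|² + r^{−2}|Z|²) r^{n−1} dr < ∞` and `Z(1) > 0`. Then `Z(r) > 0` for all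
`r ∈ (0,1]`. -/
theorem stmt_8 (n : ℕ) (hn : 2 ≤ n)
    (g : ℝ → ℝ) (hg_meas : Measurable g)
    (hg_bdd : ∃ M : ℝ, ∀ r ∈ Ioc (0:ℝ) 1, |g r| ≤ M)
    (ε : ℝ) (hε : 0 < ε) (hell : ∀ r ∈ Ioc (0:ℝ) 1, ε ≤ 1 + g r)
    (Z Z' : ℝ → ℝ)
    (hZ_cont : ContinuousOn Z (Ioc (0:ℝ) 1))
    (hZ_deriv : ∀ r ∈ Ioo (0:ℝ) 1, HasDerivAt Z (Z' r) r)
    (hZ_ode : ∀ r ∈ Ioo (0:ℝ) 1,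
      HasDerivAt (fun s => s ^ ((n:ℝ) - 1) * (1 + g s) * Z' s)
        (((n:ℝ) - 1) * r ^ ((n:ℝ) - 3) * Z r) r)
    (hZ_energy : IntegrableOn
      (fun r => (Z' r ^ 2 + Z r ^ 2 / r ^ 2) * r ^ ((n:ℝ) - 1)) (Ioo (0:ℝ) 1))
    (hZ1 : 0 < Z 1) :
    ∀ r ∈ Ioc (0:ℝ) 1, 0 < Z r := by
  obtain ⟨M, hM⟩ := hg_bdd
  have hn1 : (1:ℝ) ≤ (n:ℝ) - 1 := by
    have : (2:ℝ) ≤ n := by exact_mod_cast hn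
    linarith
  set W : ℝ → ℝ := fun s => s ^ ((n:ℝ) - 1) * (1 + g s) * Z' s with hW
  have hpos : ∀ r ∈ Ioo (0:ℝ) 1, 0 < r ^ ((n:ℝ) - 1) * (1 + g r) := fun r hr =>
    mul_pos (Real.rpow_pos_of_pos hr.1 _) (hε.trans_le (hell r ⟨hr.1, hr.2.le⟩))
  have hderivF : ∀ r ∈ Ioo (0:ℝ) 1, HasDerivAt (fun s => Z s * W s)
      (Z' r * W r + Z r * (((n:ℝ) - 1) * r ^ ((n:ℝ) - 3) * Z r)) r := fun r hr =>
    (hZ_deriv r hr).mul (hZ_ode r hr)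
  have hF_mono : MonotoneOn (fun s => Z s * W s) (Ioo (0:ℝ) 1) := by
    refine monotoneOn_of_deriv_nonneg (convex_Ioo 0 1)
      (fun r hr => (hderivF r hr).continuousAt.continuousWithinAt) ?_ ?_
    · rw [interior_Ioo]
      exact fun r hr => (hderivF r hr).differentiableAt.differentiableWithinAt
    · rw [interior_Ioo]
      intro r hr
      rw [(hderivF r hr).deriv]
      have h1 : 0 ≤ Z' r * W r := by
        have : Z' r * W r = r ^ ((n:ℝ) - 1) * (1 + g r) * Z' r ^ 2 := by simp only [hW]; ring
        rw [this]
        exact mul_nonneg (hpos r hr).le (sq_nonneg _)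
      have h2 : 0 ≤ Z r * (((n:ℝ) - 1) * r ^ ((n:ℝ) - 3) * Z r) := by
        have : Z r * (((n:ℝ) - 1) * r ^ ((n:ℝ) - 3) * Z r)
            = ((n:ℝ) - 1) * r ^ ((n:ℝ) - 3) * Z r ^ 2 := by ring
        rw [this]
        have := Real.rpow_pos_of_pos hr.1 ((n:ℝ) - 3)
        positivity
      exact add_nonneg h1 h2
  have hF_nonneg : ∀ r ∈ Ioo (0:ℝ) 1, 0 ≤ Z r * W r := by
    refine nonneg_of_monotoneOn_of_integrableOn (C := 1 + M) hF_mono hZ_energy fun r hr => ?_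
    have hr' : r ∈ Ioc (0:ℝ) 1 := ⟨hr.1, hr.2.le⟩
    have hp := Real.rpow_pos_of_pos hr.1 ((n:ℝ) - 1)
    have hg0 : 0 < 1 + g r := hε.trans_le (hell r hr')
    have hg1 : 1 + g r ≤ 1 + M := by linarith [le_abs_self (g r), hM r hr']
    have hamgm : |Z r * r⁻¹ * Z' r| ≤ Z' r ^ 2 + Z r ^ 2 / r ^ 2 := by
      have hq : Z r ^ 2 / r ^ 2 = (Z r * r⁻¹) ^ 2 := by rw [mul_pow, inv_pow, div_eq_mul_inv]
      rw [hq, abs_le]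
      constructor <;>
        nlinarith [sq_nonneg (Z r * r⁻¹ + Z' r), sq_nonneg (Z r * r⁻¹ - Z' r),
          sq_nonneg (Z r * r⁻¹), sq_nonneg (Z' r)]
    have hE : 0 ≤ Z' r ^ 2 + Z r ^ 2 / r ^ 2 := by positivity
    calc |Z r * W r| * r⁻¹
        = (1 + g r) * (|Z r * r⁻¹ * Z' r| * r ^ ((n:ℝ) - 1)) := by
          simp only [hW, abs_mul, abs_of_pos hp, abs_of_pos hg0, abs_of_pos (inv_pos.2 hr.1)]
          ring
      _ ≤ (1 + M) * ((Z' r ^ 2 + Z r ^ 2 / r ^ 2) * r ^ ((n:ℝ) - 1)) := by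
          gcongr
          linarith
  have hsq_mono : MonotoneOn (fun s => Z s ^ 2) (Ioc (0:ℝ) 1) := by
    refine monotoneOn_of_deriv_nonneg (convex_Ioc 0 1) (hZ_cont.pow 2) ?_ ?_
    · rw [interior_Ioc]
      exact fun r hr => ((hZ_deriv r hr).pow 2).differentiableAt.differentiableWithinAt
    · rw [interior_Ioc]
      intro r hr
      have hd : HasDerivAt (fun s => Z s ^ 2) (2 * (Z r * Z' r)) r :=
        ((hZ_deriv r hr).pow 2).congr_deriv (by push_cast; ring)
      rw [hd.deriv]
      have h := hF_nonneg r hr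
      have he : Z r * W r = r ^ ((n:ℝ) - 1) * (1 + g r) * (Z r * Z' r) := by
        simp only [hW]; ring
      rw [he] at h
      have := nonneg_of_mul_nonneg_right h (hpos r hr)
      positivity
  intro r₀ hr₀
  by_contra! hneg
  obtain ⟨a, ha, hZa, hZpos⟩ := exists_last_zero hZ_cont hZ1 hr₀ hneg
  have hZ_nonneg : ∀ x ∈ Ioc (0:ℝ) 1, 0 ≤ Z x := by
    intro x hx
    rcases le_or_gt x a with hxa | hxa
    · have h : Z x ^ 2 ≤ Z a ^ 2 := hsq_mono hx ⟨ha.1, ha.2.le⟩ hxa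
      rw [hZa] at h
      have : Z x = 0 := by nlinarith [sq_nonneg (Z x)]
      exact this.ge
    · exact (hZpos x ⟨hxa, hx.2⟩).le
  have hZ_mono : MonotoneOn Z (Ioc (0:ℝ) 1) := fun x hx y hy hxy =>
    (pow_le_pow_iff_left₀ (hZ_nonneg x hx) (hZ_nonneg y hy) two_ne_zero).1 (hsq_mono hx hy hxy)
  have hZ'a : Z' a = 0 := by
    refine IsLocalMin.hasDerivAt_eq_zero ?_ (hZ_deriv a ha)
    filter_upwards [Ioo_mem_nhds ha.1 ha.2] with x hx
    rw [hZa]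
    exact hZ_nonneg x ⟨hx.1, hx.2.le⟩
  have hWa : W a = 0 := by simp [hW, hZ'a]
  have hap := Real.rpow_pos_of_pos ha.1 ((n:ℝ) - 1)
  have hbound : ∀ r ∈ Ioo a 1, a ^ ((n:ℝ) - 1) * ε * a ≤ ((n:ℝ) - 1) * (r - a) ^ 2 := by
    intro r hr
    have hr0 : 0 < r := ha.1.trans hr.1
    have hra : 0 < r - a := sub_pos.2 hr.1
    obtain ⟨ξ, hξ, hZξ⟩ := exists_hasDerivAt_eq_slope Z Z' hr.1
      (hZ_cont.mono fun y hy => ⟨ha.1.trans_le hy.1, hy.2.trans hr.2.le⟩)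
      (fun y hy => hZ_deriv y ⟨ha.1.trans hy.1, hy.2.trans hr.2⟩)
    have hξ0 : 0 < ξ := ha.1.trans hξ.1
    have hξ1 : ξ < 1 := hξ.2.trans hr.2
    obtain ⟨η, hη, hWη⟩ := exists_hasDerivAt_eq_slope W
      (fun r => ((n:ℝ) - 1) * r ^ ((n:ℝ) - 3) * Z r) hξ.1
      (fun y hy => (hZ_ode y
        ⟨ha.1.trans_le hy.1, hy.2.trans_lt hξ1⟩).continuousAt.continuousWithinAt)
      (fun y hy => hZ_ode y ⟨ha.1.trans hy.1, hy.2.trans hξ1⟩)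
    have hη0 : 0 < η := ha.1.trans hη.1
    have hη1 : η < 1 := hη.2.trans hξ1
    have hξa : 0 < ξ - a := sub_pos.2 hξ.1
    rw [hZa, sub_zero, eq_div_iff hra.ne'] at hZξ
    rw [hWa, sub_zero, eq_div_iff hξa.ne'] at hWη
    have hZr : 0 < Z r := hZpos r ⟨hr.1, hr.2.le⟩
    have hZ'ξ : 0 < Z' ξ := pos_of_mul_pos_left (hZξ ▸ hZr) hra.le
    have hlow : a ^ ((n:ℝ) - 1) * ε * Z' ξ ≤ W ξ := by
      have h1 : a ^ ((n:ℝ) - 1) ≤ ξ ^ ((n:ℝ) - 1) :=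
        Real.rpow_le_rpow ha.1.le hξ.1.le (by linarith)
      have h2 : ε ≤ 1 + g ξ := hell ξ ⟨hξ0, hξ1.le⟩
      simp only [hW]
      gcongr
    have hηpow : η ^ ((n:ℝ) - 3) ≤ a⁻¹ := by
      calc η ^ ((n:ℝ) - 3) ≤ η ^ (-1 : ℝ) :=
            Real.rpow_le_rpow_of_exponent_ge hη0 hη1.le (by linarith)
        _ = η⁻¹ := Real.rpow_neg_one η
        _ ≤ a⁻¹ := inv_anti₀ ha.1 hη.1.le
    have hup : W ξ ≤ ((n:ℝ) - 1) * a⁻¹ * Z r * (r - a) := by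
      rw [← hWη]
      have h1 : Z η ≤ Z r :=
        hZ_mono ⟨hη0, hη1.le⟩ ⟨hr0, hr.2.le⟩ (hη.2.trans hξ.2).le
      have h2 : 0 ≤ Z η := hZ_nonneg η ⟨hη0, hη1.le⟩
      have h3 := ha.1
      have h4 := hξ.2.le
      gcongr
    have hfin : Z r * (a ^ ((n:ℝ) - 1) * ε * a) ≤ Z r * (((n:ℝ) - 1) * (r - a) ^ 2) := by
      calc Z r * (a ^ ((n:ℝ) - 1) * ε * a)
          = a ^ ((n:ℝ) - 1) * ε * Z' ξ * ((r - a) * a) := by rw [← hZξ]; ring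
        _ ≤ ((n:ℝ) - 1) * a⁻¹ * Z r * (r - a) * ((r - a) * a) :=
            mul_le_mul_of_nonneg_right (hlow.trans hup) (mul_pos hra ha.1).le
        _ = Z r * (((n:ℝ) - 1) * (r - a) ^ 2) := by
            have := ha.1.ne'
            field_simp
    exact le_of_mul_le_mul_left hfin hZr
  have hlim : Tendsto (fun r : ℝ => ((n:ℝ) - 1) * (r - a) ^ 2) (nhdsWithin a (Ioi a))
      (nhds 0) := by
    have hc : Continuous fun r : ℝ => ((n:ℝ) - 1) * (r - a) ^ 2 := by fun_prop
    simpa using (hc.tendsto a).mono_left nhdsWithin_le_nhds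
  have hle : a ^ ((n:ℝ) - 1) * ε * a ≤ 0 :=
    ge_of_tendsto hlim (by
      filter_upwards [Ioo_mem_nhdsGT ha.2] with r hr using hbound r hr)
  exact absurd hle (not_le.2 (mul_pos (mul_pos hap hε) ha.1))
end

section
/- Let n ≥ 2 be an integer and γ > 0. Define a(x) = (−log |x|)^{−γ} on the punctured ball {0 < |x| < 1/2} ⊂ ℝⁿ, and for 0 < r < 1/2 define the mean oscillation at the origin ω_a(r) := ⨍_{B_r} | a(y) − ⨍_{B_r} a | dy, where B_r is the ball of radius r centered at 0 and ⨍ denotes the mean with respect to Lebesgue measure. Then there exist constants C > 0 and r₀ ∈ (0,1/2) such that ω_a(r) ≤ C (−log r)^{−γ−1} for all 0 < r < r₀, and consequently ∫_0^{r₀} ω_a(r)/r dr < ∞; that is, a has Dini mean oscillation at x = 0 for every γ > 0. -/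
open Set Filter MeasureTheory Metric

/-- The mean oscillation is at most twice the mean distance to any constant. -/
lemma average_abs_sub_average_le {α : Type*} [MeasurableSpace α] {μ : Measure α}
    [IsFiniteMeasure μ] [NeZero μ] {g : α → ℝ} (hg : Integrable g μ) (c : ℝ) :
    (⨍ x, |g x - ⨍ y, g y ∂μ| ∂μ) ≤ 2 * ⨍ x, |g x - c| ∂μ := by
  set ν := (μ univ)⁻¹ • μ with hν
  have hgν : Integrable g ν := hg.to_average
  have : IsProbabilityMeasure ν := isProbabilityMeasureSMul
  simp only [average_eq', ← hν]
  have hgc : Integrable (fun x => g x - c) ν := hgν.sub (integrable_const c)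
  have hmean : |c - ∫ y, g y ∂ν| ≤ ∫ x, |g x - c| ∂ν := by
    have hsub : ∫ x, (g x - c) ∂ν = (∫ y, g y ∂ν) - c := by
      rw [integral_sub hgν (integrable_const c)]
      simp
    rw [abs_sub_comm, ← hsub]
    exact abs_integral_le_integral_abs
  calc ∫ x, |g x - ∫ y, g y ∂ν| ∂ν
      ≤ ∫ x, (|g x - c| + |c - ∫ y, g y ∂ν|) ∂ν :=
        integral_mono (hgν.sub (integrable_const _)).abs (hgc.abs.add (integrable_const _))
          fun x => abs_sub_le _ _ _
    _ = (∫ x, |g x - c| ∂ν) + |c - ∫ y, g y ∂ν| := by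
        rw [integral_add hgc.abs (integrable_const _)]
        simp
    _ ≤ 2 * ∫ x, |g x - c| ∂ν := by linarith

lemma rpow_neg_sub_rpow_neg_le {γ L t : ℝ} (hγ : 0 ≤ γ) (hL : 0 < L) (ht : L ≤ t) :
    L ^ (-γ) - t ^ (-γ) ≤ γ * L ^ (-γ - 1) * (t - L) := by
  have ht0 : 0 < t := hL.trans_le ht
  have hratio : t ^ (-γ) = L ^ (-γ) * Real.exp (-γ * Real.log (t / L)) := by
    rw [Real.rpow_def_of_pos ht0, Real.rpow_def_of_pos hL, ← Real.exp_add,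
      Real.log_div ht0.ne' hL.ne']
    ring_nf
  have hexp := Real.add_one_le_exp (-γ * Real.log (t / L))
  have hlog : γ * Real.log (t / L) ≤ γ * (t / L - 1) :=
    mul_le_mul_of_nonneg_left (Real.log_le_sub_one_of_pos (div_pos ht0 hL)) hγ
  have hLγ : 0 < L ^ (-γ) := Real.rpow_pos_of_pos hL _
  have hscale : γ * L ^ (-γ - 1) * (t - L) = L ^ (-γ) * (γ * (t / L - 1)) := by
    rw [Real.rpow_sub_one hL.ne']
    field_simp
  rw [hscale, hratio]
  nlinarith

section NormedSpace

variable {E : Type*} [NormedAddCommGroup E] [MeasurableSpace E] (μ : Measure E)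

/-- The mean oscillation of `(-log ‖x‖) ^ (-γ)` over the ball of radius `r` about the origin. -/
noncomputable def logPowOsc (γ r : ℝ) : ℝ :=
  ⨍ y in ball (0 : E) r, |(-Real.log ‖y‖) ^ (-γ) -
    ⨍ z in ball (0 : E) r, (-Real.log ‖z‖) ^ (-γ) ∂μ| ∂μ

lemma logPowOsc_nonneg (γ r : ℝ) : 0 ≤ logPowOsc μ γ r :=
  integral_nonneg fun _ => abs_nonneg _

variable [BorelSpace E]

lemma setAverage_neg_log_norm_unitBall_nonneg :
    0 ≤ ⨍ x in ball (0 : E) 1, (-Real.log ‖x‖) ∂μ := by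
  rw [setAverage_eq]
  refine smul_nonneg (by positivity) (setIntegral_nonneg measurableSet_ball fun x hx => ?_)
  exact neg_nonneg.2 (Real.log_nonpos (norm_nonneg x) (mem_ball_zero_iff.1 hx).le)

variable [NormedSpace ℝ E] [FiniteDimensional ℝ E] [μ.IsAddHaarMeasure]

lemma measurable_setAverage_ball {h : ℝ × E → ℝ} (hh : Measurable h) :
    Measurable fun r : ℝ => ⨍ y in ball (0 : E) r, h (r, y) ∂μ := by
  simp only [setAverage_eq, smul_eq_mul, ← integral_indicator measurableSet_ball]
  have hvol : Monotone fun r : ℝ => μ (ball (0 : E) r) :=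
    fun _ _ hrs => measure_mono (ball_subset_ball hrs)
  refine hvol.measurable.ennreal_toReal.inv.mul ?_
  have hset : MeasurableSet {p : ℝ × E | ‖p.2‖ < p.1} :=
    measurableSet_lt (by fun_prop) (by fun_prop)
  have hint := (hh.indicator hset).stronglyMeasurable.integral_prod_right' (ν := μ)
  convert hint.measurable using 4
  simp [indicator]

lemma measurable_logPowOsc (γ : ℝ) : Measurable (logPowOsc μ γ) := by
  have hmean : Measurable fun r : ℝ => ⨍ z in ball (0 : E) r, (-Real.log ‖z‖) ^ (-γ) ∂μ :=
    measurable_setAverage_ball μ (h := fun p => (-Real.log ‖p.2‖) ^ (-γ)) (by fun_prop)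
  refine measurable_setAverage_ball μ (h := fun p => |(-Real.log ‖p.2‖) ^ (-γ) -
    ⨍ z in ball (0 : E) p.1, (-Real.log ‖z‖) ^ (-γ) ∂μ|) ?_
  exact (Measurable.sub (by fun_prop) (hmean.comp measurable_fst)).abs

variable [Nontrivial E]

lemma integrableOn_log_norm_ball (R : ℝ) :
    IntegrableOn (fun x : E => Real.log ‖x‖) (ball 0 R) μ := by
  rcases le_or_gt R 0 with hR | hR
  · simp [ball_eq_empty.2 hR]
  rw [integrableOn_fun_norm_addHaar μ (f := Real.log)]
  refine IntegrableOn.mono_set ?_ Ioo_subset_Ioc_self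
  rw [← intervalIntegrable_iff_integrableOn_Ioc_of_le hR.le]
  exact intervalIntegral.intervalIntegrable_log'.continuousOn_smul
    (by fun_prop : ContinuousOn (fun y : ℝ => y ^ (Module.finrank ℝ E - 1)) (uIcc 0 R))

/-- By scaling, the mean over `B_r` of `log r - log ‖x‖` does not depend on `r`. -/
lemma setAverage_log_sub_log_norm {r : ℝ} (hr : 0 < r) :
    (⨍ x in ball (0 : E) r, (Real.log r - Real.log ‖x‖) ∂μ) =
      ⨍ x in ball (0 : E) 1, (-Real.log ‖x‖) ∂μ := by
  have hscale := Measure.setIntegral_comp_smul_of_pos μ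
    (fun x : E => Real.log r - Real.log ‖x‖) (ball (0 : E) 1) hr
  have hvol : μ.real (ball (0 : E) r) = r ^ Module.finrank ℝ E * μ.real (ball (0 : E) 1) := by
    rw [measureReal_def, Measure.addHaar_ball μ _ hr.le, ENNReal.toReal_mul,
      ENNReal.toReal_ofReal (by positivity), measureReal_def]
  have hcongr : ∫ x in ball (0 : E) 1, (Real.log r - Real.log ‖r • x‖) ∂μ =
      ∫ x in ball (0 : E) 1, (-Real.log ‖x‖) ∂μ := by
    refine integral_congr_ae (ae_restrict_of_ae ?_)
    filter_upwards [Measure.ae_ne μ (0 : E)] with x hx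
    rw [norm_smul, Real.norm_of_nonneg hr.le, Real.log_mul hr.ne' (norm_ne_zero_iff.2 hx)]
    ring
  rw [setAverage_eq, setAverage_eq, ← hcongr, hscale, smul_unitBall_of_pos hr, hvol, mul_inv,
    smul_smul, mul_comm]

lemma logPowOsc_le {γ r : ℝ} (hγ : 0 ≤ γ) (hr0 : 0 < r) (hr1 : r < 1) :
    logPowOsc μ γ r ≤
      2 * γ * (⨍ x in ball (0 : E) 1, (-Real.log ‖x‖) ∂μ) * (-Real.log r) ^ (-γ - 1) := by
  set L := -Real.log r
  have hL : 0 < L := neg_pos.2 (Real.log_neg hr0 hr1)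
  have : Fact (μ (ball (0 : E) r) < ⊤) := ⟨measure_ball_lt_top⟩
  have : NeZero (μ.restrict (ball (0 : E) r)) :=
    ⟨by simpa using (measure_ball_pos μ (0 : E) hr0).ne'⟩
  have hlog : Integrable (fun x : E => Real.log r - Real.log ‖x‖) (μ.restrict (ball 0 r)) :=
    (integrable_const _).sub (integrableOn_log_norm_ball μ r)
  have hbound : ∀ᵐ x ∂μ.restrict (ball (0 : E) r), |(-Real.log ‖x‖) ^ (-γ) - L ^ (-γ)| ≤
      γ * L ^ (-γ - 1) * (Real.log r - Real.log ‖x‖) := by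
    filter_upwards [ae_restrict_mem measurableSet_ball, ae_restrict_of_ae (Measure.ae_ne μ (0 : E))]
      with x hx hx0
    have hLx : L ≤ -Real.log ‖x‖ :=
      neg_le_neg (Real.log_le_log (norm_pos_iff.2 hx0) (mem_ball_zero_iff.1 hx).le)
    have hle := Real.rpow_le_rpow_of_nonpos hL hLx (neg_nonpos.2 hγ)
    rw [abs_of_nonpos (sub_nonpos.2 hle), neg_sub]
    convert rpow_neg_sub_rpow_neg_le hγ hL hLx using 2
    ring
  have hdiff : Integrable (fun x : E => (-Real.log ‖x‖) ^ (-γ) - L ^ (-γ))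
      (μ.restrict (ball 0 r)) :=
    (hlog.const_mul (γ * L ^ (-γ - 1))).mono'
      (by fun_prop : Measurable fun x : E => (-Real.log ‖x‖) ^ (-γ) - L ^ (-γ)).aestronglyMeasurable
      hbound
  have hpow : Integrable (fun x : E => (-Real.log ‖x‖) ^ (-γ)) (μ.restrict (ball 0 r)) := by
    refine (hdiff.add (integrable_const (L ^ (-γ)))).congr (.of_forall fun x => ?_)
    simp
  have hmono : (⨍ x in ball (0 : E) r, |(-Real.log ‖x‖) ^ (-γ) - L ^ (-γ)| ∂μ) ≤
      γ * L ^ (-γ - 1) * ⨍ x in ball (0 : E) r, (Real.log r - Real.log ‖x‖) ∂μ := by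
    rw [setAverage_eq, setAverage_eq, smul_eq_mul, smul_eq_mul,
      mul_left_comm (γ * L ^ (-γ - 1)), ← integral_const_mul (γ * L ^ (-γ - 1))]
    exact mul_le_mul_of_nonneg_left
      (integral_mono_ae hdiff.abs (hlog.const_mul _) hbound) (by positivity)
  rw [setAverage_log_sub_log_norm μ hr0] at hmono
  have hosc := average_abs_sub_average_le hpow (L ^ (-γ))
  rw [logPowOsc]
  linarith

end NormedSpace

lemma integrableOn_neg_log_rpow_div {γ b : ℝ} (hγ : 0 < γ) (hb : b < 1) :
    IntegrableOn (fun x : ℝ => (-Real.log x) ^ (-γ - 1) / x) (Ioc 0 b) := by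
  have hderiv : ∀ x ∈ Ioc 0 b, HasDerivAt (fun x : ℝ => (-Real.log x) ^ (-γ))
      (γ * ((-Real.log x) ^ (-γ - 1) / x)) x := by
    intro x hx
    have hL : 0 < -Real.log x := neg_pos.2 (Real.log_neg hx.1 (hx.2.trans_lt hb))
    have hlog : HasDerivAt (fun x : ℝ => -Real.log x) (-x⁻¹) x :=
      (Real.hasDerivAt_log hx.1.ne').neg
    convert hlog.rpow_const (p := -γ) (Or.inl hL.ne') using 1
    ring
  have hcont : ContinuousOn (fun x : ℝ => (-Real.log x) ^ (-γ)) (Icc 0 b) := by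
    intro x hx
    rcases hx.1.eq_or_lt with rfl | hx0
    · have hlim : Tendsto (fun x : ℝ => (-Real.log x) ^ (-γ)) (nhdsWithin 0 (Ioi 0)) (nhds 0) :=
        (tendsto_rpow_neg_atTop hγ).comp
          (tendsto_neg_atBot_atTop.comp Real.tendsto_log_nhdsGT_zero)
      have hIoi : ContinuousWithinAt (fun x : ℝ => (-Real.log x) ^ (-γ)) (Ioi 0) 0 := by
        simpa [ContinuousWithinAt, Real.zero_rpow (neg_ne_zero.2 hγ.ne')] using hlim
      exact (continuousWithinAt_Ioi_iff_Ici.1 hIoi).mono Icc_subset_Ici_self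
    · exact (hderiv x ⟨hx0, hx.2⟩).continuousAt.continuousWithinAt
  have hint := intervalIntegral.integrableOn_deriv_of_nonneg hcont
    (fun x hx => hderiv x ⟨hx.1, hx.2.le⟩) fun x hx => by
      have hL : 0 < -Real.log x := neg_pos.2 (Real.log_neg hx.1 (hx.2.trans hb))
      have := hx.1
      positivity
  exact (integrable_const_mul_iff (isUnit_iff_ne_zero.2 hγ.ne') _).1 hint

/-- For `n ≥ 2` and `γ > 0`, the function `a(x) = (−log|x|)^{−γ}` on the
punctured ball `{0 < |x| < 1/2} ⊂ ℝⁿ` has mean oscillation at the origin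
`ω_a(r) = ⨍_{B_r} |a − ⨍_{B_r} a|` bounded by `C(−log r)^{−γ−1}` for small `r`, and hence
`∫₀^{r₀} ω_a(r)/r dr < ∞`: `a` has Dini mean oscillation at `x = 0` for every `γ > 0`. -/
theorem stmt_12 (n : ℕ) (hn : 2 ≤ n) (γ : ℝ) (hγ : 0 < γ) :
    ∃ C : ℝ, 0 < C ∧ ∃ r₀ ∈ Ioo (0:ℝ) (1/2),
      (∀ r ∈ Ioo (0:ℝ) r₀,
        (⨍ y in ball (0 : EuclideanSpace ℝ (Fin n)) r,
            |(-Real.log ‖y‖) ^ (-γ) -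
              ⨍ z in ball (0 : EuclideanSpace ℝ (Fin n)) r, (-Real.log ‖z‖) ^ (-γ)|)
          ≤ C * (-Real.log r) ^ (-γ - 1)) ∧
      IntegrableOn
        (fun r => (⨍ y in ball (0 : EuclideanSpace ℝ (Fin n)) r,
            |(-Real.log ‖y‖) ^ (-γ) -
              ⨍ z in ball (0 : EuclideanSpace ℝ (Fin n)) r, (-Real.log ‖z‖) ^ (-γ)|) / r)
        (Ioo (0:ℝ) r₀) := by
  have : Nontrivial (EuclideanSpace ℝ (Fin n)) :=
    Module.nontrivial_of_finrank_pos (R := ℝ) (by simp; omega)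
  set K := ⨍ x in ball (0 : EuclideanSpace ℝ (Fin n)) 1, (-Real.log ‖x‖)
  have hK : 0 ≤ K := setAverage_neg_log_norm_unitBall_nonneg volume
  have hle : ∀ r ∈ Ioo (0:ℝ) (1/4),
      logPowOsc (volume : Measure (EuclideanSpace ℝ (Fin n))) γ r ≤
        (2 * γ * K + 1) * (-Real.log r) ^ (-γ - 1) := by
    intro r hr
    have hr1 : r < 1 := hr.2.trans (by norm_num)
    have hL : 0 < -Real.log r := neg_pos.2 (Real.log_neg hr.1 hr1)
    refine (logPowOsc_le volume hγ.le hr.1 hr1).trans ?_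
    exact mul_le_mul_of_nonneg_right (by linarith) (Real.rpow_pos_of_pos hL _).le
  refine ⟨2 * γ * K + 1, by positivity, 1/4, by norm_num, hle, ?_⟩
  have hdom := ((integrableOn_neg_log_rpow_div (b := 1/4) hγ
    (by norm_num)).mono_set Ioo_subset_Ioc_self).const_mul (2 * γ * K + 1)
  refine hdom.mono' ((measurable_logPowOsc volume γ).div measurable_id).aestronglyMeasurable ?_
  filter_upwards [ae_restrict_mem measurableSet_Ioo] with r hr
  change ‖logPowOsc volume γ r / r‖ ≤ _
  rw [Real.norm_of_nonneg (div_nonneg (logPowOsc_nonneg _ _ _) hr.1.le), ← mul_div_assoc]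
  exact div_le_div_of_nonneg_right (hle r hr) hr.1.le
end

section
/- Let β > 0. Then for all t₁, t₂ with 2π ≤ t₁ ≤ t₂ one has ∫_{t₁}^{t₂} (sin τ)/τ^β dτ ≤ ∫_{2π}^{3π} (sin τ)/τ^β dτ. -/
theorem intervalIntegrable_sin_div_rpow (β : ℝ) {a b : ℝ} (ha : 0 < a) (hb : 0 < b) :
    IntervalIntegrable (fun τ => Real.sin τ / τ ^ β) MeasureTheory.volume a b := by
  refine ContinuousOn.intervalIntegrable fun x hx => ContinuousAt.continuousWithinAt ?_
  have hx0 : 0 < x := (lt_min ha hb).trans_le hx.1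
  exact Real.continuous_sin.continuousAt.div
    (Real.continuousAt_rpow_const x β (Or.inl hx0.ne')) (Real.rpow_pos_of_pos hx0 β).ne'

/-- Integration by parts, with the antiderivative `c - cos` of `sin`. -/
theorem integral_sin_div_rpow_eq (β c : ℝ) {a b : ℝ} (ha : 0 < a) (hab : a ≤ b) :
    ∫ τ in a..b, Real.sin τ / τ ^ β
      = b ^ (-β) * (c - Real.cos b) - a ^ (-β) * (c - Real.cos a)
        + ∫ τ in a..b, β * τ ^ (-β - 1) * (c - Real.cos τ) := by
  have hpos : ∀ x ∈ Set.uIcc a b, 0 < x := fun x hx =>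
    ha.trans_le (Set.uIcc_of_le hab ▸ hx).1
  have hparts := intervalIntegral.integral_mul_deriv_eq_deriv_mul
    (u := fun τ : ℝ => τ ^ (-β)) (u' := fun τ : ℝ => -β * τ ^ (-β - 1))
    (v := fun τ => c - Real.cos τ) (v' := Real.sin) (a := a) (b := b)
    (fun x hx => Real.hasDerivAt_rpow_const (Or.inl (hpos x hx).ne'))
    (fun x _ => by simpa using (Real.hasDerivAt_cos x).const_sub c)
    (ContinuousOn.intervalIntegrable fun x hx =>
      (continuousAt_const.mul
        (Real.continuousAt_rpow_const x _ (Or.inl (hpos x hx).ne'))).continuousWithinAt)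
    (Real.continuous_sin.intervalIntegrable _ _)
  have hcongr : ∫ τ in a..b, Real.sin τ / τ ^ β = ∫ τ in a..b, τ ^ (-β) * Real.sin τ :=
    intervalIntegral.integral_congr fun x hx => by
      simp only [Real.rpow_neg (hpos x hx).le]
      ring
  rw [hcongr, hparts, sub_eq_add_neg _ (∫ τ in a..b, _), ← intervalIntegral.integral_neg]
  simp only [neg_mul, neg_neg]

theorem integral_sin_div_rpow_nonneg {β a b : ℝ} (hβ : 0 ≤ β) (ha : 0 < a) (hab : a ≤ b)
    (hcos : Real.cos a = 1) : 0 ≤ ∫ τ in a..b, Real.sin τ / τ ^ β := by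
  rw [integral_sin_div_rpow_eq β 1 ha hab, hcos, sub_self, mul_zero, sub_zero]
  refine add_nonneg (mul_nonneg (Real.rpow_nonneg (ha.le.trans hab) _)
    (sub_nonneg.2 (Real.cos_le_one b))) (intervalIntegral.integral_nonneg hab fun x hx => ?_)
  exact mul_nonneg (mul_nonneg hβ (Real.rpow_nonneg (ha.le.trans hx.1) _))
    (sub_nonneg.2 (Real.cos_le_one x))

theorem integral_sin_div_rpow_nonpos {β a b : ℝ} (hβ : 0 ≤ β) (ha : 0 < a) (hab : a ≤ b)
    (hcos : Real.cos a = -1) : ∫ τ in a..b, Real.sin τ / τ ^ β ≤ 0 := by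
  rw [integral_sin_div_rpow_eq β (-1) ha hab, hcos, sub_self, mul_zero, sub_zero]
  refine add_nonpos (mul_nonpos_of_nonneg_of_nonpos (Real.rpow_nonneg (ha.le.trans hab) _)
    (sub_nonpos.2 (Real.neg_one_le_cos b))) ?_
  rw [← neg_nonneg, ← intervalIntegral.integral_neg]
  refine intervalIntegral.integral_nonneg hab fun x hx => neg_nonneg.2 ?_
  exact mul_nonpos_of_nonneg_of_nonpos
    (mul_nonneg hβ (Real.rpow_nonneg (ha.le.trans hx.1) _))
    (sub_nonpos.2 (Real.neg_one_le_cos x))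

/-- For `β > 0` and `2π ≤ t₁ ≤ t₂`,
`∫_{t₁}^{t₂} (sin τ)/τ^β dτ ≤ ∫_{2π}^{3π} (sin τ)/τ^β dτ`. -/
theorem stmt_14 (β : ℝ) (hβ : 0 < β) (t₁ t₂ : ℝ)
    (h₁ : 2 * Real.pi ≤ t₁) (h₂ : t₁ ≤ t₂) :
    (∫ τ in t₁..t₂, Real.sin τ / τ ^ β)
      ≤ ∫ τ in (2 * Real.pi)..(3 * Real.pi), Real.sin τ / τ ^ β := by
  have hpi := Real.pi_pos
  have h2pi : 0 < 2 * Real.pi := by positivity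
  have h3pi : 0 < 3 * Real.pi := by positivity
  have ht₁ : 0 < t₁ := h2pi.trans_le h₁
  have ht₂ : 0 < t₂ := ht₁.trans_le h₂
  have hcos : Real.cos (3 * Real.pi) = -1 := by
    rw [show 3 * Real.pi = Real.pi + 2 * Real.pi by ring, Real.cos_add_two_pi, Real.cos_pi]
  have hstart := integral_sin_div_rpow_nonneg hβ.le h2pi h₁ Real.cos_two_pi
  have hend : ∫ τ in (3 * Real.pi)..t₂, Real.sin τ / τ ^ β ≤ 0 := by
    rcases le_total (3 * Real.pi) t₂ with h | h
    · exact integral_sin_div_rpow_nonpos hβ.le h3pi h hcos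
    · rw [intervalIntegral.integral_symm, neg_nonpos]
      refine intervalIntegral.integral_nonneg h fun x hx => ?_
      have hx₁ : 2 * Real.pi ≤ x := h₁.trans (h₂.trans hx.1)
      refine div_nonneg ?_ (Real.rpow_nonneg (h2pi.le.trans hx₁) _)
      rw [← Real.sin_sub_two_pi]
      exact Real.sin_nonneg_of_nonneg_of_le_pi (by linarith) (by linarith [hx.2])
  have hsplit₁ := intervalIntegral.integral_add_adjacent_intervals
    (intervalIntegrable_sin_div_rpow β h2pi ht₁) (intervalIntegrable_sin_div_rpow β ht₁ ht₂)
  have hsplit₂ := intervalIntegral.integral_add_adjacent_intervals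
    (intervalIntegrable_sin_div_rpow β h2pi h3pi) (intervalIntegrable_sin_div_rpow β h3pi ht₂)
  linarith
end

section
/- Let n ≥ 2 be an integer and let β ∈ (0,1]. Define g(r) = sin(−log r)/(−log r)^β for r ∈ (0,1/2), and define its ball average g̃(r) = (n/rⁿ) ∫_0^r g(ρ) ρ^{n−1} dρ. Then ∫_0^{1/2} |g(r) − g̃(r)| / r dr = +∞. In particular, the radial function x ↦ g(|x|) on the punctured ball of ℝⁿ does not satisfy the Dini condition on its deviation from ball averages centered at the origin when 0 < β ≤ 1. -/
open Set MeasureTheory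

/-- The radial profile `sin (-log r) / (-log r) ^ β`. -/
noncomputable def logSine (β r : ℝ) : ℝ := Real.sin (-Real.log r) / (-Real.log r) ^ β

/-- The mean of the radial function with profile `f` over a ball of radius `r` in dimension
`m + 1`. -/
noncomputable def radialAverage (m : ℕ) (f : ℝ → ℝ) (r : ℝ) : ℝ :=
  ((m + 1 : ℝ) / r ^ (m + 1)) * ∫ ρ in (0 : ℝ)..r, f ρ * ρ ^ m

theorem log_two_le_neg_log {r : ℝ} (hr : r ∈ Ioo (0 : ℝ) (1 / 2)) :
    Real.log 2 ≤ -Real.log r := by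
  have h := Real.log_le_log hr.1 hr.2.le
  rw [one_div, Real.log_inv] at h
  linarith

theorem neg_log_pos_of_mem {r : ℝ} (hr : r ∈ Ioo (0 : ℝ) (1 / 2)) : 0 < -Real.log r :=
  (Real.log_pos one_lt_two).trans_le (log_two_le_neg_log hr)

theorem measurable_logSine (β : ℝ) : Measurable (logSine β) := by
  unfold logSine
  fun_prop

theorem continuousAt_logSine (β : ℝ) {r : ℝ} (hr : r ∈ Ioo (0 : ℝ) (1 / 2)) :
    ContinuousAt (logSine β) r := by
  have hu := neg_log_pos_of_mem hr
  have hl : ContinuousAt (fun x => -Real.log x) r := (Real.continuousAt_log hr.1.ne').neg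
  exact (Real.continuous_sin.continuousAt.comp hl).div
    (hl.rpow_const (Or.inl hu.ne')) (Real.rpow_pos_of_pos hu β).ne'

theorem abs_logSine_le {β : ℝ} (hβ : 0 ≤ β) {r : ℝ} (hr : r ∈ Ioo (0 : ℝ) (1 / 2)) :
    |logSine β r| ≤ 1 / Real.log 2 ^ β := by
  have hu := neg_log_pos_of_mem hr
  have h2 := Real.log_pos one_lt_two
  rw [logSine, abs_div, abs_of_pos (Real.rpow_pos_of_pos hu β)]
  exact div_le_div₀ zero_le_one (Real.abs_sin_le_one _) (Real.rpow_pos_of_pos h2 β)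
    (Real.rpow_le_rpow h2.le (log_two_le_neg_log hr) hβ)

theorem abs_logSine_mul_pow_le {β : ℝ} (hβ : 0 ≤ β) (m : ℕ) {r ρ : ℝ}
    (hr : r ∈ Ioo (0 : ℝ) (1 / 2)) (hρ : ρ ∈ Ioc 0 r) :
    |logSine β ρ * ρ ^ m| ≤ 1 / Real.log 2 ^ β * r ^ m := by
  have h2 := Real.log_pos one_lt_two
  rw [abs_mul, abs_of_pos (pow_pos hρ.1 m)]
  exact mul_le_mul (abs_logSine_le hβ ⟨hρ.1, hρ.2.trans_lt hr.2⟩)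
    (pow_le_pow_left₀ hρ.1.le hρ.2 m) (pow_nonneg hρ.1.le m) (by positivity)

theorem intervalIntegrable_logSine_mul_pow {β : ℝ} (hβ : 0 ≤ β) (m : ℕ) {r : ℝ}
    (hr : r ∈ Ioo (0 : ℝ) (1 / 2)) :
    IntervalIntegrable (fun ρ => logSine β ρ * ρ ^ m) volume 0 r := by
  rw [intervalIntegrable_iff_integrableOn_Ioc_of_le hr.1.le]
  refine Measure.integrableOn_of_bounded (M := 1 / Real.log 2 ^ β * r ^ m) (by simp)
    ((measurable_logSine β).mul (measurable_id.pow_const m)).aestronglyMeasurable ?_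
  filter_upwards [ae_restrict_mem measurableSet_Ioc] with ρ hρ
  exact abs_logSine_mul_pow_le hβ m hr hρ

theorem abs_radialAverage_logSine_le {β : ℝ} (hβ : 0 ≤ β) (m : ℕ) {r : ℝ}
    (hr : r ∈ Ioo (0 : ℝ) (1 / 2)) :
    |radialAverage m (logSine β) r| ≤ (m + 1) * (1 / Real.log 2 ^ β) := by
  have hr0 := hr.1
  have h := intervalIntegral.norm_integral_le_of_norm_le_const
    (f := fun ρ => logSine β ρ * ρ ^ m) (a := 0) (b := r) fun ρ hρ =>
      abs_logSine_mul_pow_le hβ m hr (by rwa [uIoc_of_le hr0.le] at hρ)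
  rw [sub_zero, abs_of_pos hr0, Real.norm_eq_abs] at h
  rw [radialAverage, abs_mul, abs_of_pos (by positivity : 0 < (m + 1 : ℝ) / r ^ (m + 1))]
  calc _ ≤ (m + 1 : ℝ) / r ^ (m + 1) * (1 / Real.log 2 ^ β * r ^ m * r) := by gcongr
    _ = _ := by
      rw [pow_succ]
      field_simp

theorem hasDerivAt_radialAverage_logSine {β : ℝ} (hβ : 0 ≤ β) (m : ℕ) {r : ℝ}
    (hr : r ∈ Ioo (0 : ℝ) (1 / 2)) :
    HasDerivAt (radialAverage m (logSine β))
      ((m + 1) * (logSine β r - radialAverage m (logSine β) r) / r) r := by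
  have hr0 := hr.1
  have hI := intervalIntegral.integral_hasDerivAt_right
    (intervalIntegrable_logSine_mul_pow hβ m hr)
    ((measurable_logSine β).mul (measurable_id.pow_const m)).stronglyMeasurable.stronglyMeasurableAtFilter
    ((continuousAt_logSine β hr).mul (continuousAt_id.pow m))
  have hp := (hasDerivAt_const r (m + 1 : ℝ)).div (hasDerivAt_pow (m + 1) r)
    (pow_pos hr0 _).ne'
  refine (hp.mul hI).congr_deriv ?_
  simp only [radialAverage, Pi.div_apply]
  generalize ∫ ρ in (0 : ℝ)..r, logSine β ρ * ρ ^ m = J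
  push_cast
  simp only [pow_succ]
  field_simp
  ring

/-- A comparison function whose derivative is at most `sin u ^ 2 / u`. -/
theorem hasDerivAt_logComparison {u : ℝ} (hu : 0 < u) :
    HasDerivAt (fun v => Real.log v / 2 - Real.sin (2 * v) / (4 * v) + 1 / (4 * v))
      (Real.sin u ^ 2 / u - (1 - Real.sin (2 * u)) / (4 * u ^ 2)) u := by
  have h4 : HasDerivAt (fun v : ℝ => 4 * v) 4 u := by
    simpa using (hasDerivAt_id u).const_mul (4 : ℝ)
  have h2 : HasDerivAt (fun v : ℝ => 2 * v) 2 u := by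
    simpa using (hasDerivAt_id u).const_mul (2 : ℝ)
  have hne : 4 * u ≠ 0 := by positivity
  refine ((((Real.hasDerivAt_log hu.ne').div_const 2).sub (h2.sin.div h4 hne)).add
    ((hasDerivAt_const u (1 : ℝ)).div h4 hne)).congr_deriv ?_
  rw [Real.sin_sq_eq_half_sub]
  field_simp
  ring

theorem sin_sq_div_le_logSine_mul_sin {β : ℝ} (hβ : β ≤ 1) {r : ℝ} (hu : 1 ≤ -Real.log r) :
    Real.sin (-Real.log r) ^ 2 / -Real.log r ≤ logSine β r * Real.sin (-Real.log r) := by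
  have h : (-Real.log r) ^ β ≤ -Real.log r := by
    simpa using Real.rpow_le_rpow_of_exponent_le hu hβ
  rw [logSine, div_mul_eq_mul_div, ← pow_two]
  exact div_le_div_of_nonneg_left (sq_nonneg _) (Real.rpow_pos_of_pos (by linarith) β) h

theorem exp_neg_mem_Ioo {u : ℝ} (hu : 1 ≤ u) : Real.exp (-u) ∈ Ioo (0 : ℝ) (1 / 2) := by
  refine ⟨Real.exp_pos _, (Real.exp_le_exp.2 (neg_le_neg hu)).trans_lt ?_⟩
  linarith [Real.exp_neg_one_lt_half]

theorem not_integrableOn_logSine_sub_radialAverage {β : ℝ} (hβ : β ∈ Ioc (0 : ℝ) 1) (m : ℕ) :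
    ¬ IntegrableOn (fun r => |logSine β r - radialAverage m (logSine β) r| / r)
      (Ioo (0 : ℝ) (1 / 2)) := by
  intro hint
  set A := radialAverage m (logSine β) with hA
  set F : ℝ → ℝ := fun v => Real.log v / 2 - Real.sin (2 * v) / (4 * v) + 1 / (4 * v) with hF
  set φ : ℝ → ℝ := fun r => (m + 2) * (|logSine β r - A r| / r) with hφ
  have hφint : IntegrableOn φ (Ioo (0 : ℝ) (1 / 2)) := hint.const_mul _
  have hφ0 : ∀ r ∈ Ioo (0 : ℝ) (1 / 2), 0 ≤ φ r := fun r hr => by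
    have := hr.1
    positivity
  set K : ℝ := (m + 1) * (1 / Real.log 2 ^ β) with hK
  have hbound : ∀ T : ℝ, 1 ≤ T → F T - F 1 ≤ (∫ r in Ioo (0 : ℝ) (1 / 2), φ r) + 2 * K := by
    intro T hT
    have hle : Real.exp (-T) ≤ Real.exp (-1) := Real.exp_le_exp.2 (neg_le_neg hT)
    have hsub : Icc (Real.exp (-T)) (Real.exp (-1)) ⊆ Ioo (0 : ℝ) (1 / 2) := fun r hr =>
      ⟨(Real.exp_pos _).trans_le hr.1, hr.2.trans_lt (exp_neg_mem_Ioo le_rfl).2⟩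
    have hderiv : ∀ r ∈ Ioo (0 : ℝ) (1 / 2),
        HasDerivAt (fun r => -F (-Real.log r) - A r * Real.cos (-Real.log r))
          ((Real.sin (-Real.log r) ^ 2 / -Real.log r
              - (1 - Real.sin (2 * -Real.log r)) / (4 * (-Real.log r) ^ 2)) / r
            - ((m + 1) * (logSine β r - A r) / r * Real.cos (-Real.log r)
              + A r * Real.sin (-Real.log r) / r)) r := by
      intro r hr
      have hl : HasDerivAt (fun x => -Real.log x) (-r⁻¹) r :=
        (Real.hasDerivAt_log hr.1.ne').neg
      refine ((((hasDerivAt_logComparison (neg_log_pos_of_mem hr)).comp r hl).neg).sub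
        ((hasDerivAt_radialAverage_logSine hβ.1.le m hr).mul hl.cos)).congr_deriv ?_
      simp only [← hA]
      ring
    have hmain := intervalIntegral.sub_le_integral_of_hasDeriv_right_of_le hle
      (fun r hr => (hderiv r (hsub hr)).continuousAt.continuousWithinAt)
      (fun r hr => (hderiv r (hsub (Ioo_subset_Icc_self hr))).hasDerivWithinAt)
      (hφint.mono_set hsub) (fun r hr => by
        have hr' := hsub (Ioo_subset_Icc_self hr)
        have hr0 := hr'.1
        have hu : 1 ≤ -Real.log r := by
          have := Real.log_le_log hr0 hr.2.le
          rw [Real.log_exp] at this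
          linarith
        have hsin := sin_sq_div_le_logSine_mul_sin hβ.2 hu
        have hq : 0 ≤ (1 - Real.sin (2 * -Real.log r)) / (4 * (-Real.log r) ^ 2) :=
          div_nonneg (by linarith [Real.sin_le_one (2 * -Real.log r)]) (by positivity)
        have hs : (logSine β r - A r) * Real.sin (-Real.log r) ≤ |logSine β r - A r| := by
          refine (le_abs_self _).trans ?_
          rw [abs_mul]
          exact mul_le_of_le_one_right (abs_nonneg _) (Real.abs_sin_le_one _)
        have hc : -((logSine β r - A r) * Real.cos (-Real.log r)) ≤ |logSine β r - A r| := by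
          refine (neg_le_abs _).trans ?_
          rw [abs_mul]
          exact mul_le_of_le_one_right (abs_nonneg _) (Real.abs_cos_le_one _)
        have hc' := mul_le_mul_of_nonneg_left hc (by positivity : (0 : ℝ) ≤ m + 1)
        calc _ = ((Real.sin (-Real.log r) ^ 2 / -Real.log r
              - (1 - Real.sin (2 * -Real.log r)) / (4 * (-Real.log r) ^ 2))
              - ((m + 1) * (logSine β r - A r) * Real.cos (-Real.log r)
              + A r * Real.sin (-Real.log r))) / r := by ring
          _ ≤ ((m + 2) * |logSine β r - A r|) / r := by
            gcongr
            linarith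
          _ = φ r := by rw [hφ]; ring)
    have hset : ∫ r in Real.exp (-T)..Real.exp (-1), φ r ≤ ∫ r in Ioo (0 : ℝ) (1 / 2), φ r := by
      rw [intervalIntegral.integral_of_le hle]
      refine setIntegral_mono_set hφint ?_ (Ioc_subset_Icc_self.trans hsub).eventuallyLE
      filter_upwards [ae_restrict_mem measurableSet_Ioo] with r hr using hφ0 r hr
    have hAc : ∀ u : ℝ, 1 ≤ u → |A (Real.exp (-u)) * Real.cos u| ≤ K := fun u hu => by
      rw [abs_mul]
      exact (mul_le_of_le_one_right (abs_nonneg _) (Real.abs_cos_le_one _)).trans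
        (abs_radialAverage_logSine_le hβ.1.le m (exp_neg_mem_Ioo hu))
    have h1 := abs_le.1 (hAc 1 le_rfl)
    have h2 := abs_le.1 (hAc T hT)
    simp only [Real.log_exp, neg_neg] at hmain
    linarith [h1.2, h2.1]
  set C := (∫ r in Ioo (0 : ℝ) (1 / 2), φ r) + 2 * K + F 1 with hC
  have hT : 1 ≤ Real.exp (2 * (|C| + 1)) := Real.one_le_exp (by positivity)
  have h := hbound _ hT
  have hq : 0 ≤ (1 - Real.sin (2 * Real.exp (2 * (|C| + 1)))) / (4 * Real.exp (2 * (|C| + 1))) :=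
    div_nonneg (by linarith [Real.sin_le_one (2 * Real.exp (2 * (|C| + 1)))]) (by positivity)
  rw [sub_div] at hq
  have hFT : F (Real.exp (2 * (|C| + 1))) ≥ |C| + 1 := by
    simp only [hF, Real.log_exp]
    linarith
  linarith [le_abs_self C]

/-- For `n ≥ 2` and `0 < β ≤ 1`, the function
`g(r) = sin(−log r)/(−log r)^β` and its ball average
`g̃(r) = (n/rⁿ) ∫₀^r g(ρ) ρ^{n−1} dρ` satisfy `∫₀^{1/2} |g(r) − g̃(r)|/r dr = +∞`; the
radial function `x ↦ g(|x|)` fails the Dini condition on its deviation from ball averages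
centered at the origin. -/
theorem stmt_15 (n : ℕ) (hn : 2 ≤ n) (β : ℝ) (hβ : β ∈ Ioc (0:ℝ) 1)
    (g gbar : ℝ → ℝ)
    (hg : ∀ r ∈ Ioo (0:ℝ) (1/2), g r = Real.sin (-Real.log r) / (-Real.log r) ^ β)
    (hgbar : ∀ r ∈ Ioo (0:ℝ) (1/2),
      gbar r = ((n : ℝ) / r ^ n) * ∫ ρ in Ioo (0:ℝ) r, g ρ * ρ ^ ((n:ℝ) - 1)) :
    ∫⁻ r in Ioo (0:ℝ) (1/2), ENNReal.ofReal (|g r - gbar r| / r) = ⊤ := by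
  obtain ⟨m, rfl⟩ : ∃ m, n = m + 1 := ⟨n - 1, by omega⟩
  have havg : ∀ r ∈ Ioo (0 : ℝ) (1 / 2), gbar r = radialAverage m (logSine β) r := by
    intro r hr
    rw [hgbar r hr, radialAverage, intervalIntegral.integral_of_le hr.1.le,
      integral_Ioc_eq_integral_Ioo]
    push_cast
    congr 1
    refine setIntegral_congr_fun measurableSet_Ioo fun ρ hρ => ?_
    simp only [add_sub_cancel_right, Real.rpow_natCast]
    rw [hg ρ ⟨hρ.1, hρ.2.trans hr.2⟩, logSine]
  rw [setLIntegral_congr_fun (g := fun r =>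
    ENNReal.ofReal (|logSine β r - radialAverage m (logSine β) r| / r)) measurableSet_Ioo
    fun r hr => by simp only [hg r hr, havg r hr, logSine]]
  by_contra hfin
  refine not_integrableOn_logSine_sub_radialAverage hβ m ⟨?_, ?_⟩
  · refine ContinuousOn.aestronglyMeasurable (fun r hr => ?_) measurableSet_Ioo
    exact ((((continuousAt_logSine β hr).sub
      (hasDerivAt_radialAverage_logSine hβ.1.le m hr).continuousAt).abs).div
      continuousAt_id hr.1.ne').continuousWithinAt
  · rw [hasFiniteIntegral_iff_ofReal]
    · exact lt_top_iff_ne_top.2 hfin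
    · filter_upwards [ae_restrict_mem measurableSet_Ioo] with r hr
      exact div_nonneg (abs_nonneg _) hr.1.le
end

section
/- Let n ≥ 2 be an integer. Then there exist real constants C₁ and C₂ with C₁ − C₂ > 0 such that for every real A ≥ 2 the following holds: with g(r) := (−C₁ sin(−log r) − C₂ cos(−log r)) / (A + sin(−log r) − cos(−log r)) and Z(r) := r·(A + sin(−log r)) for r ∈ (0,1), the function Z is a solution of the ODE (r^{n−1}(1+g(r)) Z′(r))′ = (n−1) r^{n−3} Z(r) on (0,1). Moreover 1 + g(r) is bounded above and below by positive constants on (0,1) when A is sufficiently large. -/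
open Set Real

lemma add_sin_sub_cos_pos {A : ℝ} (hA : 2 ≤ A) (t : ℝ) : 0 < A + sin t - cos t := by
  nlinarith [sin_sq_add_cos_sq t, sq_nonneg (sin t + cos t)]

lemma hasDerivAt_sin_neg_log {r : ℝ} (hr : r ≠ 0) :
    HasDerivAt (fun s => sin (-log s)) (-(cos (-log r) / r)) r := by
  refine (hasDerivAt_log hr).neg.sin.congr_deriv ?_
  rw [Pi.neg_apply]
  ring

lemma hasDerivAt_cos_neg_log {r : ℝ} (hr : r ≠ 0) :
    HasDerivAt (fun s => cos (-log s)) (sin (-log r) / r) r := by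
  refine (hasDerivAt_log hr).neg.cos.congr_deriv ?_
  rw [Pi.neg_apply]
  ring

lemma hasDerivAt_mul_add_sin_neg_log (A : ℝ) {r : ℝ} (hr : r ≠ 0) :
    HasDerivAt (fun s => s * (A + sin (-log s))) (A + sin (-log r) - cos (-log r)) r := by
  refine ((hasDerivAt_id' r).mul ((hasDerivAt_sin_neg_log hr).const_add A)).congr_deriv ?_
  field_simp
  ring

lemma hasDerivAt_rpow_mul_add_sin_sub_cos (k A a b : ℝ) {r : ℝ} (hr : 0 < r) :
    HasDerivAt (fun s => s ^ k * (A + a * sin (-log s) - b * cos (-log s)))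
      (r ^ (k - 1) * (k * A + (k * a - b) * sin (-log r) - (k * b + a) * cos (-log r))) r := by
  have h0 := hr.ne'
  refine ((hasDerivAt_rpow_const (p := k) (Or.inl h0)).mul
    ((((hasDerivAt_sin_neg_log h0).const_mul a).const_add A).sub
      ((hasDerivAt_cos_neg_log h0).const_mul b))).congr_deriv ?_
  simp only [Pi.sub_apply]
  rw [rpow_sub_one h0]
  field_simp
  ring

lemma one_add_div_mem_Icc {A x y p q : ℝ} (hA : 3 ≤ A) (hx : |x| ≤ 1) (hy : |y| ≤ 1)
    (hp : |1 - p| ≤ 1) (hq : |1 + q| ≤ 1) :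
    1 + (-p * x - q * y) / (A + x - y) ∈ Icc ((A - 2) / (A + 2)) ((A + 2) / (A - 2)) := by
  have hpx : |(1 - p) * x| ≤ 1 := by
    rw [abs_mul]; exact mul_le_one₀ hp (abs_nonneg _) hx
  have hqy : |(1 + q) * y| ≤ 1 := by
    rw [abs_mul]; exact mul_le_one₀ hq (abs_nonneg _) hy
  rw [abs_le] at hx hy hpx hqy
  have hD : 0 < A + x - y := by linarith
  have h : 1 + (-p * x - q * y) / (A + x - y)
      = (A + (1 - p) * x - (1 + q) * y) / (A + x - y) := by
    field_simp
    ring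
  rw [h]
  constructor <;> apply div_le_div₀ <;> linarith

/-- There exist constants `C₁, C₂` with `C₁ − C₂ > 0` such that for every
`A ≥ 2`, with `g(r) = (−C₁ sin(−log r) − C₂ cos(−log r))/(A + sin(−log r) − cos(−log r))`,
the function `Z(r) = r(A + sin(−log r))` solves `(r^{n−1}(1+g)Z′)′ = (n−1)r^{n−3}Z` on
`(0,1)`; moreover `1 + g` is bounded above and below by positive constants on `(0,1)` for
all sufficiently large `A`. -/
theorem stmt_16 (n : ℕ) (hn : 2 ≤ n) :
    ∃ C₁ C₂ : ℝ, 0 < C₁ - C₂ ∧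
      (∀ A : ℝ, 2 ≤ A →
        ∃ Z' : ℝ → ℝ,
          (∀ r ∈ Ioo (0:ℝ) 1,
            HasDerivAt (fun s => s * (A + Real.sin (-Real.log s))) (Z' r) r) ∧
          (∀ r ∈ Ioo (0:ℝ) 1,
            HasDerivAt
              (fun s => s ^ ((n:ℝ) - 1) *
                (1 + (-C₁ * Real.sin (-Real.log s) - C₂ * Real.cos (-Real.log s)) /
                      (A + Real.sin (-Real.log s) - Real.cos (-Real.log s))) * Z' s)
              (((n:ℝ) - 1) * r ^ ((n:ℝ) - 3) * (r * (A + Real.sin (-Real.log r)))) r)) ∧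
      (∃ A₀ : ℝ, 2 ≤ A₀ ∧ ∀ A : ℝ, A₀ ≤ A → ∃ m M : ℝ, 0 < m ∧ 0 < M ∧
        ∀ r ∈ Ioo (0:ℝ) 1,
          m ≤ 1 + (-C₁ * Real.sin (-Real.log r) - C₂ * Real.cos (-Real.log r)) /
                (A + Real.sin (-Real.log r) - Real.cos (-Real.log r)) ∧
          1 + (-C₁ * Real.sin (-Real.log r) - C₂ * Real.cos (-Real.log r)) /
                (A + Real.sin (-Real.log r) - Real.cos (-Real.log r)) ≤ M) := by
  obtain ⟨k, hk⟩ : ∃ k : ℝ, k = (n : ℝ) - 1 := ⟨_, rfl⟩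
  have hk1 : 1 ≤ k := by
    have : (2 : ℝ) ≤ n := by exact_mod_cast hn
    linarith
  have hk2 : 0 < k ^ 2 + 1 := by positivity
  have hp : 1 - 1 / (k ^ 2 + 1) = k ^ 2 / (k ^ 2 + 1) := by
    field_simp
    ring
  have hq : 1 + (-(k / (k ^ 2 + 1)) - 1) = -(k / (k ^ 2 + 1)) := by ring
  refine ⟨1 / (k ^ 2 + 1), -(k / (k ^ 2 + 1)) - 1, ?_, fun A hA => ?_, 3, by norm_num,
    fun A hA => ?_⟩
  · have h1 : 0 < 1 / (k ^ 2 + 1) := by positivity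
    have h2 : 0 < k / (k ^ 2 + 1) := by positivity
    linarith
  · refine ⟨fun r => A + sin (-log r) - cos (-log r),
      fun r hr => hasDerivAt_mul_add_sin_neg_log A hr.1.ne', fun r hr => ?_⟩
    rw [← hk, show (n : ℝ) - 3 = k - 1 - 1 by rw [hk]; ring]
    convert hasDerivAt_rpow_mul_add_sin_sub_cos k A (k ^ 2 / (k ^ 2 + 1))
      (-(k / (k ^ 2 + 1))) hr.1 using 1
    · funext s
      have hD := (add_sin_sub_cos_pos hA (-log s)).ne'
      rw [← hp, ← hq, mul_assoc, add_mul, div_mul_cancel₀ _ hD]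
      ring
    · have hr0 := hr.1.ne'
      rw [rpow_sub_one hr0 (k - 1)]
      field_simp
      ring
  · refine ⟨(A - 2) / (A + 2), (A + 2) / (A - 2), div_pos (by linarith) (by linarith),
      div_pos (by linarith) (by linarith), fun r _ => ?_⟩
    refine one_add_div_mem_Icc hA (abs_sin_le_one _) (abs_cos_le_one _) ?_ ?_
    · rw [hp, abs_of_pos (by positivity), div_le_one hk2]
      linarith
    · rw [hq, abs_neg, abs_of_pos (by positivity), div_le_one hk2]
      nlinarith
end

section
/- Let n ≥ 2 be an integer. There exist a real-analytic bounded function g : (0,1) → ℝ with 1 + g(r) bounded above and below by positive constants, satisfying ∫_0^{1/2} g(r)/r dr = +∞ (i.e. ∫_ε^{1/2} g(r)/r dr → +∞ as ε → 0⁺), and a function Z : (0,1) → ℝ solving the ODE (r^{n−1}(1+g(r)) Z′(r))′ = (n−1) r^{n−3} Z(r) on (0,1), such that Z satisfies the finite energy condition ∫_0^1 ( |Z′(r)|² + r^{−2}|Z(r)|² ) r^{n−1} dr < ∞ and 0 < Z(r) ≤ C·r on (0,1) for some constant C > 0. -/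
open Set Filter MeasureTheory

/-- The phase `2N log r` of the log-periodic coefficient. -/
noncomputable def phase (N r : ℝ) : ℝ := 2 * N * Real.log r

/-- The reciprocal `1 / (1 + g)` of the coefficient. -/
noncomputable def recipCoeff (N r : ℝ) : ℝ :=
  1 + ((Real.sin (phase N r) + 2 * Real.cos (phase N r)) / 8
    + (N - 1) / (64 * N ^ 2) * Real.sin (phase N r) ^ 2)

/-- The flux `(1 + g) Z'`. -/
noncomputable def flux (N r : ℝ) : ℝ :=
  Real.exp (-((N - 1) / (16 * N ^ 2) * Real.cos (phase N r)))

/-- The solution of the ODE. -/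
noncomputable def solution (N r : ℝ) : ℝ :=
  r * (1 + Real.sin (phase N r) / (8 * N)) * flux N r

/-- A function whose derivative bounds `g(r) / r` from below. -/
noncomputable def lowerPrimitive (N r : ℝ) : ℝ :=
  Real.log r / 256 + (Real.cos (phase N r) - 2 * Real.sin (phase N r)) / (16 * N)
    + (Real.sin (phase N r) ^ 2 + Real.sin (phase N r) * Real.cos (phase N r)) / (256 * N)

lemma hasDerivAt_phase (N : ℝ) {r : ℝ} (hr : r ≠ 0) :
    HasDerivAt (phase N) (2 * N * r⁻¹) r :=
  (Real.hasDerivAt_log hr).const_mul _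

lemma hasDerivAt_flux {N r : ℝ} (hN : N ≠ 0) (hr : r ≠ 0) :
    HasDerivAt (flux N)
      ((N - 1) / (8 * N) * Real.sin (phase N r) / r * flux N r) r := by
  have h := (((hasDerivAt_phase N hr).cos.const_mul ((N - 1) / (16 * N ^ 2))).neg).exp
  refine h.congr_deriv ?_
  change flux N r * _ = _
  field_simp
  ring

lemma hasDerivAt_solution {N r : ℝ} (hN : N ≠ 0) (hr : r ≠ 0) :
    HasDerivAt (solution N) (recipCoeff N r * flux N r) r := by
  have h := ((hasDerivAt_id r).mul
    (((hasDerivAt_phase N hr).sin.div_const (8 * N)).const_add 1)).mul (hasDerivAt_flux hN hr)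
  refine h.congr_deriv ?_
  simp only [recipCoeff, id, Pi.mul_apply]
  field_simp
  ring

lemma quadCoeff_bounds {N : ℝ} (hN : 1 ≤ N) :
    0 ≤ (N - 1) / (64 * N ^ 2) ∧ (N - 1) / (64 * N ^ 2) ≤ 1 / 256 := by
  refine ⟨by have := sub_nonneg.2 hN; positivity, ?_⟩
  rw [div_le_div_iff₀ (by positivity) (by norm_num)]
  nlinarith [sq_nonneg (N - 2)]

lemma recipCoeff_bounds {N : ℝ} (hN : 1 ≤ N) (r : ℝ) :
    1 / 2 ≤ recipCoeff N r ∧ recipCoeff N r ≤ 3 / 2 := by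
  obtain ⟨h0, h1⟩ := quadCoeff_bounds hN
  have hs := Real.neg_one_le_sin (phase N r)
  have hs' := Real.sin_le_one (phase N r)
  have hc := Real.neg_one_le_cos (phase N r)
  have hc' := Real.cos_le_one (phase N r)
  have h2 := sq_nonneg (Real.sin (phase N r))
  have h3 := Real.sin_sq_le_one (phase N r)
  have h4 := mul_nonneg h0 h2
  have h5 := mul_le_mul h1 h3 h2 (by norm_num)
  unfold recipCoeff
  constructor <;> linarith

lemma flux_le {N : ℝ} (hN : 1 ≤ N) (r : ℝ) : flux N r ≤ Real.exp 1 := by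
  obtain ⟨h0, h1⟩ := quadCoeff_bounds hN
  have hc := Real.neg_one_le_cos (phase N r)
  have hq : (N - 1) / (16 * N ^ 2) = 4 * ((N - 1) / (64 * N ^ 2)) := by
    have : N ≠ 0 := by positivity
    field_simp
    ring
  refine Real.exp_le_exp.2 ?_
  rw [hq]
  nlinarith

lemma oscillation_bounds {N : ℝ} (hN : 1 ≤ N) (r : ℝ) :
    1 / 2 ≤ 1 + Real.sin (phase N r) / (8 * N) ∧ 1 + Real.sin (phase N r) / (8 * N) ≤ 2 := by
  have hN0 : 0 < 8 * N := by positivity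
  have hs := Real.neg_one_le_sin (phase N r)
  have hs' := Real.sin_le_one (phase N r)
  have h1 : -(1 / 2) ≤ Real.sin (phase N r) / (8 * N) := by
    rw [le_div_iff₀ hN0]; linarith
  have h2 : Real.sin (phase N r) / (8 * N) ≤ 1 := by
    rw [div_le_iff₀ hN0]; linarith
  constructor <;> linarith

lemma hasDerivAt_lowerPrimitive {N r : ℝ} (hN : N ≠ 0) (hr : r ≠ 0) :
    HasDerivAt (lowerPrimitive N)
      ((1 / 256 - (Real.sin (phase N r) + 2 * Real.cos (phase N r)) / 8
        + (Real.sin (phase N r) * Real.cos (phase N r) + Real.cos (phase N r) ^ 2 - 1 / 2) / 64)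
        / r) r := by
  have hp := hasDerivAt_phase N hr
  have h := (((Real.hasDerivAt_log hr).div_const 256).add
    ((hp.cos.sub (hp.sin.const_mul 2)).div_const (16 * N))).add
    (((hp.sin.pow 2).add (hp.sin.mul hp.cos)).div_const (256 * N))
  refine h.congr_deriv ?_
  have hsc := Real.sin_sq_add_cos_sq (phase N r)
  field_simp
  linear_combination (-32768 : ℝ) * hsc

lemma lowerPrimitive_deriv_le {N r : ℝ} (hN : 1 ≤ N) (hr : 0 < r) :
    (1 / 256 - (Real.sin (phase N r) + 2 * Real.cos (phase N r)) / 8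
        + (Real.sin (phase N r) * Real.cos (phase N r) + Real.cos (phase N r) ^ 2 - 1 / 2) / 64)
        / r ≤ ((recipCoeff N r)⁻¹ - 1) / r := by
  refine div_le_div_of_nonneg_right ?_ hr.le
  obtain ⟨h0, h1⟩ := quadCoeff_bounds hN
  obtain ⟨hl, hu⟩ := recipCoeff_bounds hN r
  unfold recipCoeff at *
  set S := Real.sin (phase N r)
  set C := Real.cos (phase N r)
  set b := (N - 1) / (64 * N ^ 2)
  have hS : S ^ 2 ≤ 1 := Real.sin_sq_le_one _
  have hS0 := sq_nonneg S
  set y := (S + 2 * C) / 8 + b * S ^ 2 with hy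
  have hinv : 1 - y + y ^ 2 / 2 ≤ (1 + y)⁻¹ := by
    rw [inv_eq_one_div, le_div_iff₀ (by linarith)]
    nlinarith [mul_nonneg (sq_nonneg y) (show 0 ≤ 1 - y by linarith)]
  have hsq : (S + 2 * C) ^ 2 / 256 - (b * S ^ 2) ^ 2 / 2 ≤ y ^ 2 / 2 := by
    rw [hy]; nlinarith [sq_nonneg ((S + 2 * C) / 8 + 2 * (b * S ^ 2))]
  have hB0 : 0 ≤ b * S ^ 2 := mul_nonneg h0 hS0
  have hB1 : b * S ^ 2 ≤ S ^ 2 / 256 := by nlinarith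
  have hB2 : (b * S ^ 2) ^ 2 ≤ 1 / 256 ^ 2 := by nlinarith
  nlinarith

lemma abs_lowerPrimitive_sub_le {N : ℝ} (hN : 1 ≤ N) (r : ℝ) :
    |lowerPrimitive N r - Real.log r / 256| ≤ 1 := by
  have hs := Real.neg_one_le_sin (phase N r)
  have hs' := Real.sin_le_one (phase N r)
  have hc := Real.neg_one_le_cos (phase N r)
  have hc' := Real.cos_le_one (phase N r)
  have hsc := Real.sin_sq_add_cos_sq (phase N r)
  have key : lowerPrimitive N r - Real.log r / 256
      = (16 * (Real.cos (phase N r) - 2 * Real.sin (phase N r))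
        + (Real.sin (phase N r) ^ 2 + Real.sin (phase N r) * Real.cos (phase N r)))
        / (256 * N) := by
    have : N ≠ 0 := by positivity
    unfold lowerPrimitive
    field_simp
    ring
  rw [key, abs_le, le_div_iff₀ (by positivity), div_le_iff₀ (by positivity)]
  constructor <;> nlinarith [sq_nonneg (Real.sin (phase N r) + Real.cos (phase N r)),
    sq_nonneg (Real.sin (phase N r) - Real.cos (phase N r))]

lemma analyticAt_recipCoeff (N : ℝ) {r : ℝ} (hr : 0 < r) : AnalyticAt ℝ (recipCoeff N) r := by
  have hp : AnalyticAt ℝ (phase N) r := analyticAt_const.mul (analyticAt_log hr)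
  have hs : AnalyticAt ℝ (fun x => Real.sin (phase N x)) r := Real.analyticAt_sin.comp hp
  have hc : AnalyticAt ℝ (fun x => Real.cos (phase N x)) r := Real.analyticAt_cos.comp hp
  unfold recipCoeff
  fun_prop

lemma tendsto_integral_coeff {N : ℝ} (hN : 1 ≤ N) :
    Tendsto (fun ε => ∫ r in ε..(1/2:ℝ), ((recipCoeff N r)⁻¹ - 1) / r)
      (nhdsWithin (0:ℝ) (Ioi 0)) atTop := by
  have hN0 : N ≠ 0 := by positivity
  have hlim : Tendsto (fun ε => lowerPrimitive N (1 / 2) - 1 + Real.log ε * (-1 / 256))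
      (nhdsWithin (0:ℝ) (Ioi 0)) atTop :=
    tendsto_atTop_add_const_left _ _
      (Real.tendsto_log_nhdsGT_zero.atBot_mul_const_of_neg (by norm_num))
  refine tendsto_atTop_mono' _ ?_ hlim
  filter_upwards [Ioo_mem_nhdsGT (show (0:ℝ) < 1 / 2 by norm_num)] with ε hε
  have hpos : ∀ x ∈ Icc ε (1 / 2), 0 < x := fun x hx => hε.1.trans_le hx.1
  have hint : ContinuousOn (fun r => ((recipCoeff N r)⁻¹ - 1) / r) (Icc ε (1 / 2)) := by
    intro x hx
    have h0 : recipCoeff N x ≠ 0 := by linarith [(recipCoeff_bounds hN x).1]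
    exact ((((analyticAt_recipCoeff N (hpos x hx)).continuousAt.inv₀ h0).sub
      continuousAt_const).div continuousAt_id (hpos x hx).ne').continuousWithinAt
  have h := intervalIntegral.sub_le_integral_of_hasDeriv_right_of_le hε.2.le
    (fun x hx => (hasDerivAt_lowerPrimitive hN0 (hpos x hx).ne').continuousAt.continuousWithinAt)
    (fun x hx => (hasDerivAt_lowerPrimitive hN0
      (hpos x (Ioo_subset_Icc_self hx)).ne').hasDerivWithinAt)
    hint.integrableOn_Icc
    (fun x hx => lowerPrimitive_deriv_le hN (hpos x (Ioo_subset_Icc_self hx)))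
  have h2 := (abs_le.1 (abs_lowerPrimitive_sub_le hN ε)).2
  linarith

lemma integrableOn_energy {N : ℝ} (hN : 1 ≤ N) :
    IntegrableOn (fun r => ((recipCoeff N r * flux N r) ^ 2 + solution N r ^ 2 / r ^ 2)
      * r ^ (N - 1)) (Ioo (0:ℝ) 1) := by
  have hN0 : N ≠ 0 := by positivity
  refine Measure.integrableOn_of_bounded (M := (2 * Real.exp 1) ^ 2 + (2 * Real.exp 1) ^ 2)
    (by simp) ?_ ?_
  · have hp : Measurable (phase N) := Real.measurable_log.const_mul _
    have : Measurable (flux N) := by unfold flux; fun_prop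
    have : Measurable (recipCoeff N) := by unfold recipCoeff; fun_prop
    have : Measurable (solution N) := by unfold solution; fun_prop
    exact Measurable.aestronglyMeasurable (by fun_prop)
  · filter_upwards [ae_restrict_mem measurableSet_Ioo] with r hr
    obtain ⟨h1, h2⟩ := recipCoeff_bounds hN r
    obtain ⟨h3, h4⟩ := oscillation_bounds hN r
    have h5 := flux_le hN r
    have h6 : 0 < flux N r := Real.exp_pos _
    have h7 : solution N r ^ 2 / r ^ 2
        = ((1 + Real.sin (phase N r) / (8 * N)) * flux N r) ^ 2 := by
      have := hr.1.ne'
      rw [← div_pow, solution, mul_assoc, mul_div_cancel_left₀ _ this]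
    have h8 : r ^ (N - 1) ≤ 1 := Real.rpow_le_one hr.1.le hr.2.le (by linarith)
    have h9 : 0 ≤ r ^ (N - 1) := Real.rpow_nonneg hr.1.le _
    rw [h7, Real.norm_of_nonneg (by positivity)]
    refine (mul_le_of_le_one_right (by positivity) h8).trans ?_
    gcongr
    linarith

/-- For `n ≥ 2` there exist a real-analytic function `g` on `(0,1)` with
`1 + g` bounded above and below by positive constants, satisfying
`∫_ε^{1/2} g(r)/r dr → +∞` as `ε → 0⁺`, and a solution `Z` of
`(r^{n−1}(1+g)Z′)′ = (n−1)r^{n−3}Z` on `(0,1)` with finite energy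
`∫₀¹ (|Z′|² + r^{−2}|Z|²) r^{n−1} dr < ∞` and `0 < Z(r) ≤ C·r` on `(0,1)`. -/
theorem stmt_18 (n : ℕ) (hn : 2 ≤ n) :
    ∃ g Z Z' : ℝ → ℝ,
      AnalyticOn ℝ g (Ioo (0:ℝ) 1) ∧
      (∃ m M : ℝ, 0 < m ∧ 0 < M ∧ ∀ r ∈ Ioo (0:ℝ) 1, m ≤ 1 + g r ∧ 1 + g r ≤ M) ∧
      Tendsto (fun ε => ∫ r in ε..(1/2:ℝ), g r / r) (nhdsWithin (0:ℝ) (Ioi 0)) atTop ∧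
      (∀ r ∈ Ioo (0:ℝ) 1, HasDerivAt Z (Z' r) r) ∧
      (∀ r ∈ Ioo (0:ℝ) 1,
        HasDerivAt (fun s => s ^ ((n:ℝ) - 1) * (1 + g s) * Z' s)
          (((n:ℝ) - 1) * r ^ ((n:ℝ) - 3) * Z r) r) ∧
      IntegrableOn (fun r => (Z' r ^ 2 + Z r ^ 2 / r ^ 2) * r ^ ((n:ℝ) - 1))
        (Ioo (0:ℝ) 1) ∧
      (∃ C : ℝ, 0 < C ∧ ∀ r ∈ Ioo (0:ℝ) 1, 0 < Z r ∧ Z r ≤ C * r) := by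
  have hN : (1:ℝ) ≤ n := by exact_mod_cast one_le_two.trans hn
  have hN0 : (n:ℝ) ≠ 0 := by positivity
  have hne : ∀ r, recipCoeff n r ≠ 0 := fun r => by linarith [(recipCoeff_bounds hN r).1]
  refine ⟨fun r => (recipCoeff n r)⁻¹ - 1, solution n, fun r => recipCoeff n r * flux n r,
    fun r hr => (((analyticAt_recipCoeff n hr.1).inv (hne r)).sub
      analyticAt_const).analyticWithinAt,
    ⟨1 / 2, 2, by norm_num, by norm_num, fun r _ => ?_⟩, tendsto_integral_coeff hN,
    fun r hr => hasDerivAt_solution hN0 hr.1.ne', fun r hr => ?_, integrableOn_energy hN,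
    2 * Real.exp 1, by positivity, fun r hr => ?_⟩
  · obtain ⟨h1, h2⟩ := recipCoeff_bounds hN r
    have h0 : 0 < recipCoeff n r := by linarith
    rw [add_sub_cancel, le_inv_comm₀ (by norm_num) h0, inv_le_comm₀ h0 (by norm_num)]
    constructor <;> linarith
  · have hr0 := hr.1.ne'
    have hfun : (fun s => s ^ ((n:ℝ) - 1) * (1 + ((recipCoeff n s)⁻¹ - 1))
        * (recipCoeff n s * flux n s)) = fun s => s ^ ((n:ℝ) - 1) * flux n s := by
      funext s
      have := hne s
      field_simp
      ring
    rw [hfun]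
    refine ((Real.hasDerivAt_rpow_const (Or.inl hr0)).mul
      (hasDerivAt_flux hN0 hr0)).congr_deriv ?_
    have e1 : r ^ ((n:ℝ) - 1) = r ^ ((n:ℝ) - 3) * r ^ 2 := by
      rw [← Real.rpow_natCast r 2, ← Real.rpow_add hr.1]; congr 1; push_cast; ring
    have e2 : r ^ ((n:ℝ) - 1 - 1) = r ^ ((n:ℝ) - 3) * r := by
      rw [← Real.rpow_add_one hr0]; congr 1; ring
    rw [e1, e2, solution]
    field_simp
  · obtain ⟨h1, h2⟩ := oscillation_bounds hN r
    have h3 := flux_le hN r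
    have h4 : 0 < flux n r := Real.exp_pos _
    have h5 : 0 < 1 + Real.sin (phase n r) / (8 * n) := by linarith
    have hr0 := hr.1
    refine ⟨by unfold solution; positivity, ?_⟩
    calc solution n r = (1 + Real.sin (phase n r) / (8 * n)) * flux n r * r := by
          unfold solution; ring
      _ ≤ 2 * Real.exp 1 * r := by gcongr
end
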